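/- arXiv:2506.17704 — 2 statements merged into one kernel-verified Lean document; each statement's English description precedes it below -/
import Mathlib

section
/- T_{max,2}(30) = 144, T_{max,3}(30) = 186, and T_{max,4}(30) = 210; in particular, for l = 30 the function m1 ↦ T_{max,m1}(30) is strictly increasing on {1, 2, 3, 4}. -/
open MvPolynomial

/-- A monomial ideal: an ideal containing the monomials of all its elements. -/
def IsMonomialIdeal (I : Ideal (MvPolynomial (Fin 3) ℂ)) : Prop :=
  ∀ p ∈ I, ∀ d ∈ p.support, (monomial d (1 : ℂ)) ∈ I

/-- Borel-fixed (strongly stable) in characteristic 0: for every monomial in `I`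
divisible by `x_j`, and every `i < j`, replacing one factor `x_j` by `x_i`
stays in `I`. -/
def IsBorelFixed (I : Ideal (MvPolynomial (Fin 3) ℂ)) : Prop :=
  ∀ d : Fin 3 →₀ ℕ, (monomial d (1 : ℂ)) ∈ I →
    ∀ i j : Fin 3, i < j → 0 < d j →
      (monomial (d + Finsupp.single i 1 - Finsupp.single j 1) (1 : ℂ)) ∈ I

/-- The dimension of the tangent space to the Hilbert scheme at `[I]`,
namely `dim_ℂ Hom_R(I, R/I)`. -/
noncomputable def tangentDim (I : Ideal (MvPolynomial (Fin 3) ℂ)) : ℕ :=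
  Module.finrank ℂ (↥I →ₗ[MvPolynomial (Fin 3) ℂ] (MvPolynomial (Fin 3) ℂ ⧸ I))

/-- `TmaxEq l m1 T` says that `T` is the maximum of `dim_ℂ Hom_R(I, R/I)` over all
Borel-fixed monomial ideals `I ⊆ ℂ[x,y,z]` of colength `l` whose smallest pure power
of `x` lying in `I` is `x^{m1}`. -/
def TmaxEq (l m1 T : ℕ) : Prop :=
  IsGreatest { t : ℕ | ∃ I : Ideal (MvPolynomial (Fin 3) ℂ),
      IsMonomialIdeal I ∧ IsBorelFixed I ∧
      Module.finrank ℂ (MvPolynomial (Fin 3) ℂ ⧸ I) = l ∧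
      (X 0 : MvPolynomial (Fin 3) ℂ) ^ m1 ∈ I ∧
      (X 0 : MvPolynomial (Fin 3) ℂ) ^ (m1 - 1) ∉ I ∧
      t = tangentDim I } T

/-- Upper end of the range of `k` for which `(x^i y^j z^k, x^p y^q z^(h p q - 1))` is a root of the
first kind. The flag `y` selects which of two reductions is used when `p < i` and `j ≤ q`. -/
def upperEnd (y : Bool) (h : ℕ → ℕ → ℕ) (i j p q : ℕ) : ℕ :=
  min (min (h p q) (if i = 0 then h p q else h (i - 1) j))
    (min (if j = 0 then h p q else h i (j - 1))
      (if y = true ∧ p < i ∧ j ≤ q then h (i - 1) (j + 1) + h p q - h p (q + 1)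
        else if j = 0 then h p q else h i j + h p q - h (p + 1) q))

/-- Lower end of the range of `t` for which `(x^i y^j z^(h i j), x^p y^q z^t)` is a root of the
second kind. -/
def lowerEnd (h : ℕ → ℕ → ℕ) (i j p q : ℕ) : ℕ :=
  max (max (h p (q + 1)) (if i = 0 then 0 else h p q + h i j - h (i - 1) j))
    (if j = 0 then 0 else
      match q with
      | 0 => h p 0 + h i j - h i (j - 1)
      | 1 => if j = 1 then 0 else
          min (h p 1 + h i j - h i (j - 1)) (h p 0 + h i j - h i (j - 2))
      | _ + 2 => 0)

/-- The heights of the columns over the `(x, y)`-plane in the staircase of a Borel-fixed ideal. -/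
structure IsBorelHeight (h : ℕ → ℕ → ℕ) : Prop where
  succ_right_le : ∀ i j, h i (j + 1) ≤ h i j - 1
  succ_left_le : ∀ i j, h (i + 1) j ≤ h i (j + 1)

namespace IsBorelHeight

variable {h : ℕ → ℕ → ℕ}

theorem right_le (hh : IsBorelHeight h) (i j : ℕ) : h i (j + 1) ≤ h i j :=
  (hh.succ_right_le i j).trans (Nat.sub_le _ _)

theorem left_le (hh : IsBorelHeight h) (i j : ℕ) : h (i + 1) j ≤ h i j :=
  (hh.succ_left_le i j).trans (hh.right_le i j)

theorem antitone_left (hh : IsBorelHeight h) (j : ℕ) : Antitone fun i => h i j :=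
  antitone_nat_of_succ_le fun i => hh.left_le i j

theorem antitone_right (hh : IsBorelHeight h) (i : ℕ) : Antitone (h i) :=
  antitone_nat_of_succ_le fun j => hh.right_le i j

end IsBorelHeight

/-- The relations between the coefficients `c i j k p q t` of `x^p y^q z^t` in `φ (x^i y^j z^k)`
for a homomorphism `φ : I → R ⧸ I`. -/
structure IsHomCoeff (h : ℕ → ℕ → ℕ) (c : ℕ → ℕ → ℕ → ℕ → ℕ → ℕ → ℂ) : Prop where
  shift : ∀ i j k p q t a b d, h i j ≤ k → t + d < h (p + a) (q + b) →
    c (i + a) (j + b) (k + d) (p + a) (q + b) (t + d) = c i j k p q t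
  eq_zero : ∀ i j k p q t a b d, h i j ≤ k → t < h p q → p < a ∨ q < b ∨ t < d →
    c (i + a) (j + b) (k + d) p q t = 0

namespace IsHomCoeff

variable {h : ℕ → ℕ → ℕ} {c : ℕ → ℕ → ℕ → ℕ → ℕ → ℕ → ℂ}

theorem shift_z (hc : IsHomCoeff h c) {i j k p q t : ℕ} (d : ℕ) (hk : h i j ≤ k)
    (ht : t + d < h p q) : c i j (k + d) p q (t + d) = c i j k p q t :=
  hc.shift i j k p q t 0 0 d hk ht

theorem shift_y (hc : IsHomCoeff h c) {i j k p q t : ℕ} (hk : h i j ≤ k)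
    (ht : t < h p (q + 1)) : c i (j + 1) k p (q + 1) t = c i j k p q t :=
  hc.shift i j k p q t 0 1 0 hk ht

theorem shift_x (hc : IsHomCoeff h c) {i j k p q t : ℕ} (hk : h i j ≤ k)
    (ht : t < h (p + 1) q) : c (i + 1) j k (p + 1) q t = c i j k p q t :=
  hc.shift i j k p q t 1 0 0 hk ht

theorem eq_zero_x (hc : IsHomCoeff h c) {i j k q t : ℕ} (hk : h i j ≤ k)
    (ht : t < h 0 q) : c (i + 1) j k 0 q t = 0 :=
  hc.eq_zero i j k 0 q t 1 0 0 hk ht (by simp)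

theorem eq_zero_y (hc : IsHomCoeff h c) {i j k p t : ℕ} (hk : h i j ≤ k)
    (ht : t < h p 0) : c i (j + 1) k p 0 t = 0 :=
  hc.eq_zero i j k p 0 t 0 1 0 hk ht (by simp)

theorem eq_zero_z (hc : IsHomCoeff h c) {i j k p q t d : ℕ} (hk : h i j ≤ k)
    (ht : t < h p q) (htd : t < d) : c i j (k + d) p q t = 0 :=
  hc.eq_zero i j k p q t 0 0 d hk ht (by simp [htd])

theorem eq_top (hc : IsHomCoeff h c) {i j k p q t : ℕ} (hk : h i j ≤ k) (ht : t < h p q) :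
    c i j k p q t = c i j (k + (h p q - 1 - t)) p q (h p q - 1) := by
  have := hc.shift_z (i := i) (j := j) (k := k) (p := p) (q := q) (t := t) (h p q - 1 - t) hk
    (by omega)
  rw [← this]
  congr 1
  omega

theorem lower_eq_zero_of_not (hh : IsBorelHeight h) (hc : IsHomCoeff h c) (y : Bool)
    (hroot : ∀ i j k p q, h i j ≤ k → k < upperEnd y h i j p q → c i j k p q (h p q - 1) = 0) :
    ∀ j i k p q t, h i j ≤ k → k ≤ t → t < h p q → ¬ (y = true ∧ p < i ∧ j ≤ q) →
      c i j k p q t = 0 := by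
  intro j
  induction j using Nat.strong_induction_on with
  | _ j ihj =>
  intro i
  induction i using Nat.strong_induction_on with
  | _ i ihi =>
  intro k p q t hk hkt ht hy
  rw [hc.eq_top hk ht]
  generalize hK : k + (h p q - 1 - t) = K
  generalize hT : h p q - 1 = T
  have hK1 : h i j ≤ K := by omega
  have hKT : K ≤ T := by omega
  have hTp : T < h p q := by omega
  clear hK
  by_cases h1 : i ≠ 0 ∧ h (i - 1) j ≤ K
  · obtain ⟨i, rfl⟩ := Nat.exists_eq_succ_of_ne_zero h1.1
    have h2 : h i j ≤ K := h1.2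
    rcases p with _ | p
    · exact hc.eq_zero_x h2 hTp
    · rw [hc.shift_x h2 hTp]
      exact ihi i (by omega) K p q T h2 hKT (hTp.trans_le (hh.left_le _ _))
        (fun ⟨a, b, d⟩ => hy ⟨a, by omega, d⟩)
  by_cases h2 : j ≠ 0 ∧ h i (j - 1) ≤ K
  · obtain ⟨j, rfl⟩ := Nat.exists_eq_succ_of_ne_zero h2.1
    have h3 : h i j ≤ K := h2.2
    rcases q with _ | q
    · exact hc.eq_zero_y h3 hTp
    · rw [hc.shift_y h3 hTp]
      exact ihj j (by omega) i K p q T h3 hKT (hTp.trans_le (hh.right_le _ _))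
        (fun ⟨a, b, d⟩ => hy ⟨a, b, by omega⟩)
  by_cases h3 : j ≠ 0 ∧ h i j + h p q - h (p + 1) q ≤ K
  · obtain ⟨j, rfl⟩ := Nat.exists_eq_succ_of_ne_zero h3.1
    have h4 := h3.2
    have hp := hh.left_le p q
    obtain ⟨a, ha⟩ : ∃ a, h p q = h (p + 1) q + a := ⟨_, (Nat.add_sub_cancel' hp).symm⟩
    obtain ⟨K, rfl⟩ : ∃ K', K = K' + a := ⟨K - a, by omega⟩
    obtain ⟨T, rfl⟩ : ∃ T', T = T' + a := ⟨T - a, by omega⟩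
    have h5 : h i (j + 1) ≤ K := by simp only [Nat.succ_eq_add_one] at h4; omega
    have h6 : h (i + 1) j ≤ K := (hh.succ_left_le i j).trans h5
    have hT1 : T < h (p + 1) q := by omega
    rw [hc.shift_z a h5 (by omega), ← hc.shift_x h5 hT1]
    rcases q with _ | q
    · exact hc.eq_zero_y h6 hT1
    · rw [hc.shift_y h6 hT1]
      exact ihj j (by omega) (i + 1) K (p + 1) q T h6 (by omega)
        (hT1.trans_le (hh.right_le _ _)) (fun ⟨a, b, d⟩ => hy ⟨a, by omega, by omega⟩)
  · rw [← hT]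
    refine hroot i j K p q hK1 ?_
    unfold upperEnd
    rw [if_neg hy]
    split_ifs at * <;> simp_all <;> omega

theorem lower_eq_zero_of_pos (hh : IsBorelHeight h) (hc : IsHomCoeff h c)
    (hroot : ∀ i j k p q, h i j ≤ k → k < upperEnd true h i j p q → c i j k p q (h p q - 1) = 0) :
    ∀ i j k p q t, h i j ≤ k → k ≤ t → t < h p q → p < i → j ≤ q →
      c i j k p q t = 0 := by
  intro i
  induction i using Nat.strong_induction_on with
  | _ i ihi =>
  intro j
  induction j using Nat.strong_induction_on with
  | _ j ihj =>
  intro k p q t hk hkt ht hpi hjq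
  rw [hc.eq_top hk ht]
  generalize hK : k + (h p q - 1 - t) = K
  generalize hT : h p q - 1 = T
  have hK1 : h i j ≤ K := by omega
  have hKT : K ≤ T := by omega
  have hTp : T < h p q := by omega
  clear hK
  obtain ⟨i, rfl⟩ := Nat.exists_eq_succ_of_ne_zero (show i ≠ 0 by omega)
  by_cases h2 : h i j ≤ K
  · rcases p with _ | p
    · exact hc.eq_zero_x h2 hTp
    · rw [hc.shift_x h2 hTp]
      exact ihi i (by omega) j K p q T h2 hKT (hTp.trans_le (hh.left_le _ _)) (by omega) hjq
  by_cases h3 : j ≠ 0 ∧ h (i + 1) (j - 1) ≤ K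
  · obtain ⟨j, rfl⟩ := Nat.exists_eq_succ_of_ne_zero h3.1
    have h3 : h (i + 1) j ≤ K := h3.2
    obtain ⟨q, rfl⟩ := Nat.exists_eq_succ_of_ne_zero (show q ≠ 0 by omega)
    rw [hc.shift_y h3 hTp]
    exact ihj j (by omega) K p q T h3 hKT (hTp.trans_le (hh.right_le _ _)) hpi (by omega)
  by_cases h4 : h i (j + 1) + h p q - h p (q + 1) ≤ K
  · have hp := hh.right_le p q
    obtain ⟨a, ha⟩ : ∃ a, h p q = h p (q + 1) + a := ⟨_, (Nat.add_sub_cancel' hp).symm⟩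
    obtain ⟨K, rfl⟩ : ∃ K', K = K' + a := ⟨K - a, by omega⟩
    obtain ⟨T, rfl⟩ : ∃ T', T = T' + a := ⟨T - a, by omega⟩
    have h5 : h i (j + 1) ≤ K := by omega
    have h6 : h (i + 1) j ≤ K := (hh.succ_left_le i j).trans h5
    have hT1 : T < h p (q + 1) := by omega
    rw [hc.shift_z a h6 (by omega), ← hc.shift_y h6 hT1]
    rcases p with _ | p
    · exact hc.eq_zero_x h5 hT1
    · rw [hc.shift_x h5 hT1]
      exact ihi i (by omega) (j + 1) K p (q + 1) T h5 (by omega)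
        (hT1.trans_le (hh.left_le _ _)) (by omega) (by omega)
  · rw [← hT]
    refine hroot (i + 1) j K p q hK1 ?_
    unfold upperEnd
    rw [if_pos (show true = true ∧ p < i + 1 ∧ j ≤ q from ⟨rfl, hpi, hjq⟩)]
    split_ifs at * <;> simp_all <;> omega

theorem lower_eq_zero (hh : IsBorelHeight h) (hc : IsHomCoeff h c) (y : Bool)
    (hroot : ∀ i j k p q, h i j ≤ k → k < upperEnd y h i j p q → c i j k p q (h p q - 1) = 0)
    {i j k p q t : ℕ} (hk : h i j ≤ k) (hkt : k ≤ t) (ht : t < h p q) : c i j k p q t = 0 := by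
  by_cases hy : y = true ∧ p < i ∧ j ≤ q
  · obtain ⟨rfl, hpi, hjq⟩ := hy
    exact lower_eq_zero_of_pos hh hc hroot i j k p q t hk hkt ht hpi hjq
  · exact lower_eq_zero_of_not hh hc y hroot j i k p q t hk hkt ht hy

theorem upper_eq_zero (hh : IsBorelHeight h) (hc : IsHomCoeff h c)
    (hroot : ∀ i j p q t, lowerEnd h i j p q ≤ t → t < min (h i j) (h p q) →
      c i j (h i j) p q t = 0) :
    ∀ i n j k p q t, h p q = n → h i j ≤ k → t < k → t < h p q → c i j k p q t = 0 := by
  intro i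
  induction i using Nat.strong_induction_on with
  | _ i ihi =>
  intro n
  induction n using Nat.strong_induction_on with
  | _ n ihn =>
  intro j k p q t hn hk htk ht
  obtain ⟨d, rfl⟩ := Nat.exists_eq_add_of_le hk
  by_cases htd : t < d
  · exact hc.eq_zero_z le_rfl ht htd
  obtain ⟨t, rfl⟩ : ∃ t', t = t' + d := ⟨t - d, by omega⟩
  rw [hc.shift_z d le_rfl ht]
  have htk : t < h i j := by omega
  have htp : t < h p q := by omega
  clear ht htd
  by_cases h1 : t < h p (q + 1)
  · rw [← hc.shift_y le_rfl h1]
    have := hh.succ_right_le p q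
    exact ihn (h p (q + 1)) (by omega) (j + 1) (h i j) p (q + 1) t rfl (hh.right_le _ _) htk h1
  by_cases h2 : i ≠ 0 ∧ t < h p q + h i j - h (i - 1) j
  · obtain ⟨i, rfl⟩ := Nat.exists_eq_succ_of_ne_zero h2.1
    have h3 : t < h p q + h (i + 1) j - h i j := h2.2
    obtain ⟨a, ha⟩ := Nat.exists_eq_add_of_le (hh.left_le i j)
    rw [← hc.shift_z a le_rfl (by omega)]
    have h4 : h i j ≤ h (i + 1) j + a := ha.le
    rcases p with _ | p
    · exact hc.eq_zero_x h4 (by omega)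
    · rw [hc.shift_x h4 (by omega)]
      have := hh.left_le p q
      exact ihi i (by omega) _ j _ p q _ rfl h4 (by simp only [Nat.succ_eq_add_one] at *; omega)
        (by omega)
  by_cases h3 : q = 0 ∧ j ≠ 0 ∧ t < h p q + h i j - h i (j - 1)
  · obtain ⟨rfl, hj, h3⟩ := h3
    obtain ⟨j, rfl⟩ := Nat.exists_eq_succ_of_ne_zero hj
    have h3 : t < h p 0 + h i (j + 1) - h i j := h3
    obtain ⟨a, ha⟩ := Nat.exists_eq_add_of_le (hh.right_le i j)
    rw [← hc.shift_z a le_rfl (by omega)]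
    exact hc.eq_zero_y ha.le (by omega)
  by_cases h4 : q = 1 ∧ 2 ≤ j ∧ t < min (h p 1 + h i j - h i (j - 1)) (h p 0 + h i j - h i (j - 2))
  · obtain ⟨rfl, hj, h4⟩ := h4
    obtain ⟨j, rfl⟩ := Nat.exists_eq_add_of_le' hj
    have h5 : t < h p 1 + h i (j + 2) - h i (j + 1) := h4.trans_le (min_le_left _ _)
    have h6 : t < h p 0 + h i (j + 2) - h i j := h4.trans_le (min_le_right _ _)
    clear h4 h3 h2
    obtain ⟨a, ha⟩ : ∃ a, h i (j + 1) = h i (j + 2) + a :=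
      Nat.exists_eq_add_of_le (hh.right_le i (j + 1))
    obtain ⟨b, hb⟩ := Nat.exists_eq_add_of_le (hh.right_le i j)
    have ha' : h i (j + 1) ≤ h i (j + 2) + a := ha.le
    have h1 := hh.right_le p 0
    rw [zero_add] at h1
    rw [← hc.shift_z a le_rfl (by omega), hc.shift_y (q := 0) ha' (by simp only [zero_add]; omega),
      ← hc.shift_z b ha' (by omega)]
    exact hc.eq_zero_y (by omega) (by omega)
  · refine hroot i j p q t ?_ (lt_min htk htp)
    unfold lowerEnd
    refine max_le (max_le (not_lt.1 h1) ?_) ?_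
    · split_ifs with hi
      · exact Nat.zero_le _
      · exact not_lt.1 fun hlt => h2 ⟨hi, hlt⟩
    · by_cases hj : j = 0
      · rw [if_pos hj]
        exact Nat.zero_le _
      · rw [if_neg hj]
        rcases q with _ | _ | q
        · exact not_lt.1 fun hlt => h3 ⟨rfl, hj, hlt⟩
        · by_cases hj1 : j = 1
          · simp [hj1]
          · simp only [if_neg hj1]
            exact not_lt.1 fun hlt => h4 ⟨rfl, by omega, hlt⟩
        · exact Nat.zero_le _

end IsHomCoeff

/-- A pair `(x^i y^j z^k, x^p y^q z^t)` of monomials, given by their exponents. -/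
abbrev MonPair := (ℕ × ℕ × ℕ) × (ℕ × ℕ × ℕ)

/-- The number of boxes of the staircase `h` above level `a`. -/
def boxesAbove (h : ℕ → ℕ → ℕ) (m N a : ℕ) : ℕ :=
  ∑ p ∈ Finset.range m, ∑ q ∈ Finset.range N, (h p q - a)

/-- The number of roots of the first kind. -/
def lowerRootBound (y : Bool) (h : ℕ → ℕ → ℕ) (m N i j : ℕ) : ℕ :=
  ∑ p ∈ Finset.range m, ∑ q ∈ Finset.range N, (upperEnd y h i j p q - h i j)

/-- The number of roots of the second kind. -/
def upperRootBound (h : ℕ → ℕ → ℕ) (m N i j : ℕ) : ℕ :=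
  ∑ p ∈ Finset.range m, ∑ q ∈ Finset.range N, (min (h i j) (h p q) - lowerEnd h i j p q)

/-- The number of roots of a staircase contained in `[0, m) × [0, N)`. -/
def rootBound (y : Bool) (h : ℕ → ℕ → ℕ) (m N : ℕ) : ℕ :=
  ∑ i ∈ Finset.range (m + 1), ∑ j ∈ Finset.range (N + 1),
    (lowerRootBound y h m N i j + upperRootBound h m N i j)

/-- The index set for the possible positions of roots. -/
def rootBox (m N : ℕ) : Finset ((ℕ × ℕ) × ℕ × ℕ) :=
  (Finset.range (m + 1) ×ˢ Finset.range (N + 1)) ×ˢ (Finset.range m ×ˢ Finset.range N)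

/-- The set of roots. -/
def rootSet (y : Bool) (h : ℕ → ℕ → ℕ) (m N : ℕ) : Finset MonPair :=
  ((rootBox m N).sigma fun b =>
      Finset.Ico (h b.1.1 b.1.2) (upperEnd y h b.1.1 b.1.2 b.2.1 b.2.2)).image
        (fun b => ((b.1.1.1, b.1.1.2, b.2), (b.1.2.1, b.1.2.2, h b.1.2.1 b.1.2.2 - 1))) ∪
  ((rootBox m N).sigma fun b =>
      Finset.Ico (lowerEnd h b.1.1 b.1.2 b.2.1 b.2.2)
        (min (h b.1.1 b.1.2) (h b.2.1 b.2.2))).image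
        (fun b => ((b.1.1.1, b.1.1.2, h b.1.1.1 b.1.1.2), (b.1.2.1, b.1.2.2, b.2)))

theorem card_rootSet_le (y : Bool) (h : ℕ → ℕ → ℕ) (m N : ℕ) :
    (rootSet y h m N).card ≤ rootBound y h m N := by
  refine (Finset.card_union_le _ _).trans
    ((Nat.add_le_add Finset.card_image_le Finset.card_image_le).trans ?_)
  simp only [Finset.card_sigma, rootBox, Finset.sum_product, Nat.card_Ico, rootBound,
    lowerRootBound, upperRootBound, Finset.sum_add_distrib, le_refl]

namespace IsHomCoeff

variable {h : ℕ → ℕ → ℕ} {c : ℕ → ℕ → ℕ → ℕ → ℕ → ℕ → ℂ}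

theorem eq_zero_of_rootSet (hh : IsBorelHeight h) (hc : IsHomCoeff h c) {y : Bool} {m N : ℕ}
    (hm : ∀ i j, m ≤ i → h i j = 0) (hN : ∀ i j, N ≤ j → h i j = 0)
    (hroot : ∀ v ∈ rootSet y h m N, c v.1.1 v.1.2.1 v.1.2.2 v.2.1 v.2.2.1 v.2.2.2 = 0)
    {i j k p q t : ℕ} (hk : h i j ≤ k) (ht : t < h p q) : c i j k p q t = 0 := by
  have hlt : ∀ {i j a}, a < h i j → i < m ∧ j < N := by
    intro i j a ha
    constructor
    · by_contra hi
      rw [hm i j (not_lt.1 hi)] at ha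
      omega
    · by_contra hj
      rw [hN i j (not_lt.1 hj)] at ha
      omega
  rcases le_or_gt k t with hkt | hkt
  · refine lower_eq_zero hh hc y (fun i j k p q h1 h2 => ?_) hk hkt ht
    refine hroot ((i, j, k), (p, q, h p q - 1)) ?_
    have hpq : k < h p q := h2.trans_le ((min_le_left _ _).trans (min_le_left _ _))
    have hi : k < if i = 0 then h p q else h (i - 1) j :=
      h2.trans_le ((min_le_left _ _).trans (min_le_right _ _))
    have hj : k < if j = 0 then h p q else h i (j - 1) :=
      h2.trans_le ((min_le_right _ _).trans (min_le_left _ _))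
    have him : i < m + 1 := by
      split_ifs at hi with h0
      · omega
      · have := hlt hi
        omega
    have hjN : j < N + 1 := by
      split_ifs at hj with h0
      · omega
      · have := hlt hj
        omega
    refine Finset.mem_union_left _ (Finset.mem_image.2 ⟨⟨((i, j), (p, q)), k⟩, ?_, rfl⟩)
    simp [rootBox, him, hjN, hlt hpq, h1, h2]
  · refine upper_eq_zero hh hc (fun i j p q t h1 h2 => ?_) i _ j k p q t rfl hk hkt ht
    refine hroot ((i, j, h i j), (p, q, t)) ?_
    obtain ⟨h3, h4⟩ := lt_min_iff.1 h2
    have := hlt h3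
    refine Finset.mem_union_right _ (Finset.mem_image.2 ⟨⟨((i, j), (p, q)), t⟩, ?_, rfl⟩)
    simp [rootBox, show i < m + 1 by omega, show j < N + 1 by omega, hlt h4, h1, h3, h4]

end IsHomCoeff

section quickBound

variable {h : ℕ → ℕ → ℕ} {m N n : ℕ}

theorem boxesAbove_le (hn : ∑ p ∈ Finset.range m, ∑ q ∈ Finset.range N, h p q = n) (a : ℕ) :
    boxesAbove h m N a ≤ n := by
  rw [← hn]
  exact Finset.sum_le_sum fun p _ => Finset.sum_le_sum fun q _ => Nat.sub_le _ _

theorem lowerRootBound_le (y : Bool) {i j a : ℕ} (ha : h i j ≤ a)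
    (hu : ∀ p q, upperEnd y h i j p q ≤ min (h p q) a) :
    lowerRootBound y h m N i j + boxesAbove h m N a ≤ boxesAbove h m N (h i j) := by
  simp only [lowerRootBound, boxesAbove, ← Finset.sum_add_distrib]
  refine Finset.sum_le_sum fun p _ => Finset.sum_le_sum fun q _ => ?_
  have := hu p q
  omega

theorem lowerRootBound_le_self (y : Bool) (i j : ℕ) :
    lowerRootBound y h m N i j ≤ boxesAbove h m N (h i j) := by
  refine Finset.sum_le_sum fun p _ => Finset.sum_le_sum fun q _ => Nat.sub_le_sub_right ?_ _
  exact (min_le_left _ _).trans (min_le_left _ _)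

theorem sum_min_sub_lowerEnd_le (hh : IsBorelHeight h) (i j p N : ℕ) :
    ∑ q ∈ Finset.range N, (min (h i j) (h p q) - lowerEnd h i j p q) + min (h i j) (h p N) ≤
      min (h i j) (h p 0) := by
  induction N with
  | zero => simp
  | succ N ih =>
    rw [Finset.sum_range_succ]
    have h1 : h p (N + 1) ≤ lowerEnd h i j p N := (le_max_left _ _).trans (le_max_left _ _)
    have := hh.right_le p N
    omega

/-- A coarser bound for the number of roots. -/
def quickBound (h : ℕ → ℕ → ℕ) (m N n : ℕ) : ℕ :=
  3 * n + 2 * ∑ p ∈ Finset.range m, (n - boxesAbove h (m + 1) N (h (p + 1) 0))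

theorem rootBound_le_quickBound (hh : IsBorelHeight h) (y : Bool)
    (hm : ∀ i j, m + 1 ≤ i → h i j = 0) (hN : ∀ i j, N ≤ j → h i j = 0)
    (hn : ∑ p ∈ Finset.range (m + 1), ∑ q ∈ Finset.range N, h p q = n) :
    rootBound y h (m + 1) N ≤ quickBound h m N n := by
  have hlow : ∀ i j p q, upperEnd y h i j p q ≤ h p q := fun i j p q =>
    (min_le_left _ _).trans (min_le_left _ _)
  have hlowi : ∀ i j p q, upperEnd y h (i + 1) j p q ≤ h i j := fun i j p q =>
    ((min_le_left _ _).trans (min_le_right _ _)).trans (by simp)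
  have hlowj : ∀ i j p q, upperEnd y h i (j + 1) p q ≤ h i j := fun i j p q =>
    ((min_le_right _ _).trans (min_le_left _ _)).trans (by simp)
  have hrow : ∀ K, ∑ j ∈ Finset.range (K + 1), lowerRootBound y h (m + 1) N 0 j ≤
      boxesAbove h (m + 1) N (h 0 K) := by
    intro K
    induction K with
    | zero => simpa using lowerRootBound_le_self y 0 0
    | succ K ih =>
      rw [Finset.sum_range_succ]
      have := lowerRootBound_le (m := m + 1) (N := N) y (hh.right_le 0 K)
        fun p q => le_min (hlow _ _ _ _) (hlowj _ _ _ _)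
      omega
  have hcol : ∀ K, ∑ i ∈ Finset.range K, lowerRootBound y h (m + 1) N (i + 1) 0 ≤
      boxesAbove h (m + 1) N (h K 0) := by
    intro K
    induction K with
    | zero => simp
    | succ K ih =>
      rw [Finset.sum_range_succ]
      have := lowerRootBound_le (m := m + 1) (N := N) y (hh.left_le K 0)
        fun p q => le_min (hlow _ _ _ _) (hlowi _ _ _ _)
      omega
  have hinner : ∀ i K, ∑ j ∈ Finset.range K, lowerRootBound y h (m + 1) N (i + 1) (j + 1) +
      boxesAbove h (m + 1) N (h (i + 1) 0) ≤ boxesAbove h (m + 1) N (h (i + 1) K) := by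
    intro i K
    induction K with
    | zero => simp
    | succ K ih =>
      rw [Finset.sum_range_succ]
      have := lowerRootBound_le (m := m + 1) (N := N) y (hh.right_le (i + 1) K)
        fun p q => le_min (hlow _ _ _ _) (hlowj _ _ _ _)
      omega
  have hlast : ∑ j ∈ Finset.range N, lowerRootBound y h (m + 1) N (m + 1) (j + 1) = 0 := by
    have := hinner m N
    rw [hm _ _ le_rfl, hm _ _ le_rfl] at this
    omega
  have hA : ∑ i ∈ Finset.range (m + 2), ∑ j ∈ Finset.range (N + 1),
      lowerRootBound y h (m + 1) N i j ≤
        2 * n + ∑ i ∈ Finset.range m, (n - boxesAbove h (m + 1) N (h (i + 1) 0)) := by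
    rw [Finset.sum_range_succ']
    simp only [Finset.sum_range_succ' _ N, Finset.sum_add_distrib]
    rw [Finset.sum_range_succ, hlast]
    have h1 := hrow N
    rw [Finset.sum_range_succ'] at h1
    have h2 := hcol (m + 1)
    have h3 := boxesAbove_le hn (h 0 N)
    have h4 := boxesAbove_le hn (h (m + 1) 0)
    have h5 := Finset.sum_le_sum fun i (_ : i ∈ Finset.range m) =>
      Nat.le_sub_of_add_le ((hinner i N).trans (boxesAbove_le hn (h (i + 1) N)))
    omega
  have hC : ∀ a, ∑ i ∈ Finset.range (m + 2), ∑ j ∈ Finset.range (N + 1), min (h i j) a +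
      boxesAbove h (m + 1) N a = n := by
    intro a
    rw [Finset.sum_range_succ, Finset.sum_eq_zero (s := Finset.range (N + 1)), add_zero, boxesAbove,
      ← Finset.sum_add_distrib, ← hn]
    · refine Finset.sum_congr rfl fun i _ => ?_
      rw [Finset.sum_range_succ, hN i N le_rfl, Nat.zero_min, add_zero, ← Finset.sum_add_distrib]
      exact Finset.sum_congr rfl fun j _ => by omega
    · intro j _
      rw [hm _ _ le_rfl, Nat.zero_min]
  have hB : ∑ i ∈ Finset.range (m + 2), ∑ j ∈ Finset.range (N + 1),
      upperRootBound h (m + 1) N i j ≤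
        n + ∑ p ∈ Finset.range m, (n - boxesAbove h (m + 1) N (h (p + 1) 0)) := by
    calc _ ≤ ∑ i ∈ Finset.range (m + 2), ∑ j ∈ Finset.range (N + 1),
          ∑ p ∈ Finset.range (m + 1), min (h i j) (h p 0) :=
          Finset.sum_le_sum fun i _ => Finset.sum_le_sum fun j _ => Finset.sum_le_sum fun p _ =>
            (Nat.le_add_right _ _).trans (sum_min_sub_lowerEnd_le hh i j p N)
      _ = ∑ p ∈ Finset.range (m + 1), ∑ i ∈ Finset.range (m + 2), ∑ j ∈ Finset.range (N + 1),
          min (h i j) (h p 0) := by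
          simp only [Finset.sum_comm (t := Finset.range (m + 1))]
      _ ≤ ∑ p ∈ Finset.range (m + 1), (n - boxesAbove h (m + 1) N (h p 0)) :=
          Finset.sum_le_sum fun p _ => Nat.le_sub_of_add_le (hC (h p 0)).le
      _ ≤ _ := by
          rw [Finset.sum_range_succ']
          have := Nat.sub_le n (boxesAbove h (m + 1) N (h 0 0))
          omega
  simp only [rootBound, quickBound, Finset.sum_add_distrib]
  exact (Nat.add_le_add hA hB).trans (by omega)

end quickBound

/-- The exponent vector of `x^i y^j z^k`. -/
noncomputable def mon (i j k : ℕ) : Fin 3 →₀ ℕ :=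
  Finsupp.equivFunOnFinite.symm ![i, j, k]

theorem mon_zero_apply (i j k : ℕ) : mon i j k 0 = i := rfl

theorem mon_one_apply (i j k : ℕ) : mon i j k 1 = j := rfl

theorem mon_two_apply (i j k : ℕ) : mon i j k 2 = k := rfl

theorem mon_apply (d : Fin 3 →₀ ℕ) : mon (d 0) (d 1) (d 2) = d := by
  ext a
  fin_cases a <;> rfl

theorem mon_add (i j k a b d : ℕ) : mon a b d + mon i j k = mon (i + a) (j + b) (k + d) := by
  ext x
  fin_cases x <;> simp [mon, add_comm]

theorem mon_inj {i j k a b d : ℕ} : mon i j k = mon a b d ↔ i = a ∧ j = b ∧ k = d := by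
  refine ⟨fun h => ⟨congrArg (· 0) h, congrArg (· 1) h, congrArg (· 2) h⟩, ?_⟩
  rintro ⟨rfl, rfl, rfl⟩
  rfl

theorem mon_le {i j k a b d : ℕ} : mon i j k ≤ mon a b d ↔ i ≤ a ∧ j ≤ b ∧ k ≤ d := by
  refine ⟨fun h => ⟨h 0, h 1, h 2⟩, ?_⟩
  rintro ⟨h0, h1, h2⟩ x
  fin_cases x <;> assumption

namespace IsMonomialIdeal

variable {I : Ideal (MvPolynomial (Fin 3) ℂ)}

theorem monomial_mem_of_le {d e : Fin 3 →₀ ℕ} (hd : monomial d (1 : ℂ) ∈ I) (hde : d ≤ e) :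
    monomial e (1 : ℂ) ∈ I := by
  have := I.mul_mem_left (monomial (e - d) 1) hd
  rwa [monomial_mul, one_mul, tsub_add_cancel_of_le hde] at this

theorem mem_of_support {p : MvPolynomial (Fin 3) ℂ}
    (hp : ∀ d ∈ p.support, monomial d (1 : ℂ) ∈ I) : p ∈ I := by
  rw [p.as_sum]
  refine I.sum_mem fun d hd => ?_
  have := I.mul_mem_left (C (coeff d p)) (hp d hd)
  rwa [C_mul_monomial, mul_one] at this

/-- The coefficient at a monomial outside of `I`, as a functional on `R ⧸ I`
(and zero for monomials in `I`). -/
noncomputable def coeffQuot (hI : IsMonomialIdeal I) (s : Fin 3 →₀ ℕ) :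
    (MvPolynomial (Fin 3) ℂ ⧸ I) →ₗ[ℂ] ℂ := by
  classical
  exact if hs : monomial s (1 : ℂ) ∈ I then 0 else
    ((I.restrictScalars ℂ).liftQ (lcoeff ℂ s) fun p hp => by
      rw [LinearMap.mem_ker, lcoeff_apply]
      by_contra h0
      exact hs (hI p hp s (mem_support_iff.2 h0))) ∘ₗ
      (Submodule.Quotient.restrictScalarsEquiv ℂ I).symm.toLinearMap

theorem coeffQuot_mk (hI : IsMonomialIdeal I) {s : Fin 3 →₀ ℕ} (hs : monomial s (1 : ℂ) ∉ I)
    (p : MvPolynomial (Fin 3) ℂ) : hI.coeffQuot s (Ideal.Quotient.mk I p) = coeff s p := by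
  rw [coeffQuot, dif_neg hs]
  rfl

theorem ext_coeffQuot (hI : IsMonomialIdeal I) {u v : MvPolynomial (Fin 3) ℂ ⧸ I}
    (h : ∀ s, monomial s (1 : ℂ) ∉ I → hI.coeffQuot s u = hI.coeffQuot s v) : u = v := by
  obtain ⟨p, rfl⟩ := Ideal.Quotient.mk_surjective u
  obtain ⟨q, rfl⟩ := Ideal.Quotient.mk_surjective v
  rw [Ideal.Quotient.eq]
  refine mem_of_support fun d hd => ?_
  by_contra hdI
  have := h d hdI
  rw [hI.coeffQuot_mk hdI, hI.coeffQuot_mk hdI] at this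
  exact mem_support_iff.1 hd (by rw [coeff_sub, this, sub_self])

theorem coeffQuot_monomial_smul_add (hI : IsMonomialIdeal I) (s e : Fin 3 →₀ ℕ)
    (hs : monomial (e + s) (1 : ℂ) ∉ I) (u : MvPolynomial (Fin 3) ℂ ⧸ I) :
    hI.coeffQuot (e + s) ((monomial e (1 : ℂ)) • u) = hI.coeffQuot s u := by
  obtain ⟨p, rfl⟩ := Ideal.Quotient.mk_surjective u
  have hs' : monomial s (1 : ℂ) ∉ I := fun h => hs (monomial_mem_of_le h le_add_self)
  rw [hI.coeffQuot_mk hs']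
  change hI.coeffQuot (e + s) (Ideal.Quotient.mk I (monomial e (1 : ℂ) * p)) = _
  rw [hI.coeffQuot_mk hs, coeff_monomial_mul, one_mul]

theorem coeffQuot_monomial_smul_of_not_le (hI : IsMonomialIdeal I) (s e : Fin 3 →₀ ℕ)
    (hs : monomial s (1 : ℂ) ∉ I) (hes : ¬ e ≤ s) (u : MvPolynomial (Fin 3) ℂ ⧸ I) :
    hI.coeffQuot s ((monomial e (1 : ℂ)) • u) = 0 := by
  obtain ⟨p, rfl⟩ := Ideal.Quotient.mk_surjective u
  change hI.coeffQuot s (Ideal.Quotient.mk I (monomial e (1 : ℂ) * p)) = _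
  rw [hI.coeffQuot_mk hs, coeff_monomial_mul', if_neg hes]

/-- The monomials outside of `I` form a basis of `R ⧸ I`. -/
noncomputable def basisQuot (hI : IsMonomialIdeal I) :
    Module.Basis {s : Fin 3 →₀ ℕ // monomial s (1 : ℂ) ∉ I} ℂ (MvPolynomial (Fin 3) ℂ ⧸ I) :=
  Module.Basis.mk (v := fun s => Ideal.Quotient.mk I (monomial s.1 1))
    (by
      rw [linearIndependent_iff']
      intro S g hg s hs
      have := congrArg (hI.coeffQuot s.1) hg
      classical
      simpa [map_sum, hI.coeffQuot_mk s.2, coeff_monomial, Subtype.coe_inj, hs] using this)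
    (by
      rintro u -
      obtain ⟨p, rfl⟩ := Ideal.Quotient.mk_surjective u
      rw [p.as_sum, map_sum]
      refine Submodule.sum_mem _ fun d _ => ?_
      have : Ideal.Quotient.mk I (monomial d (coeff d p)) =
          coeff d p • Ideal.Quotient.mk I (monomial d 1) := by
        change _ = Ideal.Quotient.mk I (coeff d p • monomial d 1)
        rw [smul_monomial, smul_eq_mul, mul_one]
      rw [this]
      refine Submodule.smul_mem _ _ ?_
      by_cases hd : monomial d (1 : ℂ) ∈ I
      · rw [Ideal.Quotient.eq_zero_iff_mem.2 hd]
        exact Submodule.zero_mem _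
      · exact Submodule.subset_span ⟨⟨d, hd⟩, rfl⟩)

theorem finrank_eq_ncard (hI : IsMonomialIdeal I) :
    Module.finrank ℂ (MvPolynomial (Fin 3) ℂ ⧸ I) = {s | monomial s (1 : ℂ) ∉ I}.ncard := by
  rw [Module.finrank_eq_nat_card_basis hI.basisQuot, ← Nat.card_coe_set_eq]
  rfl

/-- The coefficient of `x^s` in `φ (x^d)`, as a functional of `φ`. -/
noncomputable def homCoeff (hI : IsMonomialIdeal I) (d s : Fin 3 →₀ ℕ) :
    (I →ₗ[MvPolynomial (Fin 3) ℂ] (MvPolynomial (Fin 3) ℂ ⧸ I)) →ₗ[ℂ] ℂ := by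
  classical
  exact if hd : monomial d (1 : ℂ) ∈ I then
    hI.coeffQuot s ∘ₗ LinearMap.applyₗ' ℂ ⟨monomial d 1, hd⟩ else 0

theorem homCoeff_apply (hI : IsMonomialIdeal I) {d : Fin 3 →₀ ℕ} (hd : monomial d (1 : ℂ) ∈ I)
    (s : Fin 3 →₀ ℕ) (φ : I →ₗ[MvPolynomial (Fin 3) ℂ] (MvPolynomial (Fin 3) ℂ ⧸ I)) :
    hI.homCoeff d s φ = hI.coeffQuot s (φ ⟨monomial d 1, hd⟩) := by
  rw [homCoeff, dif_pos hd]
  rfl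

theorem eq_zero_of_homCoeff (hI : IsMonomialIdeal I)
    {φ : I →ₗ[MvPolynomial (Fin 3) ℂ] (MvPolynomial (Fin 3) ℂ ⧸ I)}
    (h : ∀ d s, monomial d (1 : ℂ) ∈ I → monomial s (1 : ℂ) ∉ I → hI.homCoeff d s φ = 0) :
    φ = 0 := by
  have hmon : ∀ d (hd : monomial d (1 : ℂ) ∈ I), φ ⟨monomial d 1, hd⟩ = 0 := fun d hd =>
    hI.ext_coeffQuot fun s hs => by
      rw [← hI.homCoeff_apply hd, h d s hd hs, map_zero]
  ext ⟨p, hp⟩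
  have : (⟨p, hp⟩ : I) = ∑ d ∈ p.support.attach,
      (C (coeff d.1 p) : MvPolynomial (Fin 3) ℂ) • (⟨monomial d.1 1, hI p hp d.1 d.2⟩ : I) := by
    apply Subtype.ext
    rw [AddSubmonoidClass.coe_finsetSum]
    simp only [SetLike.val_smul, smul_eq_mul, C_mul_monomial, mul_one]
    rw [Finset.sum_attach p.support fun d => monomial d (coeff d p)]
    exact p.as_sum
  rw [this, map_sum]
  exact Finset.sum_eq_zero fun d _ => by rw [map_smul, hmon, smul_zero]

theorem smul_monomial_eq {d : Fin 3 →₀ ℕ} (hd : monomial d (1 : ℂ) ∈ I) (e : Fin 3 →₀ ℕ)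
    (hed : monomial (e + d) (1 : ℂ) ∈ I) :
    (monomial e (1 : ℂ)) • (⟨monomial d 1, hd⟩ : I) = ⟨monomial (e + d) 1, hed⟩ :=
  Subtype.ext (by simp [monomial_mul])

theorem isHomCoeff (hI : IsMonomialIdeal I) {h : ℕ → ℕ → ℕ}
    (hh : ∀ i j k, monomial (mon i j k) (1 : ℂ) ∈ I ↔ h i j ≤ k)
    (φ : I →ₗ[MvPolynomial (Fin 3) ℂ] (MvPolynomial (Fin 3) ℂ ⧸ I)) :
    IsHomCoeff h fun i j k p q t => hI.homCoeff (mon i j k) (mon p q t) φ where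
  shift i j k p q t a b d hk ht := by
    have h1 := (hh i j k).2 hk
    have h2 : monomial (mon a b d + mon i j k) (1 : ℂ) ∈ I := monomial_mem_of_le h1 le_add_self
    have h3 : monomial (mon a b d + mon p q t) (1 : ℂ) ∉ I := by
      rw [mon_add, hh]
      exact not_le.2 ht
    rw [← mon_add, ← mon_add, hI.homCoeff_apply h1, hI.homCoeff_apply h2,
      ← smul_monomial_eq h1 _ h2, map_smul, hI.coeffQuot_monomial_smul_add _ _ h3]
  eq_zero i j k p q t a b d hk ht hlt := by
    have h1 := (hh i j k).2 hk
    have h2 : monomial (mon a b d + mon i j k) (1 : ℂ) ∈ I := monomial_mem_of_le h1 le_add_self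
    have h3 : monomial (mon p q t) (1 : ℂ) ∉ I := by
      rw [hh]
      exact not_le.2 ht
    rw [← mon_add, hI.homCoeff_apply h2, ← smul_monomial_eq h1 _ h2, map_smul,
      hI.coeffQuot_monomial_smul_of_not_le _ _ h3]
    rw [mon_le]
    omega

end IsMonomialIdeal

/-- A family of functionals without a common zero bounds the dimension. -/
theorem finrank_le_card_of_forall_eq_zero {V α : Type*} [AddCommGroup V] [Module ℂ V]
    (f : α → V →ₗ[ℂ] ℂ) (S : Finset α) (hf : ∀ v, (∀ s ∈ S, f s v = 0) → v = 0) :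
    Module.Finite ℂ V ∧ Module.finrank ℂ V ≤ S.card := by
  have hinj : Function.Injective (LinearMap.pi fun s : S => f s) := by
    rw [injective_iff_map_eq_zero]
    exact fun v hv => hf v fun s hs => congrFun hv ⟨s, hs⟩
  refine ⟨Module.Finite.of_injective _ hinj, ?_⟩
  simpa using LinearMap.finrank_le_finrank_of_injective hinj

theorem tangentDim_le_rootBound {I : Ideal (MvPolynomial (Fin 3) ℂ)} (hI : IsMonomialIdeal I)
    {h : ℕ → ℕ → ℕ} (hh : ∀ i j k, monomial (mon i j k) (1 : ℂ) ∈ I ↔ h i j ≤ k)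
    (hB : IsBorelHeight h) (y : Bool) {m N : ℕ}
    (hm : ∀ i j, m ≤ i → h i j = 0) (hN : ∀ i j, N ≤ j → h i j = 0) :
    Module.Finite ℂ (I →ₗ[MvPolynomial (Fin 3) ℂ] (MvPolynomial (Fin 3) ℂ ⧸ I)) ∧
      tangentDim I ≤ rootBound y h m N := by
  have := finrank_le_card_of_forall_eq_zero
    (fun v : MonPair => hI.homCoeff (mon v.1.1 v.1.2.1 v.1.2.2) (mon v.2.1 v.2.2.1 v.2.2.2))
    (rootSet y h m N) fun φ hφ => hI.eq_zero_of_homCoeff fun d s hd hs => by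
      rw [← mon_apply d, hh] at hd
      rw [← mon_apply s, hh, not_le] at hs
      rw [← mon_apply d, ← mon_apply s]
      exact (hI.isHomCoeff hh φ).eq_zero_of_rootSet hB hm hN hφ hd hs
  exact ⟨this.1, this.2.trans (card_rootSet_le y h m N)⟩

theorem X_zero_pow_eq_monomial (m : ℕ) :
    (X 0 : MvPolynomial (Fin 3) ℂ) ^ m = monomial (mon m 0 0) 1 := by
  have : Finsupp.single 0 m = mon m 0 0 := by
    ext a
    fin_cases a <;> simp [mon]
  rw [X_pow_eq_monomial, this]

/-- `h` is the height function of the staircase of `I`. -/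
def IsHeight (I : Ideal (MvPolynomial (Fin 3) ℂ)) (h : ℕ → ℕ → ℕ) : Prop :=
  ∀ i j k, monomial (mon i j k) (1 : ℂ) ∈ I ↔ h i j ≤ k

namespace IsHeight

variable {I : Ideal (MvPolynomial (Fin 3) ℂ)} {h : ℕ → ℕ → ℕ}

theorem ncard_eq (hh : IsHeight I h) {m N : ℕ} (hm : ∀ i j, m ≤ i → h i j = 0)
    (hN : ∀ i j, N ≤ j → h i j = 0) :
    {s | monomial s (1 : ℂ) ∉ I}.ncard =
      ∑ i ∈ Finset.range m, ∑ j ∈ Finset.range N, h i j := by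
  have : {s | monomial s (1 : ℂ) ∉ I} = (((Finset.range m ×ˢ Finset.range N).sigma fun b =>
      Finset.range (h b.1 b.2)).image fun b => mon b.1.1 b.1.2 b.2 : Finset (Fin 3 →₀ ℕ)) := by
    ext s
    rw [Finset.coe_image, Set.mem_image, Set.mem_ofPred_eq, ← mon_apply s, hh, not_le]
    constructor
    · intro hs
      refine ⟨⟨(s 0, s 1), s 2⟩, ?_, rfl⟩
      have h0 : s 0 < m := by
        by_contra h0
        rw [hm _ _ (not_lt.1 h0)] at hs
        omega
      have h1 : s 1 < N := by
        by_contra h1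
        rw [hN _ _ (not_lt.1 h1)] at hs
        omega
      simp [h0, h1, hs]
    · rintro ⟨⟨⟨i, j⟩, k⟩, hb, hs⟩
      obtain ⟨h0, h1, h2⟩ := mon_inj.1 hs
      dsimp only at h0 h1 h2
      rw [← h0, ← h1, ← h2]
      simp only [Finset.coe_sigma, Set.mem_sigma_iff, Finset.mem_coe, Finset.mem_range] at hb
      exact hb.2
  rw [this, Set.ncard_coe_finset, Finset.card_image_of_injective, Finset.card_sigma,
    Finset.sum_product]
  · simp only [Finset.card_range]
  · rintro ⟨⟨i, j⟩, k⟩ ⟨⟨i', j'⟩, k'⟩ hb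
    obtain ⟨h0, h1, h2⟩ := mon_inj.1 hb
    dsimp only at h0 h1 h2
    subst h0 h1 h2
    rfl

theorem exists_of_finite (hfin : {s | monomial s (1 : ℂ) ∉ I}.Finite) : ∃ h, IsHeight I h := by
  classical
  have hex : ∀ i j, ∃ k, monomial (mon i j k) (1 : ℂ) ∈ I := by
    intro i j
    by_contra! hne
    exact Set.infinite_of_injective_forall_mem (f := fun k => mon i j k)
      (fun k k' hk => (mon_inj.1 hk).2.2) hne hfin
  refine ⟨fun i j => Nat.find (hex i j), fun i j k => ⟨fun hk => Nat.find_min' _ hk, fun hk => ?_⟩⟩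
  exact IsMonomialIdeal.monomial_mem_of_le (Nat.find_spec (hex i j))
    (mon_le.2 ⟨le_rfl, le_rfl, hk⟩)

theorem isBorelHeight (hh : IsHeight I h) (hI : IsBorelFixed I) : IsBorelHeight h where
  succ_right_le i j := by
    rw [← hh]
    rcases hij : h i j with _ | k
    · exact IsMonomialIdeal.monomial_mem_of_le ((hh i j 0).2 hij.le) (mon_le.2 (by omega))
    · have := hI _ ((hh i j (k + 1)).2 hij.le) 1 2 (by decide) (by simp [mon])
      have e : mon i j (k + 1) + Finsupp.single 1 1 - Finsupp.single 2 1 = mon i (j + 1) k := by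
        ext a
        fin_cases a <;> simp [mon, Matrix.vecHead, Matrix.vecTail]
      rwa [e] at this
  succ_left_le i j := by
    rw [← hh]
    have := hI _ ((hh i (j + 1) _).2 le_rfl) 0 1 (by decide) (by simp [mon])
    have e : mon i (j + 1) (h i (j + 1)) + Finsupp.single 0 1 - Finsupp.single 1 1 =
        mon (i + 1) j (h i (j + 1)) := by
      ext a
      fin_cases a <;> simp [mon, Matrix.vecHead, Matrix.vecTail]
    rwa [e] at this

theorem isBorelFixed (hh : IsHeight I h) (hB : IsBorelHeight h) : IsBorelFixed I := by
  intro d hd a b hab hb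
  rw [← mon_apply d, hh] at hd
  have hright := hB.succ_right_le (d 0) (d 1)
  suffices ∀ s, d + Finsupp.single a 1 - Finsupp.single b 1 = s → monomial s (1 : ℂ) ∈ I from
    this _ rfl
  intro s hs
  rw [← mon_apply s, hh]
  have key : (a = 0 ∧ b = 1) ∨ (a = 0 ∧ b = 2) ∨ (a = 1 ∧ b = 2) := by
    clear hs hb
    revert a b
    decide
  subst hs
  rcases key with ⟨rfl, rfl⟩ | ⟨rfl, rfl⟩ | ⟨rfl, rfl⟩
  · have := hB.succ_left_le (d 0) (d 1 - 1)
    rw [Nat.sub_add_cancel hb] at this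
    simp
    omega
  · have := hB.succ_left_le (d 0) (d 1)
    simp
    omega
  · simp
    omega

theorem le_ncard (hh : IsHeight I h) (hfin : {s | monomial s (1 : ℂ) ∉ I}.Finite) (i j : ℕ) :
    h i j ≤ {s | monomial s (1 : ℂ) ∉ I}.ncard := by
  have : (((Finset.range (h i j)).image fun k => mon i j k : Finset (Fin 3 →₀ ℕ)) : Set _) ⊆
      {s | monomial s (1 : ℂ) ∉ I} := by
    rw [Finset.coe_image]
    rintro _ ⟨k, hk, rfl⟩
    rw [Set.mem_ofPred_eq, hh, not_le]
    simpa using hk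
  have := Set.ncard_le_ncard this hfin
  rwa [Set.ncard_coe_finset,
    Finset.card_image_of_injective _ fun k k' hk => (mon_inj.1 hk).2.2, Finset.card_range] at this

end IsHeight

theorem IsBorelHeight.eq_zero_of_le {h : ℕ → ℕ → ℕ} (hB : IsBorelHeight h) {i j n : ℕ}
    (hn : h i 0 ≤ n) (hj : n ≤ j) : h i j = 0 := by
  have : ∀ j, h i j ≤ h i 0 - j := by
    intro j
    induction j with
    | zero => simp
    | succ j ih =>
      have := hB.succ_right_le i j
      omega
  have := this j
  omega

/-- The conjunction of `f v`, for `v < n`. -/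
def allBelow (f : ℕ → Bool) : ℕ → Bool
  | 0 => true
  | n + 1 => f n && allBelow f n

theorem allBelow_iff {f : ℕ → Bool} {n : ℕ} : allBelow f n = true ↔ ∀ v < n, f v = true := by
  induction n with
  | zero => simp [allBelow]
  | succ n ih =>
    rw [allBelow, Bool.and_eq_true, ih, Nat.forall_lt_succ_right, and_comm]

/-- The minimum, in a form suited to evaluation. -/
def minSub (a b : ℕ) : ℕ := Nat.sub a (Nat.sub a b)

theorem minSub_eq (a b : ℕ) : minSub a b = min a b := by
  have : minSub a b = a - (a - b) := rfl
  omega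

/-- The maximum, in a form suited to evaluation. -/
def maxSub (a b : ℕ) : ℕ := Nat.add a (Nat.sub b a)

theorem maxSub_eq (a b : ℕ) : maxSub a b = max a b := by
  have : maxSub a b = a + (b - a) := rfl
  omega

/-- The condition `k` holds for all strictly decreasing lists of positive integers with sum at most
`n` and first entry at most `c` that are bounded by the given list. -/
def allStrict : List ℕ → ℕ → ℕ → (List ℕ → Bool) → Bool
  | [], _, _, k => k []
  | b :: bs, c, n, k => k [] && allBelow (fun v =>
      allStrict bs v (Nat.sub n (Nat.succ v)) fun l => k (Nat.succ v :: l)) (minSub b (minSub c n))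

/-- The condition `k` holds for all candidates for the rows of heights of a Borel-fixed staircase
with `m` nonempty rows, the first of which is bounded by the given list, and with `n` boxes. -/
def allRows : ℕ → List ℕ → ℕ → (List (List ℕ) → Bool) → Bool
  | 0, _, 0, k => k []
  | 0, _, _ + 1, _ => true
  | m + 1, bs, n, k => !Nat.ble n (Nat.mul (Nat.succ m) bs.sum) ||
      allStrict bs n n fun l => match l with
        | [] => true
        | u :: l' => allRows m l' (Nat.sub n (Nat.add u l'.sum)) fun r => k ((u :: l') :: r)

/-- The height function with given rows. -/
def height (r : List (List ℕ)) (i j : ℕ) : ℕ :=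
  (r.getD i []).getD j 0

/-- The sum `f 0 + ⋯ + f (n - 1)`, in a form suited to evaluation. -/
def sumTo (f : ℕ → ℕ) : ℕ → ℕ
  | 0 => 0
  | n + 1 => Nat.add (sumTo f n) (f n)

theorem sumTo_eq (f : ℕ → ℕ) (n : ℕ) : sumTo f n = ∑ i ∈ Finset.range n, f i := by
  induction n with
  | zero => rfl
  | succ n ih =>
    rw [Finset.sum_range_succ, ← ih]
    rfl

/-- The sum of the truncated differences `u - a`, for `u` in the list. -/
def excess (a : ℕ) : List ℕ → ℕ
  | [] => 0
  | u :: l => Nat.add (Nat.sub u a) (excess a l)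

theorem excess_append (a : ℕ) (l l' : List ℕ) :
    excess a (l ++ l') = excess a l + excess a l' := by
  induction l with
  | nil => simp [excess]
  | cons u l ih => simp [excess, ih, add_assoc]

theorem excess_zero (l : List ℕ) : excess 0 l = l.sum := by
  induction l with
  | nil => rfl
  | cons u l ih => simp [excess, ih]

theorem excess_eq_sum (a : ℕ) {l : List ℕ} {N : ℕ} (hN : ∀ j, N ≤ j → l.getD j 0 = 0) :
    excess a l = ∑ j ∈ Finset.range N, (l.getD j 0 - a) := by
  induction l generalizing N with
  | nil => simp [excess]
  | cons u l ih =>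
    have hl : ∀ j, N - 1 ≤ j → l.getD j 0 = 0 := fun j hj => by
      simpa using hN (j + 1) (by omega)
    rw [excess, ih hl]
    rcases N with _ | N
    · have : u = 0 := by simpa using hN 0 le_rfl
      simp [this]
    · rw [Finset.sum_range_succ']
      simp [add_comm]

theorem excess_flatten (a : ℕ) {r : List (List ℕ)} {N : ℕ}
    (hN : ∀ i j, N ≤ j → height r i j = 0) :
    excess a r.flatten = boxesAbove (height r) r.length N a := by
  induction r with
  | nil => simp [excess, boxesAbove]
  | cons l r ih =>
    rw [List.flatten_cons, excess_append, ih fun i j hj => by simpa [height] using hN (i + 1) j hj,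
      boxesAbove, boxesAbove, List.length_cons, Finset.sum_range_succ', add_comm,
      excess_eq_sum a fun j hj => by simpa [height] using hN 0 j hj]
    simp [height]

/-- Evaluation of list entries. -/
def rowEntry : List ℕ → ℕ → ℕ
  | [], _ => 0
  | u :: _, 0 => u
  | _ :: l, j + 1 => rowEntry l j

theorem rowEntry_eq (l : List ℕ) (j : ℕ) : rowEntry l j = l.getD j 0 := by
  fun_induction rowEntry l j <;> simp_all

/-- Evaluation of `height`. -/
def entry : List (List ℕ) → ℕ → ℕ → ℕ
  | [], _, _ => 0
  | l :: _, 0, j => rowEntry l j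
  | _ :: r, i + 1, j => entry r i j

theorem entry_eq (r : List (List ℕ)) : entry r = height r := by
  ext i j
  fun_induction entry r i j <;> simp_all [height, rowEntry_eq]

/-- Evaluation of `quickBound`. -/
def quickEval (r : List (List ℕ)) (m n : ℕ) : ℕ :=
  let L := r.flatten
  Nat.add (Nat.mul 3 n)
    (Nat.mul 2 (sumTo (fun p => Nat.sub n (excess (entry r (Nat.succ p) 0) L)) m))

/-- Evaluation of `upperEnd`. -/
def upperEndEval (y : Bool) (h : ℕ → ℕ → ℕ) (i j p q : ℕ) : ℕ :=
  minSub (minSub (h p q) (match i with | 0 => h p q | i + 1 => h i j))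
    (minSub (match j with | 0 => h p q | j + 1 => h i j)
      (cond (y && Nat.ble (Nat.succ p) i && Nat.ble j q)
        (Nat.sub (Nat.add (h (Nat.pred i) (Nat.succ j)) (h p q)) (h p (Nat.succ q)))
        (match j with
          | 0 => h p q
          | j + 1 => Nat.sub (Nat.add (h i (Nat.succ j)) (h p q)) (h (Nat.succ p) q))))

theorem upperEndEval_eq (y : Bool) (h : ℕ → ℕ → ℕ) (i j p q : ℕ) :
    upperEndEval y h i j p q = upperEnd y h i j p q := by
  have hy : (y && Nat.ble (Nat.succ p) i && Nat.ble j q) = decide (y = true ∧ p < i ∧ j ≤ q) := by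
    rw [Bool.eq_iff_iff]
    simp [and_assoc]
  simp only [upperEndEval, upperEnd, minSub_eq, hy, Bool.cond_decide]
  rcases i with _ | i <;> rcases j with _ | j <;> rfl

/-- Evaluation of `lowerEnd`. -/
def lowerEndEval (h : ℕ → ℕ → ℕ) (i j p q : ℕ) : ℕ :=
  maxSub (maxSub (h p (Nat.succ q)) (match i with
      | 0 => 0
      | i + 1 => Nat.sub (Nat.add (h p q) (h (Nat.succ i) j)) (h i j)))
    (match j with
      | 0 => 0
      | j + 1 => match q with
        | 0 => Nat.sub (Nat.add (h p 0) (h i (Nat.succ j))) (h i j)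
        | 1 => match j with
          | 0 => 0
          | j' + 1 => minSub (Nat.sub (Nat.add (h p 1) (h i (Nat.succ j))) (h i j))
              (Nat.sub (Nat.add (h p 0) (h i (Nat.succ j))) (h i j'))
        | _ + 2 => 0)

theorem lowerEndEval_eq (h : ℕ → ℕ → ℕ) (i j p q : ℕ) :
    lowerEndEval h i j p q = lowerEnd h i j p q := by
  simp only [lowerEndEval, lowerEnd, minSub_eq, maxSub_eq]
  rcases i with _ | i <;> rcases j with _ | _ | j <;> rcases q with _ | _ | q <;> rfl

/-- Evaluation of `rootBound`. -/
def rootEval (y : Bool) (h : ℕ → ℕ → ℕ) (m N : ℕ) : ℕ :=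
  sumTo (fun i => sumTo (fun j => Nat.add
    (sumTo (fun p => sumTo (fun q => Nat.sub (upperEndEval y h i j p q) (h i j)) N) m)
    (sumTo (fun p => sumTo (fun q => Nat.sub (minSub (h i j) (h p q)) (lowerEndEval h i j p q)) N)
      m)) (Nat.succ N)) (Nat.succ m)

theorem rootEval_eq (y : Bool) (h : ℕ → ℕ → ℕ) (m N : ℕ) :
    rootEval y h m N = rootBound y h m N := by
  simp only [rootEval, sumTo_eq, rootBound, lowerRootBound, upperRootBound, upperEndEval_eq,
    lowerEndEval_eq, minSub_eq]
  rfl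

/-- Check that one of the bounds shows that there are at most `T` roots. -/
def checkRows (m n T : ℕ) (r : List (List ℕ)) : Bool :=
  let N := (r.headD []).length
  Nat.ble (quickEval r m n) T || Nat.ble (rootEval true (entry r) (Nat.succ m) N) T ||
    Nat.ble (rootEval false (entry r) (Nat.succ m) N) T

theorem exists_of_allStrict {bs : List ℕ} {c n : ℕ} {k : List ℕ → Bool}
    (hk : allStrict bs c n k = true) {f : ℕ → ℕ} (hf : ∀ j, f (j + 1) ≤ f j - 1)
    (hbs : ∀ j, f j ≤ bs.getD j 0) (hc : f 0 ≤ c) (hn : ∀ K, ∑ j ∈ Finset.range K, f j ≤ n) :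
    ∃ l, k l = true ∧ ∀ j, l.getD j 0 = f j := by
  induction bs generalizing c n f k with
  | nil => exact ⟨[], hk, fun j => by simpa [eq_comm] using hbs j⟩
  | cons b bs ih =>
    rw [allStrict, Bool.and_eq_true, allBelow_iff] at hk
    rcases hv : f 0 with _ | v
    · refine ⟨[], hk.1, fun j => ?_⟩
      have : ∀ j, f j = 0 := fun j => by
        induction j with
        | zero => exact hv
        | succ j ih => exact Nat.le_zero.1 ((hf j).trans (by omega))
      simp [this]
    · have h0 : f 0 ≤ b := by simpa using hbs 0
      have h1 : f 0 ≤ n := by simpa using hn 1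
      obtain ⟨l, hl, hlf⟩ := ih (hk.2 v (by rw [minSub_eq, minSub_eq]; omega))
        (f := fun j => f (j + 1)) (fun j => hf (j + 1))
        (fun j => by simpa using hbs (j + 1)) ((hf 0).trans (by omega)) fun K => by
          have := hn (K + 1)
          rw [Finset.sum_range_succ', hv] at this
          exact Nat.le_sub_of_add_le this
      refine ⟨(v + 1) :: l, hl, fun j => ?_⟩
      rcases j with _ | j
      · simp [hv]
      · simpa using hlf j

theorem exists_of_allRows {m L : ℕ} {bs : List ℕ} {n : ℕ} {k : List (List ℕ) → Bool}
    (hk : allRows m bs n k = true) {h : ℕ → ℕ → ℕ} (hB : IsBorelHeight h)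
    (hbs : ∀ j, h 0 j ≤ bs.getD j 0) (hm : ∀ i j, m ≤ i → h i j = 0) (hpos : ∀ i < m, h i 0 ≠ 0)
    (hL : ∀ i j, L ≤ j → h i j = 0)
    (hn : ∑ i ∈ Finset.range m, ∑ j ∈ Finset.range L, h i j = n) :
    ∃ r, k r = true ∧ r.length = m ∧ height r = h := by
  induction m generalizing bs n h k with
  | zero =>
    obtain rfl : 0 = n := by simpa using hn
    refine ⟨[], hk, rfl, ?_⟩
    ext i j
    simp [height, hm i j (Nat.zero_le _)]
  | succ m ih =>
    have hle : n ≤ (m + 1) * bs.sum := by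
      have hrow : ∀ i, ∑ j ∈ Finset.range L, h i j ≤ bs.sum := fun i => by
        rw [← excess_zero, excess_eq_sum 0 (N := max L bs.length) fun j hj => by
          simp [(le_max_right L bs.length).trans hj]]
        refine (Finset.sum_le_sum_of_subset (Finset.range_mono (le_max_left L bs.length))).trans
          (Finset.sum_le_sum fun j _ => ?_)
        exact (hB.antitone_left j (Nat.zero_le i)).trans (hbs j)
      rw [← hn]
      simpa using Finset.sum_le_card_nsmul (Finset.range (m + 1)) _ _ fun i _ => hrow i
    rw [Finset.sum_range_succ'] at hn
    have hsum : ∀ K, ∑ j ∈ Finset.range K, h 0 j ≤ n := fun K => by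
      have h1 : ∑ j ∈ Finset.range K, h 0 j ≤ ∑ j ∈ Finset.range (max K L), h 0 j :=
        Finset.sum_le_sum_of_subset (Finset.range_mono (le_max_left _ _))
      have h2 : ∑ j ∈ Finset.range (max K L), h 0 j = ∑ j ∈ Finset.range L, h 0 j := by
        refine (Finset.sum_subset (Finset.range_mono (le_max_right _ _)) fun j _ hj => ?_).symm
        exact hL 0 j (by simpa using hj)
      omega
    rw [allRows, Bool.or_eq_true, Bool.not_eq_true', ← Bool.not_eq_true, Nat.ble_eq] at hk
    obtain ⟨l, hl, hlf⟩ := exists_of_allStrict (hk.resolve_left (not_not.2 hle))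
      (hB.succ_right_le 0) hbs (by simpa using hsum 1) hsum
    have hls : l.sum = ∑ j ∈ Finset.range L, h 0 j := by
      rw [← excess_zero, excess_eq_sum 0 (N := L) fun j hj => by rw [hlf, hL 0 j hj]]
      simp only [hlf, Nat.sub_zero]
    rcases l with _ | ⟨u, l⟩
    · exact absurd (hlf 0).symm (by simpa using hpos 0 (Nat.succ_pos _))
    rw [List.sum_cons] at hls
    obtain ⟨r, hr, hrm, hrh⟩ := ih hl (h := fun i => h (i + 1))
      ⟨fun i => hB.succ_right_le (i + 1), fun i => hB.succ_left_le (i + 1)⟩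
      (fun j => (hB.succ_left_le 0 j).trans (by rw [← hlf]; simp))
      (fun i j hi => hm (i + 1) j (by omega)) (fun i hi => hpos (i + 1) (by omega))
      (fun i => hL (i + 1)) (by rw [← hn, ← hls]; exact (Nat.add_sub_cancel _ _).symm)
    refine ⟨(u :: l) :: r, hr, by rw [List.length_cons, hrm], ?_⟩
    ext i j
    rcases i with _ | i
    · simpa [height] using hlf j
    · simpa [height] using congrFun (congrFun hrh i) j

theorem quickEval_eq {r : List (List ℕ)} {m N : ℕ} (hr : r.length = m + 1)
    (hN : ∀ i j, N ≤ j → height r i j = 0) (n : ℕ) :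
    quickEval r m n = quickBound (height r) m N n := by
  simp only [quickEval, quickBound, sumTo_eq, excess_flatten _ hN, hr, entry_eq]
  rfl

theorem tangentDim_le_of_checkRows {m n T : ℕ} (hn0 : n ≠ 0)
    (hT : allRows (m + 1) (List.replicate n n) n (checkRows m n T) = true)
    {I : Ideal (MvPolynomial (Fin 3) ℂ)} (hI : IsMonomialIdeal I) (hIB : IsBorelFixed I)
    (hn : Module.finrank ℂ (MvPolynomial (Fin 3) ℂ ⧸ I) = n)
    (hm : (X 0 : MvPolynomial (Fin 3) ℂ) ^ (m + 1) ∈ I)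
    (hm' : (X 0 : MvPolynomial (Fin 3) ℂ) ^ m ∉ I) :
    Module.Finite ℂ (I →ₗ[MvPolynomial (Fin 3) ℂ] (MvPolynomial (Fin 3) ℂ ⧸ I)) ∧
      tangentDim I ≤ T := by
  rw [hI.finrank_eq_ncard] at hn
  have hfin : {s | monomial s (1 : ℂ) ∉ I}.Finite := Set.finite_of_ncard_ne_zero (by omega)
  obtain ⟨h, hh⟩ := IsHeight.exists_of_finite hfin
  have hB := hh.isBorelHeight hIB
  have hle : ∀ i j, h i j ≤ n := fun i j => hn ▸ hh.le_ncard hfin i j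
  have hL : ∀ i j, n ≤ j → h i j = 0 := fun i j => hB.eq_zero_of_le (hle i 0)
  rw [X_zero_pow_eq_monomial, hh] at hm hm'
  have hm0 : ∀ i j, m + 1 ≤ i → h i j = 0 := fun i j hi => by
    have h1 : h i j ≤ h (m + 1) j := hB.antitone_left j hi
    have h2 : h (m + 1) j ≤ h (m + 1) 0 := hB.antitone_right (m + 1) (Nat.zero_le j)
    omega
  have hpos : ∀ i < m + 1, h i 0 ≠ 0 := fun i hi => by
    have h1 : h m 0 ≤ h i 0 := hB.antitone_left 0 (Nat.lt_succ_iff.1 hi)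
    omega
  rw [hh.ncard_eq hm0 hL] at hn
  obtain ⟨r, hcheck, hrm, rfl⟩ := exists_of_allRows hT hB
    (fun j => by
      rcases lt_or_ge j n with hj | hj
      · simp [hj, hle]
      · simp [hL 0 j hj]) hm0 hpos hL hn
  have hN : ∀ i j, (r.headD []).length ≤ j → height r i j = 0 := fun i j hj => by
    refine Nat.le_zero.1 ((hB.antitone_left j (Nat.zero_le i)).trans ?_)
    rcases r with _ | ⟨l, r⟩
    · simp [height]
    · have : l.length ≤ j := hj
      simp [height, this]
  have hN' : ∑ i ∈ Finset.range (m + 1), ∑ j ∈ Finset.range (r.headD []).length,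
      height r i j = n := by
    rw [← hh.ncard_eq hm0 hN, hh.ncard_eq hm0 hL, hn]
  have hbound := fun y => tangentDim_le_rootBound hI hh hB y hm0 hN
  refine ⟨(hbound true).1, ?_⟩
  simp only [checkRows, Bool.or_eq_true, Nat.ble_eq, rootEval_eq, entry_eq, quickEval_eq hrm hN]
    at hcheck
  rcases hcheck with (hc | hc) | hc
  · exact (hbound true).2.trans ((rootBound_le_quickBound hB true hm0 hN hN').trans hc)
  · exact (hbound true).2.trans hc
  · exact (hbound false).2.trans hc

namespace MonPair

/-- Boolean equality of pairs of monomials. -/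
def eqb (v w : MonPair) : Bool :=
  Nat.beq v.1.1 w.1.1 && Nat.beq v.1.2.1 w.1.2.1 && Nat.beq v.1.2.2 w.1.2.2 &&
    Nat.beq v.2.1 w.2.1 && Nat.beq v.2.2.1 w.2.2.1 && Nat.beq v.2.2.2 w.2.2.2

theorem eqb_iff {v w : MonPair} : eqb v w = true ↔ v = w := by
  obtain ⟨⟨a, b, c⟩, d, e, f⟩ := v
  obtain ⟨⟨a', b', c'⟩, d', e', f'⟩ := w
  simp [eqb, and_assoc]

/-- Membership in a list of pairs of monomials. -/
def memb (v : MonPair) (L : List MonPair) : Bool := L.any (eqb v)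

theorem memb_iff {v : MonPair} {L : List MonPair} : memb v L = true ↔ v ∈ L := by
  simp [memb, eqb_iff]

/-- Multiplication of both entries by the same monomial. -/
def up (e : ℕ × ℕ × ℕ) (v : MonPair) : MonPair :=
  ((v.1.1 + e.1, v.1.2.1 + e.2.1, v.1.2.2 + e.2.2), (v.2.1 + e.1, v.2.2.1 + e.2.1, v.2.2.2 + e.2.2))

/-- Division of both entries by the same monomial. -/
def down (e : ℕ × ℕ × ℕ) (v : MonPair) : MonPair :=
  ((v.1.1 - e.1, v.1.2.1 - e.2.1, v.1.2.2 - e.2.2), (v.2.1 - e.1, v.2.2.1 - e.2.1, v.2.2.2 - e.2.2))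

/-- Divisibility of monomials. -/
def dvdb (e s : ℕ × ℕ × ℕ) : Bool := e.1.ble s.1 && e.2.1.ble s.2.1 && e.2.2.ble s.2.2

/-- The monomial with the given exponents lies in the ideal with height function `h`. -/
def inside (h : ℕ → ℕ → ℕ) (s : ℕ × ℕ × ℕ) : Bool := (h s.1 s.2.1).ble s.2.2

/-- The exponents of the variables. -/
def units : List (ℕ × ℕ × ℕ) := [(1, 0, 0), (0, 1, 0), (0, 0, 1)]

/-- The pairs adjacent to `v`. -/
def adjacent (h : ℕ → ℕ → ℕ) (v : MonPair) : List MonPair :=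
  units.flatMap fun e =>
    (if inside h (up e v).2 then [] else [up e v]) ++
      if dvdb e v.1 && inside h (down e v).1 then [down e v] else []

/-- The search for the pairs connected to those in the stack. -/
def explore (h : ℕ → ℕ → ℕ) : ℕ → List MonPair → List MonPair → List MonPair
  | 0, _, L => L
  | _ + 1, [], L => L
  | n + 1, v :: S, L =>
    if memb v L then explore h n S L else explore h n (adjacent h v ++ S) (v :: L)

/-- The pairs are closed under adjacency, and no division leads out of the ring. -/
def closed (h : ℕ → ℕ → ℕ) (L : List MonPair) : Bool :=
  L.all fun v => units.all fun e =>
    (inside h (up e v).2 || memb (up e v) L) &&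
      (!(dvdb e v.1 && inside h (down e v).1) || (dvdb e v.2 && memb (down e v) L))

/-- The list of all roots of the staircase. -/
def roots (h : ℕ → ℕ → ℕ) (m N : ℕ) : List MonPair :=
  (List.range (m + 1)).flatMap fun i => (List.range (N + 1)).flatMap fun j =>
    (List.range m).flatMap fun p => (List.range N).flatMap fun q =>
      ((List.range (upperEnd true h i j p q - h i j)).map fun k =>
        ((i, j, h i j + k), (p, q, h p q - 1))) ++
      ((List.range (min (h i j) (h p q) - lowerEnd h i j p q)).map fun t =>
        ((i, j, h i j), (p, q, lowerEnd h i j p q + t)))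

/-- The roots lie in pairwise different components, which are found by a search with `n` steps. -/
def separated (h : ℕ → ℕ → ℕ) (n : ℕ) (R : List MonPair) : Bool :=
  R.all fun v =>
    let L := explore h n [v] []
    inside h v.1 && !inside h v.2 && memb v L && closed h L &&
      Nat.beq (R.countP fun w => memb w L) 1

theorem mem_or_of_closed {h : ℕ → ℕ → ℕ} {L : List MonPair} (hL : closed h L = true)
    {e : ℕ × ℕ × ℕ} (he : e ∈ units) {i j k p q t : ℕ} (hk : h i j ≤ k) (ht : t < h p q) :
    ((i + e.1, j + e.2.1, k + e.2.2), (p, q, t)) ∈ L ↔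
      (e.1 ≤ p ∧ e.2.1 ≤ q ∧ e.2.2 ≤ t) ∧
        ((i, j, k), (p - e.1, q - e.2.1, t - e.2.2)) ∈ L := by
  rw [closed, List.all_eq_true] at hL
  constructor
  · intro hv
    have := List.all_eq_true.1 (hL _ hv) e he
    simp only [Bool.and_eq_true, Bool.or_eq_true, Bool.not_eq_true', Bool.and_eq_false_iff,
      dvdb, down, inside, memb_iff, Nat.ble_eq, Nat.add_sub_cancel] at this
    rcases this.2 with (((h1 | h1) | h1) | h1) | h1
    iterate 4
      · rw [← Bool.not_eq_true, Nat.ble_eq] at h1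
        omega
    · exact ⟨⟨h1.1.1.1, h1.1.1.2, h1.1.2⟩, h1.2⟩
  · rintro ⟨⟨h1, h2, h3⟩, hv⟩
    have := (Bool.and_eq_true_iff.1 (List.all_eq_true.1 (hL _ hv) e he)).1
    simp only [Bool.or_eq_true, up, inside, memb_iff, Nat.ble_eq, Nat.sub_add_cancel h1,
      Nat.sub_add_cancel h2, Nat.sub_add_cancel h3] at this
    exact this.resolve_left (not_le.2 ht)

end MonPair

/-- The linear map sending `x^d` to the sum of all `x^s` with `(x^d, x^s)` in `L`. -/
noncomputable def pairMap (I : Ideal (MvPolynomial (Fin 3) ℂ)) (L : List MonPair) :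
    MvPolynomial (Fin 3) ℂ →ₗ[ℂ] (MvPolynomial (Fin 3) ℂ ⧸ I) :=
  ∑ v ∈ L.toFinset, (lcoeff ℂ (mon v.1.1 v.1.2.1 v.1.2.2)).smulRight
    (Ideal.Quotient.mk I (monomial (mon v.2.1 v.2.2.1 v.2.2.2) 1))

namespace IsMonomialIdeal

variable {I : Ideal (MvPolynomial (Fin 3) ℂ)} {h : ℕ → ℕ → ℕ}

theorem coeffQuot_pairMap (hI : IsMonomialIdeal I) (L : List MonPair) {i j k p q t : ℕ}
    (hs : monomial (mon p q t) (1 : ℂ) ∉ I) :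
    hI.coeffQuot (mon p q t) (pairMap I L (monomial (mon i j k) 1)) =
      if ((i, j, k), (p, q, t)) ∈ L then 1 else 0 := by
  classical
  simp only [pairMap, LinearMap.sum_apply, map_sum, LinearMap.smulRight_apply, lcoeff_apply,
    map_smul, hI.coeffQuot_mk hs, coeff_monomial, smul_eq_mul, mon_inj, ← ite_and, ite_mul, one_mul,
    zero_mul]
  have (v : MonPair) : (((i = v.1.1 ∧ j = v.1.2.1 ∧ k = v.1.2.2) ∧
      v.2.1 = p ∧ v.2.2.1 = q ∧ v.2.2.2 = t)) ↔ v = ((i, j, k), (p, q, t)) := by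
    obtain ⟨⟨a, b, c⟩, d, e, f⟩ := v
    simp only [Prod.mk.injEq]
    constructor <;> rintro ⟨⟨h1, h2, h3⟩, h4, h5, h6⟩ <;> subst_vars <;> simp
  simp only [this, Finset.sum_ite_eq', List.mem_toFinset]

theorem pairMap_monomial_add (hI : IsMonomialIdeal I) (hh : IsHeight I h) {L : List MonPair}
    (hL : MonPair.closed h L = true) {a b c : ℕ} (he : (a, b, c) ∈ MonPair.units) {i j k : ℕ}
    (hk : h i j ≤ k) :
    pairMap I L (monomial (mon (i + a) (j + b) (k + c)) 1) =
      (monomial (mon a b c) (1 : ℂ)) • pairMap I L (monomial (mon i j k) 1) := by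
  refine hI.ext_coeffQuot fun s hs => ?_
  obtain ⟨p, q, t, rfl⟩ : ∃ p q t, s = mon p q t := ⟨_, _, _, (mon_apply s).symm⟩
  have ht := hs
  rw [hh, not_le] at ht
  have key := MonPair.mem_or_of_closed hL he hk ht
  rw [hI.coeffQuot_pairMap L hs]
  by_cases hle : mon a b c ≤ mon p q t
  · have hle' := mon_le.1 hle
    have hsub : mon p q t = mon a b c + mon (p - a) (q - b) (t - c) := by
      rw [mon_add, Nat.sub_add_cancel hle'.1, Nat.sub_add_cancel hle'.2.1,
        Nat.sub_add_cancel hle'.2.2]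
    have hs' : monomial (mon (p - a) (q - b) (t - c)) (1 : ℂ) ∉ I := fun h' =>
      hs (monomial_mem_of_le h' (mon_le.2 (by omega)))
    have hs2 := hs
    rw [hsub] at hs2
    rw [hsub, hI.coeffQuot_monomial_smul_add _ _ hs2, hI.coeffQuot_pairMap L hs']
    exact if_congr (key.trans (and_iff_right hle')) rfl rfl
  · rw [hI.coeffQuot_monomial_smul_of_not_le _ _ hs hle, if_neg]
    exact fun hv => hle (mon_le.2 (key.1 hv).1)

theorem pairMap_X_mul (hI : IsMonomialIdeal I) (hh : IsHeight I h) {L : List MonPair}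
    (hL : MonPair.closed h L = true) (n : Fin 3) {p : MvPolynomial (Fin 3) ℂ} (hp : p ∈ I) :
    pairMap I L (X n * p) = (X n : MvPolynomial (Fin 3) ℂ) • pairMap I L p := by
  obtain ⟨a, b, c, he, hX⟩ : ∃ a b c, (a, b, c) ∈ MonPair.units ∧
      (X n : MvPolynomial (Fin 3) ℂ) = monomial (mon a b c) 1 := by
    fin_cases n
    · refine ⟨1, 0, 0, by simp [MonPair.units], congrArg (monomial · 1) ?_⟩
      ext a
      fin_cases a <;> simp [mon]
    · refine ⟨0, 1, 0, by simp [MonPair.units], congrArg (monomial · 1) ?_⟩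
      ext a
      fin_cases a <;> simp [mon]
    · refine ⟨0, 0, 1, by simp [MonPair.units], congrArg (monomial · 1) ?_⟩
      ext a
      fin_cases a <;> simp [mon]
  rw [hX]
  have hsum : p = ∑ d ∈ p.support, coeff d p • monomial d (1 : ℂ) := by
    simp only [smul_monomial, smul_eq_mul, mul_one]
    exact p.as_sum
  rw [hsum, Finset.mul_sum, map_sum, map_sum, Finset.smul_sum]
  refine Finset.sum_congr rfl fun d hd => ?_
  have hdI := hI p hp d hd
  rw [← mon_apply d] at hdI ⊢
  rw [mul_smul_comm, map_smul, map_smul, monomial_mul, mon_add, one_mul,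
    hI.pairMap_monomial_add hh hL he ((hh _ _ _).1 hdI), smul_comm]

/-- The homomorphism attached to a closed set of pairs of monomials. -/
noncomputable def pairHom (hI : IsMonomialIdeal I) (hh : IsHeight I h) {L : List MonPair}
    (hL : MonPair.closed h L = true) :
    I →ₗ[MvPolynomial (Fin 3) ℂ] (MvPolynomial (Fin 3) ℂ ⧸ I) where
  toFun p := pairMap I L p
  map_add' p q := map_add _ _ _
  map_smul' r p := by
    obtain ⟨p, hp⟩ := p
    change pairMap I L (r * p) = r • pairMap I L p
    induction r using MvPolynomial.induction_on generalizing p with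
    | C a =>
      rw [← smul_eq_C_mul, map_smul, ← algebraMap_eq, algebraMap_smul]
    | add r r' ih ih' => rw [add_mul, map_add, ih p hp, ih' p hp, add_smul]
    | mul_X r n ih =>
      rw [mul_assoc, ih _ (I.mul_mem_left _ hp), hI.pairMap_X_mul hh hL n hp, mul_smul]

theorem length_le_tangentDim (hI : IsMonomialIdeal I) (hh : IsHeight I h)
    [Module.Finite ℂ (I →ₗ[MvPolynomial (Fin 3) ℂ] (MvPolynomial (Fin 3) ℂ ⧸ I))]
    {n : ℕ} {R : List MonPair} (hR : MonPair.separated h n R = true) :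
    R.length ≤ tangentDim I := by
  classical
  simp only [MonPair.separated, List.all_eq_true, Bool.and_eq_true, Bool.not_eq_true',
    MonPair.memb_iff, MonPair.inside, Nat.ble_eq, List.countP_eq_length_filter,
    ← Bool.not_eq_true, not_le] at hR
  set L : MonPair → List MonPair := fun v => MonPair.explore h n [v] []
  have hfilter : ∀ v ∈ R, (R.filter fun w => MonPair.memb w (L v)) = [v] := fun v hv => by
    obtain ⟨⟨⟨⟨-, -⟩, h1⟩, -⟩, h2⟩ := hR v hv
    obtain ⟨w, hw⟩ := List.length_eq_one_iff.1 (Nat.eq_of_beq_eq_true h2)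
    have : v ∈ R.filter fun w => MonPair.memb w (L v) :=
      List.mem_filter.2 ⟨hv, MonPair.memb_iff.2 h1⟩
    rw [hw, List.mem_singleton] at this
    rw [hw, this]
  have hmem : ∀ v ∈ R, ∀ w ∈ R, w ∈ L v ↔ w = v := fun v hv w hw => by
    rw [← List.mem_singleton, ← hfilter v hv, List.mem_filter, MonPair.memb_iff]
    exact (and_iff_right hw).symm
  have hnodup : R.Nodup := by
    refine List.nodup_iff_count_le_one.2 fun v => ?_
    by_cases hv : v ∈ R
    · rw [← List.count_filter (p := fun w => MonPair.memb w (L v))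
        (MonPair.memb_iff.2 ((hmem v hv v hv).2 rfl)), hfilter v hv, List.count_singleton_self]
    · simp [List.count_eq_zero_of_not_mem hv]
  let φ : R.toFinset → I →ₗ[MvPolynomial (Fin 3) ℂ] (MvPolynomial (Fin 3) ℂ ⧸ I) := fun v =>
    hI.pairHom hh (hR v.1 (List.mem_toFinset.1 v.2)).1.2
  let Φ : (I →ₗ[MvPolynomial (Fin 3) ℂ] (MvPolynomial (Fin 3) ℂ ⧸ I)) →ₗ[ℂ] R.toFinset → ℂ :=
    LinearMap.pi fun w =>
      hI.homCoeff (mon w.1.1.1 w.1.1.2.1 w.1.1.2.2) (mon w.1.2.1 w.1.2.2.1 w.1.2.2.2)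
  have hΦ : ∀ v, Φ (φ v) = Pi.single v 1 := fun v => by
    ext w
    have hw := List.mem_toFinset.1 w.2
    have h1 := (hh _ _ _).2 (hR w.1 hw).1.1.1.1
    have h2 : monomial (mon w.1.2.1 w.1.2.2.1 w.1.2.2.2) (1 : ℂ) ∉ I := by
      rw [hh, not_le]
      exact (hR w.1 hw).1.1.1.2
    change hI.homCoeff _ _ (φ v) = _
    rw [hI.homCoeff_apply h1]
    refine (hI.coeffQuot_pairMap _ h2).trans ?_
    rw [Pi.single_apply]
    exact if_congr ((hmem v.1 (List.mem_toFinset.1 v.2) w.1 hw).trans Subtype.ext_iff.symm) rfl rfl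
  have hsurj : Function.Surjective Φ := fun f => by
    refine ⟨∑ v, f v • φ v, ?_⟩
    simp only [map_sum, map_smul, hΦ]
    ext w
    simp [Finset.sum_apply, Pi.single_apply]
  have := LinearMap.finrank_le_finrank_of_surjective hsurj
  rwa [Module.finrank_fintype_fun_eq_card, Fintype.card_coe, List.toFinset_card_of_nodup hnodup]
    at this

end IsMonomialIdeal

/-- The monomial ideal generated by the monomials on or above the given heights. -/
noncomputable def heightIdeal (h : ℕ → ℕ → ℕ) : Ideal (MvPolynomial (Fin 3) ℂ) :=
  Ideal.span ((fun s => monomial s 1) '' {s | h (s 0) (s 1) ≤ s 2})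

theorem mem_heightIdeal {h : ℕ → ℕ → ℕ} (hB : IsBorelHeight h) {p : MvPolynomial (Fin 3) ℂ} :
    p ∈ heightIdeal h ↔ ∀ d ∈ p.support, h (d 0) (d 1) ≤ d 2 := by
  rw [heightIdeal, mem_ideal_span_monomial_image]
  refine forall₂_congr fun d _ => ⟨?_, fun hd => ⟨d, hd, le_rfl⟩⟩
  rintro ⟨s, hs, hsd⟩
  have h1 := hB.antitone_left (s 1) (hsd 0)
  have h2 := hB.antitone_right (d 0) (hsd 1)
  have h3 : h (s 0) (s 1) ≤ s 2 := hs
  have h4 := hsd 2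
  exact h2.trans (h1.trans (h3.trans h4))

theorem isMonomialIdeal_heightIdeal {h : ℕ → ℕ → ℕ} (hB : IsBorelHeight h) :
    IsMonomialIdeal (heightIdeal h) := by
  intro p hp d hd
  rw [mem_heightIdeal hB] at hp ⊢
  intro s hs
  rw [Finset.mem_singleton.1 (support_monomial_subset hs)]
  exact hp d hd

theorem isHeight_heightIdeal {h : ℕ → ℕ → ℕ} (hB : IsBorelHeight h) :
    IsHeight (heightIdeal h) h := by
  intro i j k
  rw [mem_heightIdeal hB, support_monomial, if_neg one_ne_zero]
  simp only [Finset.mem_singleton, forall_eq, mon_zero_apply, mon_one_apply, mon_two_apply]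

/-- Check that the rows are those of a Borel-fixed staircase. -/
def borelRows (r : List (List ℕ)) (N : ℕ) : Bool :=
  r.all (fun l => l.length.ble N) &&
    (List.range r.length).all fun i => (List.range N).all fun j =>
      (height r i (j + 1)).ble (height r i j - 1) && (height r (i + 1) j).ble (height r i (j + 1))

theorem height_eq_zero_of_length_le {r : List (List ℕ)} {i : ℕ} (hi : r.length ≤ i) (j : ℕ) :
    height r i j = 0 := by
  simp [height, hi]

theorem height_eq_zero_of_borelRows {r : List (List ℕ)} {N : ℕ} (hr : borelRows r N = true)
    (i : ℕ) {j : ℕ} (hj : N ≤ j) : height r i j = 0 := by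
  rcases lt_or_ge i r.length with hi | hi
  · have := List.all_eq_true.1 (Bool.and_eq_true_iff.1 hr).1 r[i] (List.getElem_mem hi)
    rw [Nat.ble_eq] at this
    simp [height, hi, this.trans hj]
  · exact height_eq_zero_of_length_le hi j

theorem isBorelHeight_of_borelRows {r : List (List ℕ)} {N : ℕ} (hr : borelRows r N = true) :
    IsBorelHeight (height r) := by
  have key : ∀ i j, height r i (j + 1) ≤ height r i j - 1 ∧
      height r (i + 1) j ≤ height r i (j + 1) := by
    intro i j
    rcases lt_or_ge i r.length with hi | hi
    · rcases lt_or_ge j N with hj | hj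
      · have := List.all_eq_true.1 (List.all_eq_true.1 (Bool.and_eq_true_iff.1 hr).2 i
          (List.mem_range.2 hi)) j (List.mem_range.2 hj)
        simpa only [Bool.and_eq_true, Nat.ble_eq] using this
      · simp [height_eq_zero_of_borelRows hr _ hj,
          height_eq_zero_of_borelRows hr _ (hj.trans (Nat.le_succ j))]
    · simp [height_eq_zero_of_length_le hi, height_eq_zero_of_length_le (hi.trans (Nat.le_succ i))]
  exact ⟨fun i j => (key i j).1, fun i j => (key i j).2⟩

/-- The conditions on the rows of a Borel-fixed staircase with `n` boxes that ensure that the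
dimension of the tangent space is at least `T`. -/
def isWitness (m n T : ℕ) (r : List (List ℕ)) : Bool :=
  let N := (r.headD []).length
  let R := MonPair.roots (height r) (m + 1) N
  Nat.beq r.length (m + 1) && Nat.ble 1 (height r m 0) && borelRows r N &&
    Nat.beq r.flatten.sum n && T.ble R.length && MonPair.separated (height r) 200 R

theorem tmaxEq_of_isWitness {m n T : ℕ} (hn0 : n ≠ 0)
    (hT : allRows (m + 1) (List.replicate n n) n (checkRows m n T) = true)
    {r : List (List ℕ)} (hr : isWitness m n T r = true) : TmaxEq n (m + 1) T := by
  refine ⟨?_, ?_⟩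
  · simp only [isWitness, Bool.and_eq_true, Nat.ble_eq] at hr
    obtain ⟨⟨⟨⟨⟨hlen, hpos⟩, hborel⟩, hsum⟩, hTR⟩, hsep⟩ := hr
    have hlen := Nat.eq_of_beq_eq_true hlen
    have hsum := Nat.eq_of_beq_eq_true hsum
    have hB := isBorelHeight_of_borelRows hborel
    have hN := fun i j (hj : (r.headD []).length ≤ j) => height_eq_zero_of_borelRows hborel i hj
    have hI := isMonomialIdeal_heightIdeal hB
    have hh := isHeight_heightIdeal hB
    have hIB := hh.isBorelFixed hB
    have hfin : Module.finrank ℂ (MvPolynomial (Fin 3) ℂ ⧸ heightIdeal (height r)) = n := by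
      rw [hI.finrank_eq_ncard, hh.ncard_eq (fun i j hi => height_eq_zero_of_length_le hi j) hN,
        ← hsum, ← excess_zero, excess_flatten 0 hN]
      simp only [boxesAbove, Nat.sub_zero]
    have hm : (X 0 : MvPolynomial (Fin 3) ℂ) ^ (m + 1) ∈ heightIdeal (height r) := by
      rw [X_zero_pow_eq_monomial, hh, height_eq_zero_of_length_le hlen.le]
    have hm' : (X 0 : MvPolynomial (Fin 3) ℂ) ^ m ∉ heightIdeal (height r) := by
      rw [X_zero_pow_eq_monomial, hh, not_le]
      exact hpos
    obtain ⟨hfinite, hle⟩ := tangentDim_le_of_checkRows hn0 hT hI hIB hfin hm hm'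
    exact ⟨heightIdeal (height r), hI, hIB, hfin, hm, hm',
      le_antisymm (hTR.trans (hI.length_le_tangentDim hh hsep)) hle⟩
  · rintro t ⟨I, hI, hIB, hn, hm, hm', rfl⟩
    exact (tangentDim_le_of_checkRows hn0 hT hI hIB hn hm hm').2

theorem allRows_one : allRows 1 (List.replicate 30 30) 30 (checkRows 0 30 90) = true := by
  decide +kernel

theorem allRows_two : allRows 2 (List.replicate 30 30) 30 (checkRows 1 30 144) = true := by
  decide +kernel

theorem allRows_three : allRows 3 (List.replicate 30 30) 30 (checkRows 2 30 186) = true := by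
  decide +kernel

theorem allRows_four : allRows 4 (List.replicate 30 30) 30 (checkRows 3 30 210) = true := by
  decide +kernel

theorem tmaxEq_two : TmaxEq 30 2 144 :=
  tmaxEq_of_isWitness (by norm_num) allRows_two (r := [[8, 5, 3, 2, 1], [5, 3, 2, 1]])
    (by decide +kernel)

theorem tmaxEq_three : TmaxEq 30 3 186 :=
  tmaxEq_of_isWitness (by norm_num) allRows_three (r := [[8, 5, 3, 1], [5, 3, 1], [3, 1]])
    (by decide +kernel)

theorem tmaxEq_four : TmaxEq 30 4 210 :=
  tmaxEq_of_isWitness (by norm_num) allRows_four (r := [[7, 5, 3, 1], [5, 3, 1], [3, 1], [1]])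
    (by decide +kernel)

theorem le_of_tmaxEq_one {T : ℕ} (h : TmaxEq 30 1 T) : T ≤ 90 := by
  obtain ⟨I, hI, hIB, hn, hm, hm', rfl⟩ := h.1
  exact (tangentDim_le_of_checkRows (by norm_num) allRows_one hI hIB hn hm hm').2

theorem Tmax_monotonicity_l30 :
    TmaxEq 30 2 144 ∧
    TmaxEq 30 3 186 ∧
    TmaxEq 30 4 210 ∧
    (∀ T1 T2 T3 T4 : ℕ, TmaxEq 30 1 T1 → TmaxEq 30 2 T2 → TmaxEq 30 3 T3 → TmaxEq 30 4 T4 →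
      T1 < T2 ∧ T2 < T3 ∧ T3 < T4) := by
  refine ⟨tmaxEq_two, tmaxEq_three, tmaxEq_four, fun T1 T2 T3 T4 h1 h2 h3 h4 => ?_⟩
  have e1 := le_of_tmaxEq_one h1
  have e2 := h2.unique tmaxEq_two
  have e3 := h3.unique tmaxEq_three
  have e4 := h4.unique tmaxEq_four
  omega
end

section
/- T_{max,2}(34) = 166, T_{max,3}(34) = 216, and T_{max,4}(34) = 276; in particular, for l = 34 the function m1 ↦ T_{max,m1}(34) is strictly increasing on {1, 2, 3, 4}. -/
open MvPolynomial

namespace BorelTangent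

local notation:65 a:65 " ⊞ " b:66 => Nat.add a b
local notation:65 a:65 " ⊖ " b:66 => Nat.sub a b
local notation "𝟘" => nat_lit 0
local notation "𝟙" => nat_lit 1

/-- Evaluates `n` to a numeral before passing it to `k`. The functions below are written with
recursors and numerals so that the kernel evaluates them efficiently. -/
def force {α : Type} (n : ℕ) (k : ℕ → α) : α := Nat.rec (k 𝟘) (fun m _ => k (m ⊞ 𝟙)) n

/-- The head of a list, or zero. -/
def hd (l : List ℕ) : ℕ := List.rec 𝟘 (fun a _ _ => a) l

/-- The tail of a list. -/
def tl (l : List ℕ) : List ℕ := List.rec [] (fun _ t _ => t) l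

/-- The first row of a chain, or the empty row. -/
def hdRow (c : List (List ℕ)) : List ℕ := List.rec [] (fun r _ _ => r) c

/-- The minimum. -/
def meet (a b : ℕ) : ℕ := a ⊖ (a ⊖ b)

/-- The contribution of the row `r`, followed by the row `s`, to `chainCount`. -/
def rowCount (c dy dx : ℕ) (r : List ℕ) : List ℕ → ℕ :=
  List.rec (fun _ => 𝟘) (fun h t ih s =>
    force (meet (hd t) dy) fun u =>
    force (h ⊖ (u ⊞ (meet (hd s) dx ⊖ u))) fun e => meet e c ⊞ ih (tl s)) r

/-- The number of coefficients left free at a minimal generator by its relations with the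
two neighbouring ones, where `dy` and `dx` are the height differences and `c` caps each column. -/
def chainCount (ch : List (List ℕ)) (c dy dx : ℕ) : ℕ :=
  List.rec 𝟘 (fun r d s => rowCount c dy dx r (hdRow d) ⊞ s) ch

/-- The contribution of the generators in the row `r` to `chainGens`, where `p` is the previous
row and `s` the next one. -/
def rowGens (F : ℕ → ℕ → ℕ → ℕ) (p : List ℕ) : ℕ → List ℕ → List ℕ → ℕ :=
  List.rec (fun _ _ _ => 𝟘) (fun q _ ih left r s =>
    force (hd r) fun h => force (meet q left ⊖ h) fun c =>
    Nat.rec 𝟘 (fun _ _ =>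
      force (h ⊖ hd (tl r)) fun dy => force (h ⊖ hd s) fun dx => F c dy dx) c ⊞
        ih h (tl r) (tl s)) p

/-- The sum of `F (gap) dy dx` over the minimal generators of the ideal given by a chain. -/
def chainGens (F : ℕ → ℕ → ℕ → ℕ) (ch : List (List ℕ)) : List ℕ → ℕ :=
  List.rec (fun p => rowGens F p (hd p) [] [])
    (fun r d ih p => rowGens F p (hd p) r (hdRow d) ⊞ ih r) ch

/-- An upper bound for the tangent dimension, quick to compute. -/
def quickBound (ch : List (List ℕ)) : ℕ :=
  chainGens (chainCount ch) ch (70 :: hdRow ch)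

/-- The height function whose rows are the lists in `c`, extended by zero. -/
def ht (c : List (List ℕ)) (i j : ℕ) : ℕ := (c.getD i []).getD j 𝟘

/-- The sum of `f` over the numbers below `n`. -/
def sumTo (n : ℕ) (f : ℕ → ℕ) : ℕ := Nat.rec 𝟘 (fun k s => s ⊞ f k) n

/-- The maximum. -/
def join (a b : ℕ) : ℕ := force a fun a => a ⊞ (b ⊖ a)

/-- The height difference between `(i, j)` and the lower of its predecessors. -/
def gap (H : ℕ → ℕ → ℕ) (i j : ℕ) : ℕ :=
  Nat.rec (Nat.rec (H 𝟘 𝟘) (fun j _ => H 𝟘 j ⊖ H 𝟘 (j ⊞ 𝟙)) j)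
    (fun i _ => Nat.rec (H i 𝟘 ⊖ H (i ⊞ 𝟙) 𝟘)
      (fun j _ => meet (H i (j ⊞ 𝟙)) (H (i ⊞ 𝟙) j) ⊖ H (i ⊞ 𝟙) (j ⊞ 𝟙)) j) i

/-- Vanishing heights deduced from the generators at `(i, j + 1)` and `(i + 1, j)`. -/
def fwd (H : ℕ → ℕ → ℕ) (Z : ℕ → ℕ → ℕ → ℕ → ℕ) (i j k l : ℕ) : ℕ :=
  force (i ⊞ 𝟙) fun i' => force (j ⊞ 𝟙) fun j' =>
  force (k ⊞ 𝟙) fun k' => force (l ⊞ 𝟙) fun l' =>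
  join (meet (H k l') (H i j ⊖ H i j' ⊞ Z i j' k l'))
    (meet (H k' l) (H i j ⊖ H i' j ⊞ Z i' j k' l))

/-- Vanishing heights deduced from the generator at `(i, j - 1)`. -/
def bwdY (H : ℕ → ℕ → ℕ) (Z : ℕ → ℕ → ℕ → ℕ → ℕ) (i j k l : ℕ) : ℕ :=
  Nat.rec 𝟘 (fun j' _ => Nat.rec (H k 𝟘 ⊖ (H i j' ⊖ H i j))
    (fun l' _ => meet (H k l) (Z i j' k l') ⊖ (H i j' ⊖ H i j)) l) j

/-- Vanishing heights deduced from the generator at `(i - 1, j)`. -/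
def bwdX (H : ℕ → ℕ → ℕ) (Z : ℕ → ℕ → ℕ → ℕ → ℕ) (i j k l : ℕ) : ℕ :=
  Nat.rec 𝟘 (fun i' _ => Nat.rec (H 𝟘 l ⊖ (H i' j ⊖ H i j))
    (fun k' _ => meet (H k l) (Z i' j k' l) ⊖ (H i' j ⊖ H i j)) k) i

/-- Vanishing heights deduced from the generator at `(i + 1, j - 1)`. -/
def diag (H : ℕ → ℕ → ℕ) (Z : ℕ → ℕ → ℕ → ℕ → ℕ) (i j k l : ℕ) : ℕ :=
  force (i ⊞ 𝟙) fun i' => force (k ⊞ 𝟙) fun k' =>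
  Nat.rec 𝟘 (fun j' _ => Nat.rec (H k' 𝟘)
    (fun l' _ => meet (H k' l) (H i j ⊖ H i' j' ⊞ Z i' j' k' l')) l) j

/-- Heights below which coefficients vanish, from `f` rounds of `fwd`. -/
def zeroHt (H : ℕ → ℕ → ℕ) (f : ℕ) : ℕ → ℕ → ℕ → ℕ → ℕ :=
  Nat.rec (fun _ _ _ _ => 𝟘) (fun _ Z i j k l => fwd H Z i j k l) f

/-- Heights below which coefficients vanish, from `f` rounds of all four rules. -/
def zeroHt' (H : ℕ → ℕ → ℕ) (f : ℕ) : ℕ → ℕ → ℕ → ℕ → ℕ :=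
  Nat.rec (fun _ _ _ _ => 𝟘) (fun _ Z i j k l =>
    join (fwd H Z i j k l) (join (diag H Z i j k l) (join (bwdX H Z i j k l) (bwdY H Z i j k l)))) f

/-- The upper bound for the tangent dimension given by the vanishing heights `Z`. -/
def fullBound (H : ℕ → ℕ → ℕ) (Z : ℕ → ℕ → ℕ → ℕ → ℕ) (m a : ℕ) : ℕ :=
  sumTo (m ⊞ 𝟙) fun i => sumTo (a ⊞ 𝟙) fun j => force (gap H i j) fun c =>
    Nat.rec 𝟘 (fun _ _ => sumTo m fun k => sumTo a fun l =>
      force (H k l) fun h => Nat.rec 𝟘 (fun _ _ => force (h ⊖ Z i j k l) fun e => meet e c) h) c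

/-- Conjunction, lazy in its second argument. -/
def andB (a b : Bool) : Bool := Bool.rec false b a

/-- Disjunction, lazy in its second argument. -/
def orB (a b : Bool) : Bool := Bool.rec b true a

/-- Whether `p` holds for all `k` with `1 ≤ k ≤ n`. -/
def allTo (n : ℕ) (p : ℕ → Bool) : Bool := Nat.rec true (fun k s => andB (p (k ⊞ 𝟙)) s) n

/-- Whether `k` holds for all strictly decreasing lists of positive numbers below `prev`,
bounded entrywise by `b` and with sum at most `rem`. -/
def rowAll (b : List ℕ) : ℕ → ℕ → (ℕ → List ℕ → Bool) → Bool :=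
  List.rec (fun _ rem k => k rem []) (fun b _ ih prev rem k =>
    andB (k rem []) (allTo (meet (meet b (prev ⊖ 𝟙)) rem) fun h =>
      force h fun h => ih h (rem ⊖ h) fun r t => k r (h :: t))) b

/-- The analogue of `rowAll` for lists of sum exactly `rem`. -/
def lastAll (b : List ℕ) : ℕ → ℕ → (List ℕ → Bool) → Bool :=
  List.rec (fun _ rem k => Nat.rec (k []) (fun _ _ => true) rem) (fun b _ ih prev rem k =>
    Nat.rec (k []) (fun _ _ => allTo (meet (meet b (prev ⊖ 𝟙)) rem) fun h =>
      Bool.rec true (force h fun h => ih h (rem ⊖ h) fun t => k (h :: t))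
        (Nat.ble (Nat.mul (nat_lit 2) rem) (Nat.mul h (h ⊞ 𝟙)))) rem) b

/-- `b`, unless `r` is empty. -/
def nonempty (r : List ℕ) (b : Bool) : Bool := List.rec true (fun _ _ _ => b) r

/-- Whether `k` holds for all chains of `m + 1` nonempty rows of total sum `rem`, each bounded
by the tail of the previous one and the first by `b`. -/
def chainAll (m : ℕ) : List ℕ → ℕ → (List (List ℕ) → Bool) → Bool :=
  Nat.rec (fun b rem k => lastAll b 35 rem fun r => nonempty r (k [r]))
    (fun _ ih b rem k => rowAll b 35 rem fun rem r =>
      nonempty r (force rem fun rem => ih (tl r) rem fun c => k (r :: c))) m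

/-- Whether one of three upper bounds for the tangent dimension is at most `T`. -/
def good (m T : ℕ) (ch : List (List ℕ)) : Bool :=
  orB (Nat.ble (quickBound ch) T)
    (orB (Nat.ble (fullBound (ht ch) (zeroHt (ht ch) 4) m 7) T)
     (Nat.ble (fullBound (ht ch) (zeroHt' (ht ch) 3) m 7) T))

/-- The exponent vector of `x ^ i * y ^ j * z ^ k`. -/
noncomputable def ex (i j k : ℕ) : Fin 3 →₀ ℕ := Finsupp.equivFunOnFinite.symm ![i, j, k]

@[simp] lemma ex_apply_zero (i j k : ℕ) : ex i j k 0 = i := rfl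
@[simp] lemma ex_apply_one (i j k : ℕ) : ex i j k 1 = j := rfl
@[simp] lemma ex_apply_two (i j k : ℕ) : ex i j k 2 = k := rfl

lemma ex_add (i j k i' j' k' : ℕ) : ex i j k + ex i' j' k' = ex (i + i') (j + j') (k + k') := by
  ext t; fin_cases t <;> rfl

lemma ex_le {i j k i' j' k' : ℕ} : ex i j k ≤ ex i' j' k' ↔ i ≤ i' ∧ j ≤ j' ∧ k ≤ k' := by
  refine ⟨fun h => ⟨h 0, h 1, h 2⟩, fun h t => ?_⟩
  fin_cases t
  exacts [h.1, h.2.1, h.2.2]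

lemma ex_eta (d : Fin 3 →₀ ℕ) : ex (d 0) (d 1) (d 2) = d := by
  ext t; fin_cases t <;> rfl

section Coefficients

variable {I : Ideal (MvPolynomial (Fin 3) ℂ)}

lemma mem_iff_support (hI : IsMonomialIdeal I) (p : MvPolynomial (Fin 3) ℂ) :
    p ∈ I ↔ ∀ d ∈ p.support, monomial d (1 : ℂ) ∈ I := by
  refine ⟨hI p, fun h => ?_⟩
  rw [← support_sum_monomial_coeff p]
  refine I.sum_mem fun d hd => ?_
  rw [← mul_one (coeff d p), ← C_mul_monomial]
  exact I.mul_mem_left _ (h d hd)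

lemma monomial_add_mem {d : Fin 3 →₀ ℕ} (u : Fin 3 →₀ ℕ) (h : monomial d (1 : ℂ) ∈ I) :
    monomial (d + u) (1 : ℂ) ∈ I := by
  simpa [monomial_mul] using I.mul_mem_right (monomial u (1 : ℂ)) h

variable (I) in
open Classical in
/-- The coefficient of the monomial with exponent `n` on `R ⧸ I` (zero if it is not
well defined). -/
noncomputable def coefQ (n : Fin 3 →₀ ℕ) : (MvPolynomial (Fin 3) ℂ ⧸ I) →ₗ[ℂ] ℂ :=
  if h : I.restrictScalars ℂ ≤ LinearMap.ker (lcoeff ℂ n) then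
    (Submodule.liftQ (I.restrictScalars ℂ) (lcoeff ℂ n) h).comp
      (Submodule.Quotient.restrictScalarsEquiv ℂ I).symm.toLinearMap
  else 0

lemma coefQ_mk (hI : IsMonomialIdeal I) {n : Fin 3 →₀ ℕ} (hn : monomial n (1 : ℂ) ∉ I)
    (p : MvPolynomial (Fin 3) ℂ) : coefQ I n (Ideal.Quotient.mk I p) = coeff n p := by
  have h : I.restrictScalars ℂ ≤ LinearMap.ker (lcoeff ℂ n) := by
    intro p hp
    rw [LinearMap.mem_ker, lcoeff_apply]
    by_contra h0
    exact hn (hI p hp n (mem_support_iff.2 h0))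
  rw [coefQ, dif_pos h]
  rfl

lemma coefQ_monomial_smul (hI : IsMonomialIdeal I) {n u : Fin 3 →₀ ℕ}
    (hn : monomial n (1 : ℂ) ∉ I) (q : MvPolynomial (Fin 3) ℂ ⧸ I) :
    coefQ I n (monomial u (1 : ℂ) • q) = if u ≤ n then coefQ I (n - u) q else 0 := by
  obtain ⟨p, rfl⟩ := Ideal.Quotient.mk_surjective q
  have : monomial u (1 : ℂ) • Ideal.Quotient.mk I p = Ideal.Quotient.mk I (monomial u 1 * p) := rfl
  rw [this, coefQ_mk hI hn, coeff_monomial_mul']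
  split_ifs with h
  · rw [coefQ_mk hI, one_mul]
    intro h'
    exact hn (by simpa [tsub_add_cancel_of_le h] using monomial_add_mem u h')
  · rfl

lemma eq_zero_of_coefQ (hI : IsMonomialIdeal I) (q : MvPolynomial (Fin 3) ℂ ⧸ I)
    (h : ∀ n, monomial n (1 : ℂ) ∉ I → coefQ I n q = 0) : q = 0 := by
  obtain ⟨p, rfl⟩ := Ideal.Quotient.mk_surjective q
  rw [Ideal.Quotient.eq_zero_iff_mem, mem_iff_support hI]
  intro d hd
  by_contra hd'
  exact mem_support_iff.1 hd (by rw [← coefQ_mk hI hd', h d hd'])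

end Coefficients

/-- The tangent space to the Hilbert scheme at `[I]`. -/
abbrev Tangent (I : Ideal (MvPolynomial (Fin 3) ℂ)) : Type :=
  ↥I →ₗ[MvPolynomial (Fin 3) ℂ] (MvPolynomial (Fin 3) ℂ ⧸ I)

/-- `H i j` is the least exponent `k` with `x ^ i * y ^ j * z ^ k ∈ I`. -/
structure IsHeight (I : Ideal (MvPolynomial (Fin 3) ℂ)) (H : ℕ → ℕ → ℕ) : Prop where
  monomialIdeal : IsMonomialIdeal I
  mem_iff : ∀ i j k, monomial (ex i j k) (1 : ℂ) ∈ I ↔ H i j ≤ k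
  antitone_left : ∀ i j, H (i + 1) j ≤ H i j
  antitone_right : ∀ i j, H i (j + 1) ≤ H i j
  le_diag : ∀ i j, H (i + 1) j ≤ H i (j + 1)

section Bound

variable {I : Ideal (MvPolynomial (Fin 3) ℂ)} {H : ℕ → ℕ → ℕ}

/-- The coefficient of `x ^ k * y ^ l * z ^ w` in the image of the generator
`x ^ i * y ^ j * z ^ s`. -/
noncomputable def entry (hH : IsHeight I H) (i j s : ℕ) (hs : H i j ≤ s) (k l w : ℕ) :
    Tangent I →ₗ[ℂ] ℂ where
  toFun φ := coefQ I (ex k l w) (φ ⟨monomial (ex i j s) 1, (hH.mem_iff i j s).2 hs⟩)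
  map_add' φ ψ := by simp
  map_smul' c φ := by simp

lemma entry_shift (hH : IsHeight I H) (φ : Tangent I) {i j s k l w dx dy dz : ℕ}
    (hs : H i j ≤ s) {i' j' s' k' l' w' : ℕ} (hs' : H i' j' ≤ s')
    (hi : i' = i + dx) (hj : j' = j + dy) (hz : s' = s + dz)
    (hk : k' = k + dx) (hl : l' = l + dy) (hw : w' = w + dz) (hn : w' < H k' l') :
    entry hH i' j' s' hs' k' l' w' φ = entry hH i j s hs k l w φ := by
  subst hi hj hz hk hl hw
  have e : (⟨monomial (ex (i + dx) (j + dy) (s + dz)) 1, (hH.mem_iff _ _ _).2 hs'⟩ : I) =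
      monomial (ex dx dy dz) (1 : ℂ) • ⟨monomial (ex i j s) 1, (hH.mem_iff i j s).2 hs⟩ := by
    apply Subtype.ext
    simp [monomial_mul, ex_add, add_comm]
  have hn' : monomial (ex (k + dx) (l + dy) (w + dz)) (1 : ℂ) ∉ I := by
    rw [hH.mem_iff]; omega
  simp only [entry, LinearMap.coe_mk, AddHom.coe_mk]
  rw [e, map_smul, coefQ_monomial_smul hH.monomialIdeal hn', ← ex_add, if_pos le_add_self,
    add_tsub_cancel_right]

lemma entry_eq_zero (hH : IsHeight I H) (φ : Tangent I) {i j s k l w dx dy dz : ℕ}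
    (hs : H i j ≤ s) {i' j' s' : ℕ} (hs' : H i' j' ≤ s')
    (hi : i' = i + dx) (hj : j' = j + dy) (hz : s' = s + dz)
    (hd : k < dx ∨ l < dy ∨ w < dz) (hn : w < H k l) :
    entry hH i' j' s' hs' k l w φ = 0 := by
  subst hi hj hz
  have e : (⟨monomial (ex (i + dx) (j + dy) (s + dz)) 1, (hH.mem_iff _ _ _).2 hs'⟩ : I) =
      monomial (ex dx dy dz) (1 : ℂ) • ⟨monomial (ex i j s) 1, (hH.mem_iff i j s).2 hs⟩ := by
    apply Subtype.ext
    simp [monomial_mul, ex_add, add_comm]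
  have hn' : monomial (ex k l w) (1 : ℂ) ∉ I := by
    rw [hH.mem_iff]; omega
  simp only [entry, LinearMap.coe_mk, AddHom.coe_mk]
  rw [e, map_smul, coefQ_monomial_smul hH.monomialIdeal hn', if_neg]
  rw [ex_le]; omega

/-- The coefficients of `φ (x ^ i * y ^ j * z ^ H i j)` at `x ^ k * y ^ l * z ^ w` vanish for
`w < t`. -/
def Vanishes (hH : IsHeight I H) (φ : Tangent I) (i j k l t : ℕ) : Prop :=
  ∀ w, w < H k l → w < t → entry hH i j (H i j) le_rfl k l w φ = 0

variable {hH : IsHeight I H} {φ : Tangent I}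

lemma Vanishes.zero (i j k l : ℕ) : Vanishes hH φ i j k l 0 := fun _ _ h => absurd h (by omega)

lemma Vanishes.max {i j k l s t : ℕ} (hs : Vanishes hH φ i j k l s)
    (ht : Vanishes hH φ i j k l t) : Vanishes hH φ i j k l (max s t) := by
  intro w hw h
  rcases lt_max_iff.1 h with h | h
  exacts [hs w hw h, ht w hw h]

/-- Comparison along a relation `x ^ dx * y ^ dy * g = x ^ dx' * y ^ dy' * z ^ e * g'`. -/
lemma Vanishes.relation {i j i' j' k l k' l' t dx dy dx' dy' : ℕ}
    (h : Vanishes hH φ i' j' k' l' t) (hi : i + dx = i' + dx') (hj : j + dy = j' + dy')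
    (hk : k + dx = k' + dx') (hl : l + dy = l' + dy') (hle : H i' j' ≤ H i j)
    (h₁ : H (k + dx) (l + dy) ≤ H k' l') (h₀ : H (i + dx) (j + dy) ≤ H i j) :
    Vanishes hH φ i j k l (min (H (k + dx) (l + dy)) (H i j - H i' j' + t)) := by
  intro w hw ht
  rw [lt_min_iff] at ht
  rw [← entry_shift hH φ (i' := i + dx) (j' := j + dy) (s' := H i j)
    (k' := k + dx) (l' := l + dy) (w' := w) (dx := dx) (dy := dy) (dz := 0) le_rfl h₀ rfl rfl rfl rfl rfl rfl ht.1]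
  by_cases hw' : w < H i j - H i' j'
  · exact entry_eq_zero hH φ (i := i') (j := j') (s := H i' j') (dz := H i j - H i' j') le_rfl h₀
      hi hj (by omega) (Or.inr (Or.inr hw')) ht.1
  · rw [entry_shift hH φ (i := i') (j := j') (s := H i' j') (dz := H i j - H i' j')
      (k := k') (l := l') (w := w - (H i j - H i' j')) le_rfl h₀ hi hj (by omega) hk hl (by omega)
      ht.1]
    exact h _ (by omega) (by omega)

lemma Vanishes.of_lt {i j i' j' k l dx dy dx' dy' : ℕ}
    (hi : i + dx = i' + dx') (hj : j + dy = j' + dy')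
    (hd : k + dx < dx' ∨ l + dy < dy') (hle : H i' j' ≤ H i j)
    (h₀ : H (i + dx) (j + dy) ≤ H i j) :
    Vanishes hH φ i j k l (H (k + dx) (l + dy)) := by
  intro w hw ht
  rw [← entry_shift hH φ (i' := i + dx) (j' := j + dy) (s' := H i j)
    (k' := k + dx) (l' := l + dy) (w' := w) (dx := dx) (dy := dy) (dz := 0) le_rfl h₀ rfl rfl rfl rfl rfl rfl ht]
  exact entry_eq_zero hH φ (i := i') (j := j') (s := H i' j') (dz := H i j - H i' j') le_rfl h₀
      hi hj (by omega) (by omega) ht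

lemma Vanishes.right {i j k l t : ℕ} (h : Vanishes hH φ i (j + 1) k (l + 1) t) :
    Vanishes hH φ i j k l (min (H k (l + 1)) (H i j - H i (j + 1) + t)) :=
  h.relation (dx := 0) (dy := 1) (dx' := 0) (dy' := 0) rfl rfl rfl rfl (hH.antitone_right i j)
    le_rfl (hH.antitone_right i j)

lemma Vanishes.left {i j k l t : ℕ} (h : Vanishes hH φ (i + 1) j (k + 1) l t) :
    Vanishes hH φ i j k l (min (H (k + 1) l) (H i j - H (i + 1) j + t)) :=
  h.relation (dx := 1) (dy := 0) (dx' := 0) (dy' := 0) rfl rfl rfl rfl (hH.antitone_left i j)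
    le_rfl (hH.antitone_left i j)

lemma Vanishes.diag {i j k l t : ℕ} (h : Vanishes hH φ (i + 1) j (k + 1) l t) :
    Vanishes hH φ i (j + 1) k (l + 1)
      (min (H (k + 1) (l + 1)) (H i (j + 1) - H (i + 1) j + t)) :=
  h.relation (dx := 1) (dy := 0) (dx' := 0) (dy' := 1) rfl rfl rfl rfl (hH.le_diag i j)
    (hH.antitone_right _ _) (hH.antitone_left _ _)

lemma Vanishes.diag_zero {i j k : ℕ} : Vanishes hH φ i (j + 1) k 0 (H (k + 1) 0) :=
  Vanishes.of_lt (i' := i + 1) (j' := j) (dx := 1) (dy := 0) (dx' := 0) (dy' := 1) rfl rfl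
    (by omega) (hH.le_diag i j) (hH.antitone_left _ _)

/-- Comparison along a relation `z ^ e * g = x ^ dx * y ^ dy * g'`. -/
lemma Vanishes.back {i j k l t dx dy : ℕ} (h : Vanishes hH φ i j k l t)
    (h₀ : H (i + dx) (j + dy) ≤ H i j) (h₁ : H (k + dx) (l + dy) ≤ H k l) :
    Vanishes hH φ (i + dx) (j + dy) (k + dx) (l + dy)
      (min (H (k + dx) (l + dy)) t - (H i j - H (i + dx) (j + dy))) := by
  intro w hw ht
  have ht' : w + (H i j - H (i + dx) (j + dy)) < min (H (k + dx) (l + dy)) t := by omega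
  rw [lt_min_iff] at ht'
  refine (entry_shift hH φ (i := i + dx) (j := j + dy) (i' := i + dx) (j' := j + dy) (s' := H i j)
    (k' := k + dx) (l' := l + dy) (w' := w + (H i j - H (i + dx) (j + dy))) (dx := 0) (dy := 0)
    (dz := H i j - H (i + dx) (j + dy)) le_rfl h₀ rfl rfl (Nat.add_sub_cancel' h₀).symm rfl rfl rfl
      ht'.1).symm.trans ?_
  exact (entry_shift hH φ (i := i) (j := j) (s := H i j) (dz := 0) (dx := dx) (dy := dy)
    (k := k) (l := l) (w := w + (H i j - H (i + dx) (j + dy))) le_rfl h₀ rfl rfl rfl rfl rfl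
    rfl ht'.1).trans (h _ (by omega) (by omega))

lemma Vanishes.back_of_lt {i j k l dx dy : ℕ} (hd : k < dx ∨ l < dy)
    (h₀ : H (i + dx) (j + dy) ≤ H i j) :
    Vanishes hH φ (i + dx) (j + dy) k l (H k l - (H i j - H (i + dx) (j + dy))) := by
  intro w hw ht
  have ht' : w + (H i j - H (i + dx) (j + dy)) < H k l := by omega
  refine (entry_shift hH φ (i := i + dx) (j := j + dy) (i' := i + dx) (j' := j + dy) (s' := H i j)
    (k' := k) (l' := l) (w' := w + (H i j - H (i + dx) (j + dy))) (dx := 0) (dy := 0)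
    (dz := H i j - H (i + dx) (j + dy)) le_rfl h₀ rfl rfl (Nat.add_sub_cancel' h₀).symm rfl rfl rfl
      ht').symm.trans ?_
  exact entry_eq_zero hH φ (i := i) (j := j) (s := H i j) (dz := 0) le_rfl h₀ rfl rfl rfl
    (by omega) ht'

lemma vanishes_right_succ {i j : ℕ} (h : ∀ k l, Vanishes hH φ i j k l (H k l)) (k l : ℕ) :
    Vanishes hH φ i (j + 1) k l (H k l - (H i j - H i (j + 1))) := by
  rcases l with _ | l
  · exact Vanishes.back_of_lt (dx := 0) (dy := 1) (by omega) (hH.antitone_right i j)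
  · have := (h k l).back (dx := 0) (dy := 1) (hH.antitone_right i j) (hH.antitone_right k l)
    simpa [min_eq_left (hH.antitone_right k l)] using this

lemma vanishes_left_succ {i j : ℕ} (h : ∀ k l, Vanishes hH φ i j k l (H k l)) (k l : ℕ) :
    Vanishes hH φ (i + 1) j k l (H k l - (H i j - H (i + 1) j)) := by
  rcases k with _ | k
  · exact Vanishes.back_of_lt (dx := 1) (dy := 0) (by omega) (hH.antitone_left i j)
  · have := (h k l).back (dx := 1) (dy := 0) (hH.antitone_left i j) (hH.antitone_left k l)
    simpa [min_eq_left (hH.antitone_left k l)] using this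

lemma eq_zero_of_vanishes (h : ∀ i j k l, Vanishes hH φ i j k l (H k l)) : φ = 0 := by
  have hmon : ∀ d (hd : monomial d (1 : ℂ) ∈ I), φ ⟨monomial d 1, hd⟩ = 0 := by
    intro d hd
    obtain ⟨i, j, s, rfl⟩ : ∃ i j s, d = ex i j s := ⟨_, _, _, (ex_eta d).symm⟩
    have hs := (hH.mem_iff i j s).1 hd
    refine eq_zero_of_coefQ hH.monomialIdeal _ fun n hn => ?_
    obtain ⟨k, l, w, rfl⟩ : ∃ k l w, n = ex k l w := ⟨_, _, _, (ex_eta n).symm⟩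
    rw [hH.mem_iff, not_le] at hn
    change entry hH i j s hs k l w φ = 0
    by_cases hw : w < s - H i j
    · exact entry_eq_zero hH φ (dx := 0) (dy := 0) (dz := s - H i j) (le_refl (H i j)) hs rfl rfl
        (by omega) (by omega) hn
    · exact (entry_shift hH φ (dx := 0) (dy := 0) (dz := s - H i j) (k := k) (l := l)
        (w := w - (s - H i j)) (le_refl (H i j)) hs rfl rfl (by omega) rfl rfl (by omega) hn).trans
        (h i j k l _ (by omega) (by omega))
  refine LinearMap.ext fun ⟨p, hp⟩ => ?_
  have hd : ∀ d : p.support, monomial (d : Fin 3 →₀ ℕ) (1 : ℂ) ∈ I :=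
    fun d => hH.monomialIdeal p hp d d.2
  have e : (⟨p, hp⟩ : I) = ∑ d : p.support,
      (C (coeff (d : Fin 3 →₀ ℕ) p) : MvPolynomial (Fin 3) ℂ) •
        (⟨monomial (d : Fin 3 →₀ ℕ) 1, hd d⟩ : I) := by
    apply Subtype.ext
    rw [AddSubmonoidClass.coe_finsetSum]
    refine (support_sum_monomial_coeff p).symm.trans ?_
    rw [← Finset.sum_coe_sort]
    refine Finset.sum_congr rfl fun d _ => ?_
    simp [C_mul_monomial]
  rw [e, map_sum]
  refine Finset.sum_eq_zero fun d _ => ?_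
  rw [map_smul, hmon, smul_zero]
lemma meet_eq_min (a b : ℕ) : meet a b = min a b := by
  change a - (a - b) = min a b
  omega

lemma force_eq {α : Type} (n : ℕ) (k : ℕ → α) : force n k = k n := by
  cases n <;> rfl

lemma join_eq_max (a b : ℕ) : join a b = max a b := by
  rw [join, force_eq]
  change a + (b - a) = max a b
  omega

lemma Vanishes.join {i j k l s t : ℕ} (hs : Vanishes hH φ i j k l s)
    (ht : Vanishes hH φ i j k l t) : Vanishes hH φ i j k l (join s t) := by
  rw [join_eq_max]
  exact hs.max ht

lemma sumTo_eq (n : ℕ) (f : ℕ → ℕ) : sumTo n f = ∑ i ∈ Finset.range n, f i := by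
  induction n with
  | zero => rfl
  | succ n ih => rw [Finset.sum_range_succ, ← ih]; rfl

lemma gap_zero_zero : gap H 0 0 = H 0 0 := rfl

lemma gap_zero_succ (j : ℕ) : gap H 0 (j + 1) = H 0 j - H 0 (j + 1) := rfl

lemma gap_succ_zero (i : ℕ) : gap H (i + 1) 0 = H i 0 - H (i + 1) 0 := rfl

lemma gap_succ_succ (i j : ℕ) :
    gap H (i + 1) (j + 1) = min (H i (j + 1)) (H (i + 1) j) - H (i + 1) (j + 1) := by
  rw [← meet_eq_min]; rfl

lemma IsHeight.le_zero_zero (hH : IsHeight I H) (i j : ℕ) : H i j ≤ H 0 0 :=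
  (antitone_nat_of_succ_le (hH.antitone_right i) j.zero_le).trans
    (antitone_nat_of_succ_le (f := fun i => H i 0) (fun i => hH.antitone_left i 0) i.zero_le)

/-- If all coefficients vanish below `H k l - gap H i j` at smaller generators, they vanish. -/
lemma vanishes_sub_gap {i j : ℕ}
    (hx : ∀ i', i = i' + 1 → ∀ k l, Vanishes hH φ i' j k l (H k l))
    (hy : ∀ j', j = j' + 1 → ∀ k l, Vanishes hH φ i j' k l (H k l)) (k l : ℕ) :
    Vanishes hH φ i j k l (H k l - gap H i j) := by
  rcases i with _ | i <;> rcases j with _ | j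
  · rw [gap_zero_zero, Nat.sub_eq_zero_of_le (hH.le_zero_zero k l)]
    exact Vanishes.zero _ _ _ _
  · rw [gap_zero_succ]
    exact vanishes_right_succ (hy j rfl) k l
  · rw [gap_succ_zero]
    exact vanishes_left_succ (hx i rfl) k l
  · rw [gap_succ_succ]
    rcases min_choice (H i (j + 1)) (H (i + 1) j) with h | h <;> rw [h]
    · exact vanishes_left_succ (hx i rfl) k l
    · exact vanishes_right_succ (hy j rfl) k l

/-- The coefficients which determine a homomorphism `I → R ⧸ I`. -/
def roots (H : ℕ → ℕ → ℕ) (Z : ℕ → ℕ → ℕ → ℕ → ℕ) (A B : Finset (ℕ × ℕ)) :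
    Finset (Σ _ : (ℕ × ℕ) × (ℕ × ℕ), ℕ) :=
  (A ×ˢ B).sigma fun q => Finset.Ico
    (max (H q.2.1 q.2.2 - gap H q.1.1 q.1.2) (Z q.1.1 q.1.2 q.2.1 q.2.2)) (H q.2.1 q.2.2)

lemma card_roots (Z : ℕ → ℕ → ℕ → ℕ → ℕ) (A B : Finset (ℕ × ℕ)) :
    (roots H Z A B).card =
      ∑ p ∈ A, ∑ q ∈ B, min (H q.1 q.2 - Z p.1 p.2 q.1 q.2) (gap H p.1 p.2) := by
  rw [roots, Finset.card_sigma, Finset.sum_product]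
  refine Finset.sum_congr rfl fun p _ => Finset.sum_congr rfl fun q _ => ?_
  rw [Nat.card_Ico]
  dsimp only
  omega

lemma eq_zero_of_roots {Z : ℕ → ℕ → ℕ → ℕ → ℕ} {A B : Finset (ℕ × ℕ)}
    (hZ : ∀ i j k l, Vanishes hH φ i j k l (Z i j k l))
    (hA : ∀ p : ℕ × ℕ, gap H p.1 p.2 ≠ 0 → p ∈ A) (hB : ∀ p : ℕ × ℕ, H p.1 p.2 ≠ 0 → p ∈ B)
    (h : ∀ r ∈ roots H Z A B, entry hH r.1.1.1 r.1.1.2 _ le_rfl r.1.2.1 r.1.2.2 r.2 φ = 0) :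
    φ = 0 := by
  refine eq_zero_of_vanishes (hH := hH) fun i j => ?_
  induction hn : i + j using Nat.strong_induction_on generalizing i j with
  | _ n ih =>
  intro k l w hw _
  by_cases h₁ : w < max (H k l - gap H i j) (Z i j k l)
  · exact ((vanishes_sub_gap (fun i' hi => ih _ (by omega) i' j rfl)
      (fun j' hj => ih _ (by omega) i j' rfl) k l).max (hZ i j k l)) w hw h₁
  · refine h ⟨((i, j), (k, l)), w⟩ (Finset.mem_sigma.2 ⟨Finset.mem_product.2
      ⟨hA (i, j) ?_, hB (k, l) ?_⟩, Finset.mem_Ico.2 ⟨not_lt.1 h₁, hw⟩⟩)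
    · change gap H i j ≠ 0; omega
    · change H k l ≠ 0; omega

theorem finite_and_finrank_le (hH : IsHeight I H) {Z : ℕ → ℕ → ℕ → ℕ → ℕ}
    {A B : Finset (ℕ × ℕ)} (hZ : ∀ φ i j k l, Vanishes hH φ i j k l (Z i j k l))
    (hA : ∀ p : ℕ × ℕ, gap H p.1 p.2 ≠ 0 → p ∈ A) (hB : ∀ p : ℕ × ℕ, H p.1 p.2 ≠ 0 → p ∈ B) :
    Module.Finite ℂ (Tangent I) ∧ tangentDim I ≤
      ∑ p ∈ A, ∑ q ∈ B, min (H q.1 q.2 - Z p.1 p.2 q.1 q.2) (gap H p.1 p.2) := by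
  let f : Tangent I →ₗ[ℂ] (roots H Z A B → ℂ) := LinearMap.pi fun r =>
    entry hH r.1.1.1.1 r.1.1.1.2 _ le_rfl r.1.1.2.1 r.1.1.2.2 r.1.2
  have hf : Function.Injective f := by
    refine (injective_iff_map_eq_zero f).2 fun φ hφ => ?_
    exact eq_zero_of_roots (hZ φ) hA hB fun r hr => congrFun hφ ⟨r, hr⟩
  refine ⟨Module.Finite.of_injective f hf, ?_⟩
  rw [← card_roots]
  exact (LinearMap.finrank_le_finrank_of_injective hf).trans_eq (by simp)

lemma vanishes_fwd {Z : ℕ → ℕ → ℕ → ℕ → ℕ} (hZ : ∀ i j k l, Vanishes hH φ i j k l (Z i j k l))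
    (i j k l : ℕ) : Vanishes hH φ i j k l (fwd H Z i j k l) := by
  simp only [fwd, force_eq, join_eq_max, meet_eq_min]
  exact (hZ i (j + 1) k (l + 1)).right.max (hZ (i + 1) j (k + 1) l).left

lemma vanishes_bwdY {Z : ℕ → ℕ → ℕ → ℕ → ℕ} (hZ : ∀ i j k l, Vanishes hH φ i j k l (Z i j k l))
    (i j k l : ℕ) : Vanishes hH φ i j k l (bwdY H Z i j k l) := by
  rcases j with _ | j
  · exact Vanishes.zero _ _ _ _
  rcases l with _ | l
  · exact Vanishes.back_of_lt (dx := 0) (dy := 1) (by omega) (hH.antitone_right i j)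
  · have := (hZ i j k l).back (dx := 0) (dy := 1) (hH.antitone_right i j) (hH.antitone_right k l)
    rwa [← meet_eq_min] at this

lemma vanishes_bwdX {Z : ℕ → ℕ → ℕ → ℕ → ℕ} (hZ : ∀ i j k l, Vanishes hH φ i j k l (Z i j k l))
    (i j k l : ℕ) : Vanishes hH φ i j k l (bwdX H Z i j k l) := by
  rcases i with _ | i
  · exact Vanishes.zero _ _ _ _
  rcases k with _ | k
  · exact Vanishes.back_of_lt (dx := 1) (dy := 0) (by omega) (hH.antitone_left i j)
  · have := (hZ i j k l).back (dx := 1) (dy := 0) (hH.antitone_left i j) (hH.antitone_left k l)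
    rwa [← meet_eq_min] at this

lemma vanishes_diag {Z : ℕ → ℕ → ℕ → ℕ → ℕ} (hZ : ∀ i j k l, Vanishes hH φ i j k l (Z i j k l))
    (i j k l : ℕ) : Vanishes hH φ i j k l (diag H Z i j k l) := by
  simp only [diag, force_eq, meet_eq_min]
  rcases j with _ | j
  · exact Vanishes.zero _ _ _ _
  rcases l with _ | l
  · exact Vanishes.diag_zero
  · exact (hZ (i + 1) j (k + 1) l).diag

lemma vanishes_zeroHt (f i j k l : ℕ) : Vanishes hH φ i j k l (zeroHt H f i j k l) := by
  induction f generalizing i j k l with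
  | zero => exact Vanishes.zero _ _ _ _
  | succ f ih => exact vanishes_fwd ih i j k l

lemma vanishes_zeroHt' (f i j k l : ℕ) : Vanishes hH φ i j k l (zeroHt' H f i j k l) := by
  induction f generalizing i j k l with
  | zero => exact Vanishes.zero _ _ _ _
  | succ f ih =>
    exact (vanishes_fwd ih i j k l).join ((vanishes_diag ih i j k l).join
      ((vanishes_bwdX ih i j k l).join (vanishes_bwdY ih i j k l)))

lemma fullBound_eq (Z : ℕ → ℕ → ℕ → ℕ → ℕ) (m a : ℕ) :
    fullBound H Z m a = ∑ p ∈ Finset.range (m + 1) ×ˢ Finset.range (a + 1),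
      ∑ q ∈ Finset.range m ×ˢ Finset.range a,
        min (H q.1 q.2 - Z p.1 p.2 q.1 q.2) (gap H p.1 p.2) := by
  have aux : ∀ n t : ℕ, (Nat.rec 0 (fun _ _ => t) n : ℕ) = if n = 0 then 0 else t := by
    intro n t; cases n <;> rfl
  simp only [fullBound, sumTo_eq, force_eq, meet_eq_min, Finset.sum_product]
  refine Finset.sum_congr rfl fun i _ => Finset.sum_congr rfl fun j _ => ?_
  rw [aux]
  split_ifs with h
  · simp [h]
  refine Finset.sum_congr rfl fun k _ => Finset.sum_congr rfl fun l _ => ?_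
  rw [aux]
  split_ifs with h
  · simp [h]
  · rfl

lemma gap_eq_zero_of_le (m a : ℕ) (h0 : ∀ i j, m ≤ i ∨ a ≤ j → H i j = 0) (p : ℕ × ℕ)
    (hp : gap H p.1 p.2 ≠ 0) : p ∈ Finset.range (m + 1) ×ˢ Finset.range (a + 1) := by
  obtain ⟨i, j⟩ := p
  simp only [Finset.mem_product, Finset.mem_range]
  by_contra h
  apply hp
  rcases i with _ | i <;> rcases j with _ | j
  · omega
  · rw [gap_zero_succ, h0 0 j (by omega), Nat.zero_sub]
  · rw [gap_succ_zero, h0 i 0 (by omega), Nat.zero_sub]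
  · rw [gap_succ_succ]
    have : m ≤ i ∨ a ≤ j := by omega
    rcases this with h | h
    · rw [h0 i _ (Or.inl h), Nat.zero_min, Nat.zero_sub]
    · rw [h0 _ j (Or.inr h), Nat.min_zero, Nat.zero_sub]

theorem finite_and_le_fullBound (hH : IsHeight I H) {Z : ℕ → ℕ → ℕ → ℕ → ℕ} {m a : ℕ}
    (hZ : ∀ φ i j k l, Vanishes hH φ i j k l (Z i j k l))
    (h0 : ∀ i j, m ≤ i ∨ a ≤ j → H i j = 0) :
    Module.Finite ℂ (Tangent I) ∧ tangentDim I ≤ fullBound H Z m a := by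
  rw [fullBound_eq]
  refine finite_and_finrank_le hH hZ (gap_eq_zero_of_le m a h0) fun p hp => ?_
  rw [Finset.mem_product, Finset.mem_range, Finset.mem_range]
  by_contra h
  exact hp (h0 _ _ (by omega))

end Bound

section QuickBound

lemma getD_tl (r : List ℕ) (j : ℕ) : (tl r).getD j 0 = r.getD (j + 1) 0 := by
  cases r <;> simp [tl]

lemma hd_eq_getD (r : List ℕ) : hd r = r.getD 0 0 := by
  cases r <;> rfl

lemma hdRow_eq_getD (c : List (List ℕ)) : hdRow c = c.getD 0 [] := by
  cases c <;> rfl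

lemma rowCount_eq (c dy dx : ℕ) (r s : List ℕ) {N : ℕ} (hN : r.length ≤ N) :
    rowCount c dy dx r s = ∑ l ∈ Finset.range N,
      min (r.getD l 0 - max (min (r.getD (l + 1) 0) dy) (min (s.getD l 0) dx)) c := by
  induction r generalizing s N with
  | nil => exact (Finset.sum_eq_zero (by simp)).symm
  | cons h t ih =>
    obtain ⟨N, rfl⟩ : ∃ M, N = M + 1 := ⟨N - 1, by simp at hN; omega⟩
    have e : rowCount c dy dx (h :: t) s = min (h - join (min (hd t) dy) (min (hd s) dx)) c +
        rowCount c dy dx t (tl s) := by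
      rw [← meet_eq_min, ← meet_eq_min, ← meet_eq_min, join]
      simp only [rowCount, force_eq]
      rfl
    rw [e, Finset.sum_range_succ', ih (tl s) (by simpa using hN), join_eq_max, hd_eq_getD,
      hd_eq_getD, add_comm]
    simp only [getD_tl]
    simp

lemma chainCount_eq (ch : List (List ℕ)) (c dy dx : ℕ) {a : ℕ} (ha : ∀ r ∈ ch, r.length ≤ a) :
    chainCount ch c dy dx = ∑ k ∈ Finset.range ch.length, ∑ l ∈ Finset.range a,
      min (ht ch k l - max (min (ht ch k (l + 1)) dy) (min (ht ch (k + 1) l) dx)) c := by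
  induction ch with
  | nil => rfl
  | cons r d ih =>
    have e : chainCount (r :: d) c dy dx = rowCount c dy dx r (hdRow d) + chainCount d c dy dx :=
      rfl
    rw [e, List.length_cons, Finset.sum_range_succ', rowCount_eq c dy dx r _ (ha r (by simp)),
      ih fun r hr => ha r (by simp [hr]), add_comm, hdRow_eq_getD]
    simp [ht]

lemma rowGens_eq (F : ℕ → ℕ → ℕ → ℕ) (p : List ℕ) (left : ℕ) (r s : List ℕ) {N : ℕ}
    (hN : p.length ≤ N) (hF : ∀ dy dx, F 0 dy dx = 0) :
    rowGens F p left r s = ∑ j ∈ Finset.range N,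
      F (min (p.getD j 0) ((left :: r).getD j 0) - r.getD j 0)
        (r.getD j 0 - r.getD (j + 1) 0) (r.getD j 0 - s.getD j 0) := by
  induction p generalizing left r s N with
  | nil => exact (Finset.sum_eq_zero (by simp [hF])).symm
  | cons q p ih =>
    obtain ⟨N, rfl⟩ : ∃ M, N = M + 1 := ⟨N - 1, by simp at hN; omega⟩
    have aux : ∀ n t : ℕ, (Nat.rec 0 (fun _ _ => t) n : ℕ) = if n = 0 then 0 else t := by
      intro n t; cases n <;> rfl
    have e : rowGens F (q :: p) left r s = F (min q left - hd r) (hd r - hd (tl r)) (hd r - hd s) +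
        rowGens F p (hd r) (tl r) (tl s) := by
      rw [← meet_eq_min]
      simp only [rowGens, force_eq, aux]
      split_ifs with h
      · have h' : meet q left - hd r = 0 := h
        rw [h', hF]
        rfl
      · rfl
    rw [e, Finset.sum_range_succ', ih _ _ _ (by simpa using hN), hd_eq_getD (tl r),
      hd_eq_getD r, hd_eq_getD s, add_comm]
    congr 1
    · refine Finset.sum_congr rfl fun j _ => ?_
      simp only [getD_tl]
      cases j with
      | zero => simp
      | succ j => simp only [List.getD_cons_succ, getD_tl]
    · simp only [List.getD_cons_zero, getD_tl]

lemma chainGens_eq (F : ℕ → ℕ → ℕ → ℕ) (ch : List (List ℕ)) (p : List ℕ) {a : ℕ}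
    (hp : p.length ≤ a) (ha : ∀ r ∈ ch, r.length ≤ a) (hF : ∀ dy dx, F 0 dy dx = 0) :
    chainGens F ch p = ∑ i ∈ Finset.range (ch.length + 1), ∑ j ∈ Finset.range a,
      F (min (ht (p :: ch) i j) ((ht (p :: ch) i 0 :: ch.getD i []).getD j 0) - ht ch i j)
        (ht ch i j - ht ch i (j + 1)) (ht ch i j - ht ch (i + 1) j) := by
  induction ch generalizing p with
  | nil =>
    have e : chainGens F [] p = rowGens F p (hd p) [] [] := rfl
    rw [e, rowGens_eq F p _ _ _ hp hF]
    simp [ht, hd_eq_getD]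
  | cons r d ih =>
    have e : chainGens F (r :: d) p = rowGens F p (hd p) r (hdRow d) + chainGens F d r := rfl
    rw [e, rowGens_eq F p _ _ _ hp hF, ih r (ha r (by simp)) fun r hr => ha r (by simp [hr]),
      List.length_cons, Finset.sum_range_succ' _ (d.length + 1), add_comm]
    simp [ht, hd_eq_getD, hdRow_eq_getD]

lemma gap_le (ch : List (List ℕ)) (h : ht ch 0 0 ≤ 35) (i j : ℕ) :
    gap (ht ch) i j ≤ min (ht ((70 :: hdRow ch) :: ch) i j)
      ((ht ((70 :: hdRow ch) :: ch) i 0 :: ch.getD i []).getD j 0) - ht ch i j := by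
  rcases i with _ | i <;> rcases j with _ | j
  · rw [gap_zero_zero]
    simp only [ht] at h ⊢
    simp at h ⊢
    omega
  · rw [gap_zero_succ, hdRow_eq_getD]
    simp [ht]
  · rw [gap_succ_zero]
    simp [ht]
  · rw [gap_succ_succ]
    simp [ht]

theorem fullBound_le_quickBound (ch : List (List ℕ)) {a : ℕ} (ha : ∀ r ∈ ch, r.length ≤ a)
    (h : ht ch 0 0 ≤ 35) :
    fullBound (ht ch) (zeroHt (ht ch) 1) ch.length a ≤ quickBound ch := by
  have hF : ∀ dy dx, chainCount ch 0 dy dx = 0 := fun dy dx => by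
    rw [chainCount_eq ch 0 dy dx ha]; simp
  have hp : (70 :: hdRow ch).length ≤ a + 1 := by
    rw [hdRow_eq_getD, List.length_cons]
    cases ch with
    | nil => simp
    | cons r d => simpa using ha r (by simp)
  rw [fullBound_eq, quickBound, chainGens_eq _ _ _ hp (fun r hr => (ha r hr).trans a.le_succ) hF,
    Finset.sum_product]
  refine Finset.sum_le_sum fun i _ => Finset.sum_le_sum fun j _ => ?_
  rw [chainCount_eq _ _ _ _ ha, Finset.sum_product]
  refine Finset.sum_le_sum fun k _ => Finset.sum_le_sum fun l _ => ?_
  refine min_le_min (tsub_le_tsub_left (le_of_eq ?_) _) (gap_le ch h i j)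
  change _ = fwd (ht ch) (zeroHt (ht ch) 0) i j k l
  simp only [fwd, force_eq, join_eq_max, meet_eq_min]
  rfl

end QuickBound

section Enumeration

lemma andB_eq_true {a b : Bool} : andB a b = true ↔ a = true ∧ b = true := by
  cases a <;> cases b <;> decide

lemma orB_eq_true {a b : Bool} : orB a b = true ↔ a = true ∨ b = true := by
  cases a <;> cases b <;> decide

lemma allTo_spec {n : ℕ} {p : ℕ → Bool} (h : allTo n p = true) {k : ℕ} (h₁ : 1 ≤ k)
    (h₂ : k ≤ n) : p k = true := by
  induction n with
  | zero => omega
  | succ n ih =>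
    obtain ⟨ha, hb⟩ := andB_eq_true.1 (show andB (p (n + 1)) (allTo n p) = true from h)
    rcases h₂.lt_or_eq with h | rfl
    exacts [ih hb (by omega), ha]

/-- A strictly decreasing list of positive numbers below `prev`, bounded entrywise by `b`. -/
def RowOK : List ℕ → ℕ → List ℕ → Prop
  | _, _, [] => True
  | [], _, _ :: _ => False
  | b :: bs, prev, h :: t => 1 ≤ h ∧ h ≤ b ∧ h < prev ∧ RowOK bs h t

/-- A chain of `m + 1` nonempty rows, each bounded by the tail of the previous one. -/
def ChainOK : ℕ → List ℕ → List (List ℕ) → Prop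
  | _, _, [] => False
  | 0, b, r :: c => RowOK b 35 r ∧ r ≠ [] ∧ c = []
  | m + 1, b, r :: c => RowOK b 35 r ∧ r ≠ [] ∧ ChainOK m (tl r) c

lemma RowOK.two_mul_sum_le {b : List ℕ} {prev : ℕ} {t : List ℕ} (h : RowOK b (prev + 1) t) :
    2 * t.sum ≤ prev * (prev + 1) := by
  induction t generalizing b prev with
  | nil => simp
  | cons a t ih =>
    cases b with
    | nil => exact h.elim
    | cons b bs =>
      obtain ⟨h₁, -, h₂, h₃⟩ := h
      obtain ⟨a, rfl⟩ : ∃ a', a = a' + 1 := ⟨a - 1, by omega⟩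
      obtain ⟨d, rfl⟩ : ∃ d, prev = a + 1 + d := ⟨prev - (a + 1), by omega⟩
      have := ih h₃
      rw [List.sum_cons]
      nlinarith

lemma rowAll_spec {b t : List ℕ} {prev rem : ℕ} {k : ℕ → List ℕ → Bool}
    (h : rowAll b prev rem k = true) (ht : RowOK b prev t) (hs : t.sum ≤ rem) :
    k (rem - t.sum) t = true := by
  induction b generalizing t prev rem k with
  | nil =>
    cases t with
    | nil => exact h
    | cons a t => exact ht.elim
  | cons b bs ih =>
    obtain ⟨h₀, h₁⟩ := andB_eq_true.1 (show andB (k rem []) (allTo (meet (meet b (prev - 1)) rem)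
      fun a => force a fun a => rowAll bs a (rem - a) fun r t => k r (a :: t)) = true from h)
    cases t with
    | nil => exact h₀
    | cons a t =>
      obtain ⟨ha, hb, hp, ht⟩ := ht
      rw [List.sum_cons] at hs ⊢
      have h₂ := allTo_spec h₁ ha (by rw [meet_eq_min, meet_eq_min]; omega)
      rw [force_eq] at h₂
      have := ih h₂ ht (by omega)
      rwa [Nat.sub_sub] at this

lemma lastAll_spec {b t : List ℕ} {prev rem : ℕ} {k : List ℕ → Bool}
    (h : lastAll b prev rem k = true) (ht : RowOK b prev t) (hs : t.sum = rem) :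
    k t = true := by
  induction b generalizing t prev rem k with
  | nil =>
    cases t with
    | nil => subst hs; exact h
    | cons a t => exact ht.elim
  | cons b bs ih =>
    cases t with
    | nil => subst hs; exact h
    | cons a t =>
      have hrow := ht
      obtain ⟨ha, hb, hp, ht⟩ := ht
      have hsum : 2 * (a + t.sum) ≤ a * (a + 1) := by
        rw [← List.sum_cons]
        exact RowOK.two_mul_sum_le (b := b :: bs) ⟨ha, hb, Nat.lt_succ_self a, ht⟩
      rw [List.sum_cons] at hs
      obtain ⟨rem, rfl⟩ : ∃ r, rem = r + 1 := ⟨rem - 1, by omega⟩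
      have h₁ : (allTo (meet (meet b (prev - 1)) (rem + 1)) fun a =>
        Bool.rec true (force a fun a => lastAll bs a (rem + 1 - a) fun t => k (a :: t))
          (Nat.ble (2 * (rem + 1)) (a * (a + 1)))) = true := h
      have h₂ := allTo_spec h₁ ha (by rw [meet_eq_min, meet_eq_min]; omega)
      have h₃ : Nat.ble (2 * (rem + 1)) (a * (a + 1)) = true := by
        rw [Nat.ble_eq, ← hs]; exact hsum
      rw [h₃, force_eq] at h₂
      exact ih (k := fun t => k (a :: t)) h₂ ht (by omega)

lemma nonempty_spec {r : List ℕ} {b : Bool} (h : nonempty r b = true) (hr : r ≠ []) : b = true := by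
  cases r with
  | nil => exact absurd rfl hr
  | cons => exact h

theorem chainAll_spec {m : ℕ} {b : List ℕ} {rem : ℕ} {k : List (List ℕ) → Bool}
    (h : chainAll m b rem k = true) {ch : List (List ℕ)} (hc : ChainOK m b ch)
    (hs : (ch.map List.sum).sum = rem) : k ch = true := by
  induction m generalizing b rem k ch with
  | zero =>
    match ch, hc with
    | r :: c, ⟨hr, hne, hc⟩ =>
      subst hc
      exact nonempty_spec
        (lastAll_spec (k := fun r => nonempty r (k [r])) h hr (by simpa using hs)) hne
  | succ m ih =>
    match ch, hc with
    | r :: c, ⟨hr, hne, hc⟩ =>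
      rw [List.map_cons, List.sum_cons] at hs
      have := nonempty_spec (rowAll_spec (show (rowAll b 35 rem fun rem r =>
        nonempty r (force rem fun rem => chainAll m (tl r) rem fun c => k (r :: c))) = true from h)
          hr (by omega)) hne
      rw [force_eq] at this
      exact ih this hc (by omega)

/-- The list of the first `n` values of `f`. -/
def rowList (f : ℕ → ℕ) : ℕ → List ℕ
  | 0 => []
  | n + 1 => f 0 :: rowList (fun j => f (j + 1)) n

lemma length_rowList (f : ℕ → ℕ) (n : ℕ) : (rowList f n).length = n := by
  induction n generalizing f with
  | zero => rfl
  | succ n ih => simp [rowList, ih]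

lemma sum_rowList (f : ℕ → ℕ) (n : ℕ) : (rowList f n).sum = ∑ j ∈ Finset.range n, f j := by
  induction n generalizing f with
  | zero => rfl
  | succ n ih => rw [rowList, List.sum_cons, ih, Finset.sum_range_succ', add_comm]

lemma getD_rowList (f : ℕ → ℕ) (n j : ℕ) : (rowList f n).getD j 0 = if j < n then f j else 0 := by
  induction n generalizing f j with
  | zero => rfl
  | succ n ih =>
    cases j with
    | zero => simp [rowList]
    | succ j => rw [rowList, List.getD_cons_succ, ih]; simp

lemma rowOK_rowList {f : ℕ → ℕ} {n prev : ℕ} {b : List ℕ} (hb : ∀ j < n, f j ≤ b.getD j 0)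
    (hpos : ∀ j < n, 1 ≤ f j) (hf : ∀ j < n, f (j + 1) ≤ f j - 1) (hp : f 0 < prev) :
    RowOK b prev (rowList f n) := by
  induction n generalizing f b prev with
  | zero => cases b <;> trivial
  | succ n ih =>
    cases b with
    | nil =>
      have := hb 0 n.succ_pos
      have := hpos 0 n.succ_pos
      simp at *
      omega
    | cons b bs =>
      have h0 := hf 0 n.succ_pos
      have h1 := hpos 0 n.succ_pos
      exact ⟨h1, by simpa using hb 0 n.succ_pos, hp,
        ih (fun j hj => by simpa using hb (j + 1) (by omega)) (fun j hj => hpos (j + 1) (by omega))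
          (fun j hj => hf (j + 1) (by omega)) (by omega)⟩

/-- Numerical properties of the heights of a strongly stable ideal of colength `N` whose first
pure power of `x` is `x ^ m`. -/
structure IsStaircase (H : ℕ → ℕ → ℕ) (m N : ℕ) : Prop where
  strict : ∀ i j, H i (j + 1) ≤ H i j - 1
  le_diag : ∀ i j, H (i + 1) j ≤ H i (j + 1)
  pos : ∀ i < m, 0 < H i 0
  zero : H m 0 = 0
  sum_eq : ∀ K, H 0 0 ≤ K → ∑ i ∈ Finset.range m, ∑ j ∈ Finset.range K, H i j = N

variable {H : ℕ → ℕ → ℕ} {m N : ℕ}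

lemma IsStaircase.add_le (hH : IsStaircase H m N) (i j k : ℕ) : H i (j + k) ≤ H i j - k := by
  induction k with
  | zero => simp
  | succ k ih =>
    have := hH.strict i (j + k)
    rw [← add_assoc]
    omega

lemma IsStaircase.antitone_left (hH : IsStaircase H m N) (i j : ℕ) : H (i + 1) j ≤ H i j := by
  have := hH.le_diag i j
  have := hH.strict i j
  omega

lemma IsStaircase.eq_zero_of_le (hH : IsStaircase H m N) {i : ℕ} (hi : m ≤ i) (j : ℕ) :
    H i j = 0 := by
  have h₁ := hH.add_le i 0 j
  have h₂ := antitone_nat_of_succ_le (f := fun i => H i 0) (fun i => hH.antitone_left i 0) hi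
  have := hH.zero
  rw [zero_add] at h₁
  dsimp only at h₂
  omega

lemma IsStaircase.le_zero_zero (hH : IsStaircase H m N) (i j : ℕ) : H i j ≤ H 0 0 - j := by
  have h₁ := hH.add_le i 0 j
  have h₂ := antitone_nat_of_succ_le (f := fun i => H i 0) (fun i => hH.antitone_left i 0) i.zero_le
  rw [zero_add] at h₁
  dsimp only at h₂
  omega

lemma IsStaircase.sum_row_le (hH : IsStaircase H m N) (i K : ℕ) :
    ∑ j ∈ Finset.range K, H i j ≤ N := by
  by_cases hi : i < m
  · rw [← hH.sum_eq (max (H 0 0) K) (le_max_left _ _)]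
    refine le_trans ?_ (Finset.single_le_sum
      (f := fun i => ∑ j ∈ Finset.range (max (H 0 0) K), H i j)
      (fun _ _ => Nat.zero_le _) (Finset.mem_range.2 hi))
    exact Finset.sum_le_sum_of_subset (Finset.range_subset_range.2 (le_max_right _ _))
  · rw [Finset.sum_eq_zero fun j _ => hH.eq_zero_of_le (not_lt.1 hi) j]
    exact N.zero_le

lemma IsStaircase.zero_zero_le (hH : IsStaircase H m N) : H 0 0 ≤ N := by
  simpa using hH.sum_row_le 0 1

lemma IsStaircase.eq_zero_of_seven_le (hH : IsStaircase H m 34) (i : ℕ) {j : ℕ} (hj : 7 ≤ j) :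
    H i j = 0 := by
  have h := hH.sum_row_le i 8
  have h7 := hH.add_le i 7 (j - 7)
  rw [show 7 + (j - 7) = j by omega] at h7
  simp only [Finset.sum_range_succ, Finset.sum_range_zero] at h
  have h0 : H i 1 ≤ H i 0 - 1 := hH.strict i 0
  have h1 : H i 2 ≤ H i 1 - 1 := hH.strict i 1
  have h2 : H i 3 ≤ H i 2 - 1 := hH.strict i 2
  have h3 : H i 4 ≤ H i 3 - 1 := hH.strict i 3
  have h4 : H i 5 ≤ H i 4 - 1 := hH.strict i 4
  have h5 : H i 6 ≤ H i 5 - 1 := hH.strict i 5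
  have h6 : H i 7 ≤ H i 6 - 1 := hH.strict i 6
  omega

lemma exists_rowLen {f : ℕ → ℕ} (hf : ∀ j, f (j + 1) ≤ f j - 1) (h7 : ∀ j, 7 ≤ j → f j = 0) :
    ∃ n ≤ 7, ∀ j, j < n ↔ 0 < f j := by
  have h : ∃ j, f j = 0 := ⟨7, h7 7 le_rfl⟩
  refine ⟨Nat.find h, Nat.find_min' h (h7 7 le_rfl), fun j => ⟨fun hj => ?_, fun hj => ?_⟩⟩
  · exact Nat.pos_of_ne_zero (Nat.find_min h hj)
  · by_contra hlt
    have hanti : Antitone f := antitone_nat_of_succ_le fun j => by have := hf j; omega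
    have := hanti (not_lt.1 hlt)
    rw [Nat.find_spec h] at this
    omega

/-- The list of the first `m + 1` rows. -/
def chainList (F : ℕ → ℕ → ℕ) (n : ℕ → ℕ) : ℕ → List (List ℕ)
  | 0 => [rowList (F 0) (n 0)]
  | m + 1 => rowList (F 0) (n 0) :: chainList (fun i => F (i + 1)) (fun i => n (i + 1)) m

lemma chainList_eq_map (F : ℕ → ℕ → ℕ) (n : ℕ → ℕ) (m : ℕ) :
    chainList F n m = (List.range (m + 1)).map fun i => rowList (F i) (n i) := by
  induction m generalizing F n with
  | zero => rfl
  | succ m ih => rw [chainList, ih, List.range_succ_eq_map (n := m + 1)]; simp [Function.comp_def]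

lemma getD_map_range (f : ℕ → List ℕ) (n i : ℕ) :
    ((List.range n).map f).getD i [] = if i < n then f i else [] := by
  split_ifs with h
  · rw [List.getD_eq_getElem _ _ (by simpa using h), List.getElem_map, List.getElem_range]
  · exact List.getD_eq_default _ _ (by simpa using h)

lemma chainOK_chainList {F : ℕ → ℕ → ℕ} {n : ℕ → ℕ} {b : List ℕ}
    (hn : ∀ i j, j < n i ↔ 0 < F i j) (hF : ∀ i j, F i (j + 1) ≤ F i j - 1)
    (hd : ∀ i j, F (i + 1) j ≤ F i (j + 1)) (h35 : ∀ i, F i 0 < 35)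
    (hpos : ∀ i ≤ m, 0 < F i 0) (hb : ∀ j, F 0 j ≤ b.getD j 0) :
    ChainOK m b (chainList F n m) := by
  have hrow : RowOK b 35 (rowList (F 0) (n 0)) :=
    rowOK_rowList (fun j _ => hb j) (fun j hj => (hn 0 j).1 hj) (fun j _ => hF 0 j) (h35 0)
  have hne : rowList (F 0) (n 0) ≠ [] := by
    rw [← List.length_pos_iff, length_rowList, hn]
    exact hpos 0 m.zero_le
  induction m generalizing F n b with
  | zero => exact ⟨hrow, hne, rfl⟩
  | succ m ih =>
    have hb' : ∀ j, F 1 j ≤ (tl (rowList (F 0) (n 0))).getD j 0 := by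
      intro j
      rw [getD_tl, getD_rowList]
      have h₁ := hd 0 j
      have h₂ := hn 0 (j + 1)
      rw [zero_add] at h₁
      split_ifs <;> omega
    have hpos' : ∀ i ≤ m, 0 < F (i + 1) 0 := fun i hi => hpos (i + 1) (by omega)
    refine ⟨hrow, hne, ih (fun i => hn (i + 1)) (fun i => hF (i + 1)) (fun i => hd (i + 1))
      (fun i => h35 (i + 1)) hpos' hb' ?_ ?_⟩
    · exact rowOK_rowList (fun j _ => hb' j) (fun j hj => (hn 1 j).1 hj) (fun j _ => hF 1 j) (h35 1)
    · rw [← List.length_pos_iff, length_rowList, hn]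
      exact hpos' 0 m.zero_le

theorem exists_chain (hH : IsStaircase H (m + 1) 34) {k : List (List ℕ) → Bool}
    (h : chainAll m (List.replicate 34 34) 34 k = true) :
    ∃ ch, ht ch = H ∧ ch.length = m + 1 ∧ (∀ r ∈ ch, r.length ≤ 7) ∧ k ch = true := by
  choose n hn7 hn using fun i => exists_rowLen (hH.strict i) fun j hj => hH.eq_zero_of_seven_le i hj
  have h34 := hH.zero_zero_le
  refine ⟨chainList H n m, ?_, ?_, ?_, chainAll_spec h (chainOK_chainList hn hH.strict hH.le_diag
    (fun i => ?_) (fun i hi => hH.pos i (by omega)) fun j => ?_) ?_⟩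
  · funext i j
    rw [ht, chainList_eq_map, getD_map_range]
    split_ifs with hi
    · rw [getD_rowList]
      have := hn i j
      split_ifs <;> omega
    · rw [hH.eq_zero_of_le (not_lt.1 hi)]
      rfl
  · simp [chainList_eq_map]
  · simp only [chainList_eq_map, List.mem_map]
    rintro _ ⟨i, -, rfl⟩
    rw [length_rowList]
    exact hn7 i
  · have := hH.le_zero_zero i 0
    omega
  · have := hH.le_zero_zero 0 j
    by_cases hj : j < 34
    · rw [List.getD_eq_getElem _ _ (by simpa using hj), List.getElem_replicate]
      omega
    · omega
  · rw [chainList_eq_map, List.map_map, ← hH.sum_eq 34 h34]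
    change ∑ i ∈ Finset.range (m + 1), (rowList (H i) (n i)).sum = _
    refine Finset.sum_congr rfl fun i _ => ?_
    rw [sum_rowList]
    refine Finset.sum_subset (Finset.range_subset_range.2 ((hn7 i).trans (by omega)))
      fun j _ hj => ?_
    rw [Finset.mem_range, hn] at hj
    omega

end Enumeration

section Heights

variable {I : Ideal (MvPolynomial (Fin 3) ℂ)} {N : ℕ}

lemma ex_injective : Function.Injective fun q : Σ _ : ℕ × ℕ, ℕ => ex q.1.1 q.1.2 q.2 := by
  rintro ⟨⟨i, j⟩, k⟩ ⟨⟨i', j'⟩, k'⟩ h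
  have h0 : i = i' := DFunLike.congr_fun h 0
  have h1 : j = j' := DFunLike.congr_fun h 1
  have h2 : k = k' := DFunLike.congr_fun h 2
  subst h0 h1 h2
  rfl

lemma linearIndependent_mk_monomial (hI : IsMonomialIdeal I) :
    LinearIndependent ℂ fun n : {n : Fin 3 →₀ ℕ // monomial n (1 : ℂ) ∉ I} =>
      Ideal.Quotient.mk I (monomial (n : Fin 3 →₀ ℕ) 1) := by
  classical
  rw [linearIndependent_iff']
  intro s g hg n hn
  have := congrArg (coefQ I n) hg
  simp only [map_sum, map_smul, coefQ_mk hI n.2, map_zero, coeff_monomial] at this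
  rw [Finset.sum_eq_single n] at this
  · simpa using this
  · intro b _ hb
    rw [if_neg fun h => hb (Subtype.ext h), smul_zero]
  · exact fun h => absurd hn h

lemma finrank_eq_ncard_compl (hI : IsMonomialIdeal I)
    (hfin : {n : Fin 3 →₀ ℕ | monomial n (1 : ℂ) ∉ I}.Finite) :
    Module.finrank ℂ (MvPolynomial (Fin 3) ℂ ⧸ I) =
      {n : Fin 3 →₀ ℕ | monomial n (1 : ℂ) ∉ I}.ncard := by
  have hli := linearIndependent_mk_monomial hI
  have : Finite {n : Fin 3 →₀ ℕ // monomial n (1 : ℂ) ∉ I} := hfin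
  have := Fintype.ofFinite {n : Fin 3 →₀ ℕ // monomial n (1 : ℂ) ∉ I}
  let f : (MvPolynomial (Fin 3) ℂ ⧸ I) →ₗ[ℂ] ({n : Fin 3 →₀ ℕ // monomial n (1 : ℂ) ∉ I} → ℂ) :=
    LinearMap.pi fun n => coefQ I n
  have hf : Function.Injective f := (injective_iff_map_eq_zero f).2 fun q hq =>
    eq_zero_of_coefQ hI q fun n hn => congrFun hq ⟨n, hn⟩
  have : Module.Finite ℂ (MvPolynomial (Fin 3) ℂ ⧸ I) := Module.Finite.of_injective f hf
  have h₁ := LinearMap.finrank_le_finrank_of_injective hf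
  have h₂ := hli.fintype_card_le_finrank
  rw [Module.finrank_fintype_fun_eq_card] at h₁
  change _ = Nat.card {n : Fin 3 →₀ ℕ // monomial n (1 : ℂ) ∉ I}
  rw [Nat.card_eq_fintype_card]
  omega

lemma compl_eq {H : ℕ → ℕ → ℕ} (hmem : ∀ i j k, monomial (ex i j k) (1 : ℂ) ∈ I ↔ H i j ≤ k)
    {m K : ℕ} (hz : ∀ i j, m ≤ i ∨ K ≤ j → H i j = 0) :
    {n : Fin 3 →₀ ℕ | monomial n (1 : ℂ) ∉ I} =
      (((Finset.range m ×ˢ Finset.range K).sigma fun q => Finset.range (H q.1 q.2)).map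
        ⟨fun q : Σ _ : ℕ × ℕ, ℕ => ex q.1.1 q.1.2 q.2, ex_injective⟩ : Finset (Fin 3 →₀ ℕ)) := by
  ext n
  obtain ⟨i, j, k, rfl⟩ : ∃ i j k, n = ex i j k := ⟨_, _, _, (ex_eta n).symm⟩
  rw [Set.mem_ofPred_eq, hmem, Finset.mem_coe, not_le, Finset.mem_map]
  constructor
  · intro h
    refine ⟨⟨(i, j), k⟩, ?_, rfl⟩
    simp only [Finset.mem_sigma, Finset.mem_product, Finset.mem_range]
    refine ⟨?_, h⟩
    by_contra hij
    have := hz i j (by omega)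
    omega
  · rintro ⟨⟨⟨i', j'⟩, k'⟩, hq, he⟩
    cases ex_injective (a₂ := ⟨(i, j), k⟩) he
    simpa using (Finset.mem_sigma.1 hq).2

lemma ncard_compl {H : ℕ → ℕ → ℕ} (hmem : ∀ i j k, monomial (ex i j k) (1 : ℂ) ∈ I ↔ H i j ≤ k)
    {m K : ℕ} (hz : ∀ i j, m ≤ i ∨ K ≤ j → H i j = 0) :
    {n : Fin 3 →₀ ℕ | monomial n (1 : ℂ) ∉ I}.ncard =
      ∑ i ∈ Finset.range m, ∑ j ∈ Finset.range K, H i j := by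
  rw [compl_eq hmem hz, Set.ncard_coe_finset, Finset.card_map, Finset.card_sigma,
    Finset.sum_product]
  simp

lemma X_pow_eq (m : ℕ) : (X 0 : MvPolynomial (Fin 3) ℂ) ^ m = monomial (ex m 0 0) 1 := by
  have h : Finsupp.single 0 m = ex m 0 0 := by ext t; fin_cases t <;> simp
  rw [X_pow_eq_monomial, h]

lemma ex_swap (hB : IsBorelFixed I) {i j k : ℕ} :
    (monomial (ex i (j + 1) k) (1 : ℂ) ∈ I → monomial (ex (i + 1) j k) (1 : ℂ) ∈ I) ∧
      (monomial (ex i j (k + 1)) (1 : ℂ) ∈ I → monomial (ex i (j + 1) k) (1 : ℂ) ∈ I) := by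
  constructor
  · intro h
    convert hB _ h 0 1 (by decide) (by simp)
    ext t; fin_cases t <;> simp
  · intro h
    convert hB _ h 1 2 (by decide) (by simp)
    ext t; fin_cases t <;> simp

theorem exists_height (hI : IsMonomialIdeal I) (hB : IsBorelFixed I)
    (hN : Module.finrank ℂ (MvPolynomial (Fin 3) ℂ ⧸ I) = N) (h0 : N ≠ 0) {m : ℕ}
    (hm : (X 0 : MvPolynomial (Fin 3) ℂ) ^ m ∈ I)
    (hm' : (X 0 : MvPolynomial (Fin 3) ℂ) ^ (m - 1) ∉ I) :
    ∃ H, IsHeight I H ∧ IsStaircase H m N := by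
  classical
  have : Module.Finite ℂ (MvPolynomial (Fin 3) ℂ ⧸ I) := Module.finite_of_finrank_pos (by omega)
  have hfin : {n : Fin 3 →₀ ℕ | monomial n (1 : ℂ) ∉ I}.Finite :=
    (linearIndependent_mk_monomial hI).finite
  rw [finrank_eq_ncard_compl hI hfin] at hN
  have hex : ∀ i j, ∃ k, monomial (ex i j k) (1 : ℂ) ∈ I := by
    intro i j
    by_contra! h
    refine Set.infinite_of_injective_forall_mem (f := fun k => ex i j k) (fun k k' hk => ?_) h hfin
    exact DFunLike.congr_fun hk 2
  let H : ℕ → ℕ → ℕ := fun i j => Nat.find (hex i j)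
  have hmem : ∀ i j k, monomial (ex i j k) (1 : ℂ) ∈ I ↔ H i j ≤ k := by
    refine fun i j k => ⟨fun h => Nat.find_min' _ h, fun h => ?_⟩
    have := monomial_add_mem (ex 0 0 (k - H i j)) (Nat.find_spec (hex i j))
    rwa [ex_add, add_zero, add_zero, Nat.add_sub_cancel' h] at this
  have hdiag : ∀ i j, H (i + 1) j ≤ H i (j + 1) := fun i j => by
    rw [← hmem]; exact (ex_swap hB).1 ((hmem _ _ _).2 le_rfl)
  have hstrict : ∀ i j, H i (j + 1) ≤ H i j - 1 := fun i j => by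
    rcases Nat.eq_zero_or_pos (H i j) with h | h
    · have := monomial_add_mem (ex 0 1 0) ((hmem i j (H i j)).2 le_rfl)
      rw [ex_add, hmem] at this
      simp only [add_zero] at this
      omega
    · rw [← hmem]
      refine (ex_swap hB).2 ((hmem _ _ _).2 ?_)
      omega
  have hright : ∀ i j, H i (j + 1) ≤ H i j := fun i j => by have := hstrict i j; omega
  have hleft : ∀ i j, H (i + 1) j ≤ H i j := fun i j => (hdiag i j).trans (hright i j)
  have hHt : IsHeight I H := ⟨hI, hmem, hleft, hright, hdiag⟩
  rw [X_pow_eq, hmem] at hm hm'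
  have hanti : Antitone fun i => H i 0 := antitone_nat_of_succ_le fun i => hleft i 0
  have hzero : ∀ i j, m ≤ i → H i j = 0 := by
    intro i j hi
    have h₁ : H i j ≤ H i 0 := antitone_nat_of_succ_le (hright i) j.zero_le
    have h₂ : H i 0 ≤ H m 0 := hanti hi
    omega
  refine ⟨H, hHt, hstrict, hdiag, fun i hi => ?_, by omega, fun K hK => ?_⟩
  · have : H (m - 1) 0 ≤ H i 0 := hanti (by omega)
    omega
  · rw [← hN, ncard_compl hmem]
    rintro i j (hi | hj)
    · exact hzero i j hi
    · have h₁ : ∀ j, H i j ≤ H i 0 - j := fun j => by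
        induction j with
        | zero => simp
        | succ j ih => have := hstrict i j; omega
      have h₂ := h₁ j
      have h₃ : H i 0 ≤ H 0 0 := hanti i.zero_le
      omega

lemma IsStaircase.eq_zero {H : ℕ → ℕ → ℕ} {m : ℕ} (hS : IsStaircase H m 34) (i j : ℕ)
    (h : m ≤ i ∨ 7 ≤ j) : H i j = 0 :=
  h.elim (fun h => hS.eq_zero_of_le h j) fun h => hS.eq_zero_of_seven_le i h

theorem tangentDim_le_of_good {H : ℕ → ℕ → ℕ} {m T : ℕ} (hH : IsHeight I H)
    (hS : IsStaircase H m 34) {ch : List (List ℕ)} (hch : ht ch = H) (hlen : ch.length = m)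
    (hrow : ∀ r ∈ ch, r.length ≤ 7) (hgood : good m T ch = true) : tangentDim I ≤ T := by
  subst hch
  rcases orB_eq_true.1 hgood with h | h
  · rw [Nat.ble_eq] at h
    refine le_trans ?_ h
    refine le_trans ?_ (fullBound_le_quickBound ch hrow (hS.zero_zero_le.trans (by norm_num)))
    rw [hlen]
    exact (finite_and_le_fullBound hH (fun φ => vanishes_zeroHt (φ := φ) 1) hS.eq_zero).2
  · rcases orB_eq_true.1 h with h | h <;> rw [Nat.ble_eq] at h
    · exact (finite_and_le_fullBound hH (fun φ => vanishes_zeroHt (φ := φ) 4) hS.eq_zero).2.trans h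
    · exact (finite_and_le_fullBound hH (fun φ => vanishes_zeroHt' (φ := φ) 3) hS.eq_zero).2.trans h

theorem tangentDim_le {m T : ℕ}
    (hcheck : chainAll m (List.replicate 34 34) 34 (good (m + 1) T) = true)
    (hI : IsMonomialIdeal I) (hB : IsBorelFixed I)
    (hN : Module.finrank ℂ (MvPolynomial (Fin 3) ℂ ⧸ I) = 34)
    (hm : (X 0 : MvPolynomial (Fin 3) ℂ) ^ (m + 1) ∈ I)
    (hm' : (X 0 : MvPolynomial (Fin 3) ℂ) ^ m ∉ I) : tangentDim I ≤ T := by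
  obtain ⟨H, hH, hS⟩ := exists_height hI hB hN (by norm_num) hm hm'
  obtain ⟨ch, hch, hlen, hrow, hgood⟩ := exists_chain hS hcheck
  exact tangentDim_le_of_good hH hS hch hlen hrow hgood

end Heights

/-- `H` fails the inequality at the shift of the least common multiple of `x` and `y`
by `n - g`. -/
def linked (H : ℕ → ℕ → ℕ) (g n x y : ℕ × ℕ × ℕ) : Bool :=
  Nat.blt (max x.2.2 y.2.2 + n.2.2 - g.2.2)
    (H (max x.1 y.1 + n.1 - g.1) (max x.2.1 y.2.1 + n.2.1 - g.2.1))

/-- The shift by `n - g` keeps `x` in the positive octant, and `x` does not precede `g`. -/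
def admissible (g n x : ℕ × ℕ × ℕ) : Bool :=
  Nat.ble g.1 (x.1 + n.1) && Nat.ble g.2.1 (x.2.1 + n.2.1) && Nat.ble g.2.2 (x.2.2 + n.2.2) &&
    Nat.ble (8 * g.1 + g.2.1) (8 * x.1 + x.2.1)

/-- Whether the closure of `W` under `linked` within `R`, computed in at most `f` steps, consists
of admissible exponents. -/
def closes (H : ℕ → ℕ → ℕ) (g n : ℕ × ℕ × ℕ) : ℕ → List (ℕ × ℕ × ℕ) → List (ℕ × ℕ × ℕ) → Bool
  | 0, _, _ => false
  | _ + 1, [], _ => true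
  | f + 1, x :: W, R => admissible g n x &&
      closes H g n f (R.filter (linked H g n x) ++ W) (R.filter fun y => !linked H g n x y)

/-- Exponents of generators of the ideal of heights `H`. -/
def generators (H : ℕ → ℕ → ℕ) (m a : ℕ) : List (ℕ × ℕ × ℕ) :=
  (List.range (m + 1)).flatMap fun i =>
    ((List.range (a + 1)).filter fun j => gap H i j != 0).map fun j => (i, j, H i j)

/-- The number of pairs of a generator in `L` and an exponent outside the ideal which give rise
to a homomorphism `I → R ⧸ I`. -/
def countHoms (H : ℕ → ℕ → ℕ) (m a : ℕ) (L : List (ℕ × ℕ × ℕ)) : ℕ :=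
  sumTo (m + 1) fun i => sumTo (a + 1) fun j => sumTo m fun k => sumTo a fun l =>
    sumTo (H k l) fun w => bif Nat.ble (H k l) (w + gap H i j) &&
      closes H (i, j, H i j) (k, l, w) 99 [(i, j, H i j)] L then 1 else 0

section Homs

variable {I : Ideal (MvPolynomial (Fin 3) ℂ)} {H : ℕ → ℕ → ℕ}

lemma closes_spec {g n : ℕ × ℕ × ℕ} {f : ℕ} {W R : List (ℕ × ℕ × ℕ)}
    (h : closes H g n f W R = true) :
    ∃ G R' : Set (ℕ × ℕ × ℕ), (∀ x ∈ W, x ∈ G) ∧ (∀ y ∈ R, y ∈ G ∨ y ∈ R') ∧ (∀ y ∈ R', y ∈ R) ∧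
      (∀ x ∈ G, admissible g n x = true) ∧ ∀ x ∈ G, ∀ y ∈ R', linked H g n x y = false := by
  induction f generalizing W R with
  | zero => simp [closes] at h
  | succ f ih =>
    cases W with
    | nil => exact ⟨∅, {y | y ∈ R}, by simp, by simp, by simp, by simp, by simp⟩
    | cons x W =>
      rw [closes, Bool.and_eq_true] at h
      obtain ⟨G, R', hW, hR, hR', hadm, hl⟩ := ih h.2
      refine ⟨insert x G, R', ?_, ?_, ?_, ?_, ?_⟩
      · intro y hy
        rcases List.mem_cons.1 hy with rfl | hy
        · exact Set.mem_insert _ _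
        · exact Set.mem_insert_of_mem _ (hW y (List.mem_append_right _ hy))
      · intro y hy
        by_cases hxy : linked H g n x y = true
        · exact Or.inl (Set.mem_insert_of_mem _
            (hW y (List.mem_append_left _ (List.mem_filter.2 ⟨hy, hxy⟩))))
        · refine (hR y (List.mem_filter.2 ⟨hy, by simpa using hxy⟩)).imp_left ?_
          exact Set.mem_insert_of_mem _
      · exact fun y hy => (List.mem_filter.1 (hR' y hy)).1
      · rintro y (rfl | hy)
        exacts [h.1, hadm y hy]
      · rintro z (rfl | hz) y hy
        · simpa using (List.mem_filter.1 (hR' y hy)).2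
        · exact hl z hz y hy

lemma mem_of_le {d d' : Fin 3 →₀ ℕ} (h : monomial d (1 : ℂ) ∈ I) (hd : d ≤ d') :
    monomial d' (1 : ℂ) ∈ I := by
  simpa [add_tsub_cancel_of_le hd] using monomial_add_mem (d' - d) h

/-- A function on exponents compatible with multiplication by monomials extends to a
homomorphism `I → R ⧸ I`. -/
lemma exists_tangent (hI : IsMonomialIdeal I) (T : (Fin 3 →₀ ℕ) → MvPolynomial (Fin 3) ℂ ⧸ I)
    (hT : ∀ d e, monomial d (1 : ℂ) ∈ I → T (d + e) = monomial e (1 : ℂ) • T d) :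
    ∃ φ : Tangent I, ∀ d (hd : monomial d (1 : ℂ) ∈ I), φ ⟨monomial d 1, hd⟩ = T d := by
  let Φ : MvPolynomial (Fin 3) ℂ →ₗ[ℂ] MvPolynomial (Fin 3) ℂ ⧸ I :=
    (basisMonomials (Fin 3) ℂ).constr ℂ T
  have hΦ : ∀ d (c : ℂ), Φ (monomial d c) = c • T d := by
    intro d c
    have h₁ : Φ (monomial d 1) = T d := by
      have := (basisMonomials (Fin 3) ℂ).constr_basis ℂ T d
      rwa [coe_basisMonomials] at this
    rw [← h₁, ← map_smul, smul_monomial, smul_eq_mul, mul_one]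
  have hmul : ∀ e (c : ℂ) d (b : ℂ), monomial d (1 : ℂ) ∈ I →
      Φ (monomial e c * monomial d b) = monomial e c • Φ (monomial d b) := by
    intro e c d b hd
    have hc : monomial e c = c • monomial e (1 : ℂ) := by
      rw [smul_monomial, smul_eq_mul, mul_one]
    rw [monomial_mul, hΦ, hΦ, add_comm e d, hT d e hd, hc, smul_assoc, mul_smul]
    congr 1
    exact smul_comm _ _ _
  have hlin : ∀ r p, p ∈ I → Φ (r * p) = r • Φ p := by
    intro r p hp
    induction r using MvPolynomial.induction_on' with
    | monomial e c =>
      conv_lhs => rw [p.as_sum]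
      conv_rhs => rw [p.as_sum]
      rw [Finset.mul_sum, map_sum, map_sum, Finset.smul_sum]
      exact Finset.sum_congr rfl fun d hd => hmul e c d _ (hI p hp d hd)
    | add r s hr hs => rw [add_mul, map_add, hr, hs, add_smul]
  refine ⟨⟨⟨fun p => Φ p, fun p q => ?_⟩, fun r p => ?_⟩, fun d hd => ?_⟩
  · simp
  · exact hlin r p p.2
  · exact (hΦ d 1).trans (one_smul _ _)

lemma exists_hom (hH : IsHeight I H) {L : List (ℕ × ℕ × ℕ)}
    (hL : ∀ i j, ∃ y ∈ L, y.1 ≤ i ∧ y.2.1 ≤ j ∧ y.2.2 ≤ H i j) {f i j k l w : ℕ} (hw : w < H k l)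
    (hc : closes H (i, j, H i j) (k, l, w) f [(i, j, H i j)] L = true) :
    ∃ φ : Tangent I, entry hH i j (H i j) le_rfl k l w φ = 1 ∧ ∀ i' j' k' l' w', w' < H k' l' →
      entry hH i' j' (H i' j') le_rfl k' l' w' φ ≠ 0 → 8 * i + j ≤ 8 * i' + j' ∧
        (i' = i → j' = j → k' = k ∧ l' = l ∧ w' = w) := by
  classical
  obtain ⟨G, R, hG, hR, -, hadm, hlink⟩ := closes_spec hc
  simp only [admissible, Bool.and_eq_true, Nat.ble_eq] at hadm
  let P : (Fin 3 →₀ ℕ) → Prop := fun d => ∃ x ∈ G, ex x.1 x.2.1 x.2.2 ≤ d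
  have hPle : ∀ d, P d → ex i j (H i j) ≤ d + ex k l w := by
    rintro d ⟨x, hx, hxd⟩
    refine le_trans ?_ (add_le_add_left hxd _)
    rw [ex_add, ex_le]
    exact ⟨(hadm x hx).1.1.1, (hadm x hx).1.1.2, (hadm x hx).1.2⟩
  let T : (Fin 3 →₀ ℕ) → MvPolynomial (Fin 3) ℂ ⧸ I := fun d =>
    if P d then Ideal.Quotient.mk I (monomial (d + ex k l w - ex i j (H i j)) 1) else 0
  have hT : ∀ d e, monomial d (1 : ℂ) ∈ I → T (d + e) = monomial e (1 : ℂ) • T d := by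
    intro d e hd
    by_cases hP : P d
    · have hP' : P (d + e) := hP.imp fun x hx => ⟨hx.1, hx.2.trans le_self_add⟩
      simp only [T, if_pos hP, if_pos hP']
      change _ = Ideal.Quotient.mk I (monomial e 1 * monomial _ 1)
      rw [monomial_mul, one_mul, add_right_comm, ← tsub_add_eq_add_tsub (hPle d hP), add_comm e]
    · simp only [T, if_neg hP, smul_zero]
      split_ifs with hP'
      · obtain ⟨x, hx, hxd⟩ := hP'
        obtain ⟨a, b, c, rfl⟩ : ∃ a b c, d = ex a b c := ⟨_, _, _, (ex_eta d).symm⟩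
        obtain ⟨a', b', c', rfl⟩ : ∃ a b c, e = ex a b c := ⟨_, _, _, (ex_eta e).symm⟩
        obtain ⟨y, hy, hya, hyb, hyc⟩ := hL a b
        have hyc := hyc.trans ((hH.mem_iff a b c).1 hd)
        have hyR : y ∈ R := (hR y hy).resolve_left fun h => hP ⟨y, h, ex_le.2 ⟨hya, hyb, hyc⟩⟩
        have hxy := hlink x hx y hyR
        rw [linked, ← Bool.not_eq_true, Nat.blt_eq, not_lt, ← hH.mem_iff] at hxy
        rw [Ideal.Quotient.eq_zero_iff_mem]
        refine mem_of_le hxy ?_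
        rw [ex_add, ex_le] at hxd
        rw [ex_add, ex_add, ← ex_eta (ex _ _ _ - _), ex_le]
        simp only [Finsupp.tsub_apply, ex_apply_zero, ex_apply_one, ex_apply_two]
        omega
      · rfl
  obtain ⟨φ, hφ⟩ := exists_tangent hH.monomialIdeal T hT
  have hentry : ∀ i' j' k' l' w', w' < H k' l' → entry hH i' j' (H i' j') le_rfl k' l' w' φ =
      if P (ex i' j' (H i' j')) ∧ ex i' j' (H i' j') + ex k l w - ex i j (H i j) = ex k' l' w'
        then 1 else 0 := by
    intro i' j' k' l' w' hw'
    have hn : monomial (ex k' l' w') (1 : ℂ) ∉ I := by rw [hH.mem_iff]; omega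
    change coefQ I _ (φ _) = _
    rw [hφ]
    by_cases hP : P (ex i' j' (H i' j'))
    · simp only [T, if_pos hP, coefQ_mk hH.monomialIdeal hn, coeff_monomial, hP, true_and]
    · simp [T, hP]
  refine ⟨φ, ?_, fun i' j' k' l' w' hw' h => ?_⟩
  · rw [hentry _ _ _ _ _ hw, if_pos]
    exact ⟨⟨_, hG _ (List.mem_singleton_self _), le_rfl⟩, add_tsub_cancel_left _ _⟩
  · rw [hentry _ _ _ _ _ hw', ne_eq, ite_eq_right_iff, Classical.not_imp] at h
    obtain ⟨⟨⟨x, hx, hxg⟩, he⟩, -⟩ := h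
    refine ⟨?_, ?_⟩
    · have := (hadm x hx).2
      rw [ex_le] at hxg
      omega
    · rintro rfl rfl
      rw [add_tsub_cancel_left] at he
      exact ⟨(DFunLike.congr_fun he 0).symm, (DFunLike.congr_fun he 1).symm,
        (DFunLike.congr_fun he 2).symm⟩

/-- The indices counted by `countHoms`. -/
def homIndex (H : ℕ → ℕ → ℕ) (m a : ℕ) (L : List (ℕ × ℕ × ℕ)) :
    Finset (Σ _ : (ℕ × ℕ) × (ℕ × ℕ), ℕ) :=
  (((Finset.range (m + 1) ×ˢ Finset.range (a + 1)) ×ˢ (Finset.range m ×ˢ Finset.range a)).sigma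
    fun q => Finset.range (H q.2.1 q.2.2)).filter fun r =>
      (Nat.ble (H r.1.2.1 r.1.2.2) (r.2 + gap H r.1.1.1 r.1.1.2) &&
        closes H (r.1.1.1, r.1.1.2, H r.1.1.1 r.1.1.2) (r.1.2.1, r.1.2.2, r.2) 99
          [(r.1.1.1, r.1.1.2, H r.1.1.1 r.1.1.2)] L) = true

lemma card_homIndex (m a : ℕ) (L : List (ℕ × ℕ × ℕ)) :
    (homIndex H m a L).card = countHoms H m a L := by
  simp only [homIndex, countHoms, sumTo_eq, Finset.card_filter, Finset.sum_sigma,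
    Finset.sum_product, Bool.cond_eq_ite]

theorem countHoms_le (hH : IsHeight I H) (hfin : Module.Finite ℂ (Tangent I)) {m a : ℕ}
    (ha : a < 8) {L : List (ℕ × ℕ × ℕ)}
    (hL : ∀ i j, ∃ y ∈ L, y.1 ≤ i ∧ y.2.1 ≤ j ∧ y.2.2 ≤ H i j) :
    countHoms H m a L ≤ tangentDim I := by
  classical
  have hmem : ∀ r : homIndex H m a L, r.1.1.1.2 < 8 ∧ r.1.2 < H r.1.1.2.1 r.1.1.2.2 ∧
      closes H (r.1.1.1.1, r.1.1.1.2, H r.1.1.1.1 r.1.1.1.2) (r.1.1.2.1, r.1.1.2.2, r.1.2) 99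
          [(r.1.1.1.1, r.1.1.1.2, H r.1.1.1.1 r.1.1.1.2)] L = true := by
    rintro ⟨⟨⟨⟨i, j⟩, ⟨k, l⟩⟩, w⟩, hr⟩
    simp only [homIndex, Finset.mem_filter, Finset.mem_sigma, Finset.mem_product, Finset.mem_range,
      Bool.and_eq_true] at hr
    exact ⟨by dsimp only; omega, hr.1.2, hr.2.2⟩
  choose φ hφ₁ hφ using fun r => exists_hom hH hL (hmem r).2.1 (hmem r).2.2
  have hli : LinearIndependent ℂ φ := by
    rw [Fintype.linearIndependent_iff]
    intro c hc r
    induction hn : 8 * r.1.1.1.1 + r.1.1.1.2 using Nat.strong_induction_on generalizing r with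
    | _ n ih =>
    have h := congrArg (entry hH r.1.1.1.1 r.1.1.1.2 _ le_rfl r.1.1.2.1 r.1.1.2.2 r.1.2) hc
    rw [map_sum, map_zero, Finset.sum_eq_single r, map_smul, hφ₁, smul_eq_mul, mul_one] at h
    · exact h
    · intro s _ hs
      by_contra h0
      rw [map_smul, smul_eq_mul, mul_eq_zero, not_or] at h0
      obtain ⟨hle, heq⟩ := hφ s _ _ _ _ _ (hmem r).2.1 h0.2
      rcases hle.lt_or_eq with hlt | he
      · exact h0.1 (ih _ (by omega) s rfl)
      · have h₁ := (hmem s).1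
        have h₂ := (hmem r).1
        obtain ⟨e₁, e₂, e₃⟩ := heq (by omega) (by omega)
        obtain ⟨⟨⟨⟨i, j⟩, ⟨k, l⟩⟩, w⟩, hr⟩ := r
        obtain ⟨⟨⟨⟨i', j'⟩, ⟨k', l'⟩⟩, w'⟩, hs'⟩ := s
        dsimp only at *
        obtain rfl : i' = i := by omega
        obtain rfl : j' = j := by omega
        subst e₁ e₂ e₃
        exact hs rfl
    · exact fun h => absurd (Finset.mem_univ r) h
  have := hli.fintype_card_le_finrank
  rwa [Fintype.card_coe, card_homIndex] at this

end Homs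

section Existence

variable {H : ℕ → ℕ → ℕ} {m N : ℕ}

/-- The monomial ideal with the given heights. -/
noncomputable def idealOf (H : ℕ → ℕ → ℕ) : Ideal (MvPolynomial (Fin 3) ℂ) :=
  Ideal.span ((fun s => monomial s (1 : ℂ)) '' {d : Fin 3 →₀ ℕ | H (d 0) (d 1) ≤ d 2})

lemma IsStaircase.antitone_right (hS : IsStaircase H m N) (i j : ℕ) : H i (j + 1) ≤ H i j :=
  (hS.strict i j).trans (Nat.sub_le _ _)

lemma IsStaircase.antitone (hS : IsStaircase H m N) {i j i' j' : ℕ} (hi : i ≤ i') (hj : j ≤ j') :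
    H i' j' ≤ H i j :=
  (antitone_nat_of_succ_le (hS.antitone_right i') hj).trans
    (antitone_nat_of_succ_le (f := fun i => H i j) (fun i => hS.antitone_left i j) hi)

lemma IsStaircase.mem_idealOf (hS : IsStaircase H m N) (p : MvPolynomial (Fin 3) ℂ) :
    p ∈ idealOf H ↔ ∀ d ∈ p.support, H (d 0) (d 1) ≤ d 2 := by
  rw [idealOf, mem_ideal_span_monomial_image]
  refine forall₂_congr fun d _ => ⟨?_, fun h => ⟨d, h, le_rfl⟩⟩
  rintro ⟨e, he, hed⟩
  exact (hS.antitone (hed 0) (hed 1)).trans (le_trans he (hed 2))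

lemma IsStaircase.monomial_mem_idealOf (hS : IsStaircase H m N) (d : Fin 3 →₀ ℕ) :
    monomial d (1 : ℂ) ∈ idealOf H ↔ H (d 0) (d 1) ≤ d 2 := by
  classical
  rw [hS.mem_idealOf, support_monomial, if_neg one_ne_zero]
  simp

lemma IsStaircase.isHeight (hS : IsStaircase H m N) : IsHeight (idealOf H) H where
  monomialIdeal p hp d hd :=
    (hS.monomial_mem_idealOf d).2 ((hS.mem_idealOf p).1 hp d hd)
  mem_iff _ _ _ := hS.monomial_mem_idealOf _
  antitone_left := hS.antitone_left
  antitone_right := hS.antitone_right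
  le_diag := hS.le_diag

lemma IsStaircase.isBorelFixed (hS : IsStaircase H m N) : IsBorelFixed (idealOf H) := by
  intro d hd i j hij hj
  obtain ⟨a, b, c, rfl⟩ : ∃ a b c, d = ex a b c := ⟨_, _, _, (ex_eta d).symm⟩
  rw [hS.monomial_mem_idealOf] at hd ⊢
  have hz : ∀ a b c, 0 < c → H a b ≤ c → H a (b + 1) ≤ c - 1 := fun a b c _ h =>
    (hS.strict a b).trans (Nat.sub_le_sub_right h 1)
  fin_cases i <;> fin_cases j <;> simp at hij hj hd ⊢
  · obtain ⟨b, rfl⟩ := Nat.exists_eq_succ_of_ne_zero hj.ne'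
    exact (hS.le_diag a b).trans hd
  · exact (hS.le_diag a b).trans (hz a b c hj hd)
  · exact hz a b c hj hd

lemma IsStaircase.finrank_eq (hS : IsStaircase H m N) :
    Module.finrank ℂ (MvPolynomial (Fin 3) ℂ ⧸ idealOf H) = N := by
  have hz : ∀ i j, m ≤ i ∨ H 0 0 ≤ j → H i j = 0 := by
    rintro i j (hi | hj)
    · exact hS.eq_zero_of_le hi j
    · have := hS.le_zero_zero i j
      omega
  have hmem := hS.isHeight.mem_iff
  rw [finrank_eq_ncard_compl hS.isHeight.monomialIdeal, ncard_compl hmem hz,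
    hS.sum_eq _ le_rfl]
  rw [compl_eq hmem hz]
  exact Finset.finite_toSet _

lemma ht_eq_zero {ch : List (List ℕ)} {a : ℕ} (hrow : ∀ r ∈ ch, r.length ≤ a) {i j : ℕ}
    (h : ch.length ≤ i ∨ a ≤ j) : ht ch i j = 0 := by
  change (ch.getD i []).getD j 0 = 0
  rcases lt_or_ge i ch.length with hi | hi
  · have := hrow _ (List.getElem_mem hi)
    rw [List.getD_eq_getElem _ _ hi, List.getD_eq_default]
    omega
  · rw [List.getD_eq_default _ _ hi]
    rfl

lemma isStaircase_ht {ch : List (List ℕ)} {a : ℕ} (hrow : ∀ r ∈ ch, r.length ≤ a)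
    (h0 : a ≤ ht ch 0 0) (hstrict : ∀ i < ch.length, ∀ j < a, ht ch i (j + 1) ≤ ht ch i j - 1)
    (hdiag : ∀ i < ch.length, ∀ j < a, ht ch (i + 1) j ≤ ht ch i (j + 1))
    (hpos : ∀ i < ch.length, 0 < ht ch i 0)
    (hsum : ∑ i ∈ Finset.range ch.length, ∑ j ∈ Finset.range a, ht ch i j = N) :
    IsStaircase (ht ch) ch.length N := by
  refine ⟨fun i j => ?_, fun i j => ?_, hpos, ht_eq_zero hrow (Or.inl le_rfl), fun K hK => ?_⟩
  · by_cases h : i < ch.length ∧ j < a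
    · exact hstrict i h.1 j h.2
    · rw [ht_eq_zero hrow (by omega)]
      exact Nat.zero_le _
  · by_cases h : i < ch.length ∧ j < a
    · exact hdiag i h.1 j h.2
    · rw [ht_eq_zero hrow (by omega)]
      exact Nat.zero_le _
  · rw [← hsum]
    refine Finset.sum_congr rfl fun i _ => (Finset.sum_subset ?_ fun j _ hj => ?_).symm
    · exact Finset.range_mono (h0.trans hK)
    · exact ht_eq_zero hrow (Or.inr (by simpa using hj))

theorem tmaxEq_of_chain {m T : ℕ} {ch : List (List ℕ)} (hlen : ch.length = m + 1)
    (hcheck : chainAll m (List.replicate 34 34) 34 (good (m + 1) T) = true)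
    (hrow : ∀ r ∈ ch, r.length ≤ 5) (hS : IsStaircase (ht ch) ch.length 34)
    (hgen : ∀ i ≤ m + 1, ∀ j ≤ 5, ∃ y ∈ generators (ht ch) (m + 1) 5,
      y.1 ≤ i ∧ y.2.1 ≤ j ∧ y.2.2 ≤ ht ch i j)
    (hT : countHoms (ht ch) (m + 1) 5 (generators (ht ch) (m + 1) 5) = T) :
    TmaxEq 34 (m + 1) T := by
  have hH := hS.isHeight
  have hm : (X 0 : MvPolynomial (Fin 3) ℂ) ^ (m + 1) ∈ idealOf (ht ch) := by
    rw [X_pow_eq, hH.mem_iff, ← hlen, hS.zero]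
  have hm' : (X 0 : MvPolynomial (Fin 3) ℂ) ^ m ∉ idealOf (ht ch) := by
    rw [X_pow_eq, hH.mem_iff, not_le]
    exact hS.pos m (by omega)
  have hfin : Module.Finite ℂ (Tangent (idealOf (ht ch))) :=
    (finite_and_le_fullBound hH (fun φ => vanishes_zeroHt (φ := φ) 0) hS.eq_zero).1
  refine ⟨⟨idealOf (ht ch), hH.monomialIdeal, hS.isBorelFixed, hS.finrank_eq, hm, hm', ?_⟩, ?_⟩
  · refine le_antisymm ?_
      (tangentDim_le hcheck hH.monomialIdeal hS.isBorelFixed hS.finrank_eq hm hm')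
    rw [← hT]
    refine countHoms_le hH hfin (by norm_num) fun i j => ?_
    obtain ⟨y, hy, hi, hj, hk⟩ := hgen (min i (m + 1)) (min_le_right _ _) (min j 5)
      (min_le_right _ _)
    refine ⟨y, hy, hi.trans (min_le_left _ _), hj.trans (min_le_left _ _), hk.trans ?_⟩
    by_cases h : i ≤ m + 1 ∧ j ≤ 5
    · rw [min_eq_left h.1, min_eq_left h.2]
    · rw [ht_eq_zero hrow (by omega)]
      exact Nat.zero_le _
  · rintro t ⟨I, hI, hB, hN, hm, hm', rfl⟩
    exact tangentDim_le hcheck hI hB hN hm hm'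

end Existence

lemma tangentDim_le_of_one {t : ℕ} (ht : TmaxEq 34 1 t) : t ≤ 165 := by
  obtain ⟨I, hI, hB, hN, hm, hm', rfl⟩ := ht.1
  exact tangentDim_le (m := 0) (by decide +kernel) hI hB hN hm hm'

lemma tmaxEq_two : TmaxEq 34 2 166 :=
  tmaxEq_of_chain (m := 1) (ch := [[8, 6, 4, 2, 1], [6, 4, 2, 1]]) rfl (by decide +kernel)
    (by decide) (isStaircase_ht (a := 5) (by decide) (by decide) (by decide) (by decide)
      (by decide) (by decide)) (by decide) (by decide +kernel)

lemma tmaxEq_three : TmaxEq 34 3 216 :=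
  tmaxEq_of_chain (m := 2) (ch := [[6, 5, 4, 2, 1], [4, 3, 2, 1], [3, 2, 1]]) rfl
    (by decide +kernel) (by decide) (isStaircase_ht (a := 5) (by decide) (by decide) (by decide)
      (by decide) (by decide) (by decide)) (by decide) (by decide +kernel)

lemma tmaxEq_four : TmaxEq 34 4 276 :=
  tmaxEq_of_chain (m := 3) (ch := [[5, 4, 3, 2, 1], [4, 3, 2, 1], [3, 2, 1], [2, 1]]) rfl
    (by decide +kernel) (by decide) (isStaircase_ht (a := 5) (by decide) (by decide) (by decide)
      (by decide) (by decide) (by decide)) (by decide) (by decide +kernel)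

end BorelTangent

theorem Tmax_monotonicity_l34 :
    TmaxEq 34 2 166 ∧
    TmaxEq 34 3 216 ∧
    TmaxEq 34 4 276 ∧
    (∀ T1 T2 T3 T4 : ℕ, TmaxEq 34 1 T1 → TmaxEq 34 2 T2 → TmaxEq 34 3 T3 → TmaxEq 34 4 T4 →
      T1 < T2 ∧ T2 < T3 ∧ T3 < T4) := by
  refine ⟨BorelTangent.tmaxEq_two, BorelTangent.tmaxEq_three, BorelTangent.tmaxEq_four, ?_⟩
  intro T1 T2 T3 T4 h1 h2 h3 h4
  have h1 := BorelTangent.tangentDim_le_of_one h1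
  have h2 := h2.unique BorelTangent.tmaxEq_two
  have h3 := h3.unique BorelTangent.tmaxEq_three
  have h4 := h4.unique BorelTangent.tmaxEq_four
  omega
end
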